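/- Let $2\le k\le d$ and let $n=(n_1,\dots,n_d)$ with $n_d=1$, where the coordinates $n_i$ are real algebraic numbers spanning a $\mathbb{Q}$-vector space of dimension $k$. Then there is a constant $K''>0$ (depending on $n$ and $\varepsilon$) such that for every $R>1$ and any two lattice points $c,c'\in\mathbb{Z}^d$ with $|c-c'|\le 2R$ and $\langle c-c',n\rangle\neq 0$, one has $\left|\left\langle c-c',\frac{n}{|n|}\right\rangle\right|\ge \frac{K''}{R^{k-1+\varepsilon}}$. -/

import Mathlib

namespace Sch
open MvPolynomial

section wnorm
variable {σ τ R R' : Type*} [CommRing R] [CommRing R']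

/-- weight of a monomial -/
noncomputable def mw (w : σ → ℝ) (b : σ →₀ ℕ) : ℝ := b.prod fun i e => w i ^ e

lemma mw_add (w : σ → ℝ) (a b : σ →₀ ℕ) : mw w (a + b) = mw w a * mw w b := by
  classical
  unfold mw
  exact Finsupp.prod_add_index' (by simp) (by intros; exact pow_add _ _ _)

lemma mw_zero (w : σ → ℝ) : mw w 0 = 1 := by simp [mw]

lemma mw_nonneg {w : σ → ℝ} (hw : ∀ i, 0 ≤ w i) (b : σ →₀ ℕ) : 0 ≤ mw w b :=
  Finset.prod_nonneg fun i _ => pow_nonneg (hw i) _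

lemma mw_pos {w : σ → ℝ} (hw : ∀ i, 0 < w i) (b : σ →₀ ℕ) : 0 < mw w b :=
  Finset.prod_pos fun i _ => pow_pos (hw i) _

lemma mw_one (b : σ →₀ ℕ) : mw (fun _ => 1) b = 1 := by simp [mw]

/-- weighted l1 norm of a polynomial -/
noncomputable def wnorm (N : RingSeminorm R) (w : σ → ℝ) (f : MvPolynomial σ R) : ℝ :=
  ∑ b ∈ f.support, N (f.coeff b) * mw w b

variable (N : RingSeminorm R) (N' : RingSeminorm R')

lemma wnorm_eq_of_subset (w : σ → ℝ) (f : MvPolynomial σ R) (s : Finset (σ →₀ ℕ))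
    (hs : f.support ⊆ s) : wnorm N w f = ∑ b ∈ s, N (f.coeff b) * mw w b := by
  unfold wnorm
  apply Finset.sum_subset hs
  intro b _ hb
  rw [notMem_support_iff.mp hb, map_zero, zero_mul]

lemma wnorm_nonneg {w : σ → ℝ} (hw : ∀ i, 0 ≤ w i) (f : MvPolynomial σ R) : 0 ≤ wnorm N w f :=
  Finset.sum_nonneg fun b _ => mul_nonneg (apply_nonneg N _) (mw_nonneg hw b)

lemma wnorm_zero (w : σ → ℝ) : wnorm N w (0 : MvPolynomial σ R) = 0 := by simp [wnorm]

lemma wnorm_add_le {w : σ → ℝ} (hw : ∀ i, 0 ≤ w i) (f g : MvPolynomial σ R) :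
    wnorm N w (f + g) ≤ wnorm N w f + wnorm N w g := by
  classical
  rw [wnorm_eq_of_subset N w (f + g) (f.support ∪ g.support) support_add,
    wnorm_eq_of_subset N w f (f.support ∪ g.support) Finset.subset_union_left,
    wnorm_eq_of_subset N w g (f.support ∪ g.support) Finset.subset_union_right,
    ← Finset.sum_add_distrib]
  apply Finset.sum_le_sum
  intro b _
  rw [coeff_add, ← add_mul]
  exact mul_le_mul_of_nonneg_right (map_add_le_add N _ _) (mw_nonneg hw b)

lemma wnorm_neg (w : σ → ℝ) (f : MvPolynomial σ R) : wnorm N w (-f) = wnorm N w f := by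
  unfold wnorm
  rw [support_neg]
  exact Finset.sum_congr rfl fun b _ => by rw [coeff_neg, map_neg_eq_map]

lemma wnorm_sum_le {w : σ → ℝ} (hw : ∀ i, 0 ≤ w i) {ι : Type*} (s : Finset ι)
    (f : ι → MvPolynomial σ R) : wnorm N w (∑ i ∈ s, f i) ≤ ∑ i ∈ s, wnorm N w (f i) := by
  classical
  induction s using Finset.induction_on with
  | empty => simp [wnorm_zero]
  | insert a s ha ih =>
    rw [Finset.sum_insert ha, Finset.sum_insert ha]
    exact (wnorm_add_le N hw _ _).trans (by gcongr)

lemma wnorm_monomial (w : σ → ℝ) (b : σ →₀ ℕ) (c : R) :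
    wnorm N w (monomial b c) = N c * mw w b := by
  classical
  rw [wnorm_eq_of_subset N w _ {b} support_monomial_subset]
  simp

lemma wnorm_C (w : σ → ℝ) (c : R) : wnorm N w (C c : MvPolynomial σ R) = N c := by
  rw [C_apply, wnorm_monomial, mw_zero, mul_one]

lemma wnorm_X_le {w : σ → ℝ} (hw : ∀ i, 0 ≤ w i) (h1 : N 1 ≤ 1) (i : σ) :
    wnorm N w (X i : MvPolynomial σ R) ≤ w i := by
  rw [X, wnorm_monomial]
  have : mw w (Finsupp.single i 1) = w i := by simp [mw]
  rw [this]
  exact mul_le_of_le_one_left (hw i) h1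

lemma wnorm_mul_le {w : σ → ℝ} (hw : ∀ i, 0 ≤ w i) (f g : MvPolynomial σ R) :
    wnorm N w (f * g) ≤ wnorm N w f * wnorm N w g := by
  classical
  have : f * g = ∑ a ∈ f.support, ∑ b ∈ g.support, monomial (a + b) (f.coeff a * g.coeff b) := by
    conv_lhs => rw [f.as_sum, g.as_sum]
    rw [Finset.sum_mul_sum]
    simp [monomial_mul]
  rw [this]
  refine (wnorm_sum_le N hw _ _).trans ?_
  unfold wnorm
  rw [Finset.sum_mul_sum]
  apply Finset.sum_le_sum
  intro a _
  refine (wnorm_sum_le N hw _ _).trans ?_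
  apply Finset.sum_le_sum
  intro b _
  rw [wnorm_monomial, mw_add]
  calc _ ≤ (N (f.coeff a) * N (g.coeff b)) * (mw w a * mw w b) :=
        mul_le_mul_of_nonneg_right (map_mul_le_mul N _ _)
          (mul_nonneg (mw_nonneg hw _) (mw_nonneg hw _))
    _ = _ := by ring

lemma wnorm_one_le {w : σ → ℝ} (h1 : N 1 ≤ 1) :
    wnorm N w (1 : MvPolynomial σ R) ≤ 1 := by
  rw [← C_1, wnorm_C]; exact h1

lemma wnorm_prod_le {w : σ → ℝ} (hw : ∀ i, 0 ≤ w i) (h1 : N 1 ≤ 1) {ι : Type*} (s : Finset ι)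
    (f : ι → MvPolynomial σ R) : wnorm N w (∏ i ∈ s, f i) ≤ ∏ i ∈ s, wnorm N w (f i) := by
  classical
  induction s using Finset.induction_on with
  | empty => simpa using wnorm_one_le N h1
  | insert a s ha ih =>
    rw [Finset.prod_insert ha, Finset.prod_insert ha]
    exact (wnorm_mul_le N hw _ _).trans
      (mul_le_mul_of_nonneg_left ih (wnorm_nonneg N hw _))

lemma wnorm_pow_le {w : σ → ℝ} (hw : ∀ i, 0 ≤ w i) (h1 : N 1 ≤ 1) (n : ℕ)
    (f : MvPolynomial σ R) : wnorm N w (f ^ n) ≤ wnorm N w f ^ n := by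
  have := wnorm_prod_le N hw h1 (Finset.range n) (fun _ => f)
  simpa using this

lemma coeff_le_wnorm {w : σ → ℝ} (hw : ∀ i, 0 ≤ w i) (f : MvPolynomial σ R) (b : σ →₀ ℕ) :
    N (f.coeff b) * mw w b ≤ wnorm N w f := by
  by_cases hb : b ∈ f.support
  · exact Finset.single_le_sum (f := fun b => N (f.coeff b) * mw w b)
      (fun b _ => mul_nonneg (apply_nonneg N _) (mw_nonneg hw b)) hb
  · rw [notMem_support_iff.mp hb, map_zero, zero_mul]; exact wnorm_nonneg N hw f

lemma wnorm_mono {w w' : σ → ℝ} (hw : ∀ i, 0 ≤ w i) (h : ∀ i, w i ≤ w' i)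
    (f : MvPolynomial σ R) : wnorm N w f ≤ wnorm N w' f := by
  apply Finset.sum_le_sum
  intro b _
  apply mul_le_mul_of_nonneg_left _ (apply_nonneg N _)
  exact Finset.prod_le_prod (fun i _ => pow_nonneg (hw i) _)
    fun i _ => pow_le_pow_left₀ (hw i) (h i) _

/-- general substitution bound -/
lemma wnorm_eval₂_le {w : σ → ℝ} {w' : τ → ℝ} (hw' : ∀ i, 0 ≤ w' i) (h1 : N' 1 ≤ 1)
    (φ : R →+* MvPolynomial τ R') (g : σ → MvPolynomial τ R')
    (hφ : ∀ c, wnorm N' w' (φ c) ≤ N c) (hg : ∀ i, wnorm N' w' (g i) ≤ w i)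
    (f : MvPolynomial σ R) : wnorm N' w' (eval₂ φ g f) ≤ wnorm N w f := by
  rw [eval₂_eq]
  refine (wnorm_sum_le N' hw' _ _).trans ?_
  apply Finset.sum_le_sum
  intro b _
  refine (wnorm_mul_le N' hw' _ _).trans ?_
  apply mul_le_mul (hφ _) _ (wnorm_nonneg N' hw' _) (apply_nonneg N _)
  refine (wnorm_prod_le N' hw' h1 _ _).trans ?_
  unfold mw Finsupp.prod
  apply Finset.prod_le_prod
  · intro i _; exact wnorm_nonneg N' hw' _
  · intro i _
    exact (wnorm_pow_le N' hw' h1 _ _).trans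
      (pow_le_pow_left₀ (wnorm_nonneg N' hw' _) (hg i) _)

/-- l1 norm as ring seminorm -/
noncomputable def l1 (σ : Type*) (N : RingSeminorm R) : RingSeminorm (MvPolynomial σ R) where
  toFun := wnorm N (fun _ => 1)
  map_zero' := wnorm_zero N _
  add_le' := wnorm_add_le N (fun _ => zero_le_one)
  neg' := wnorm_neg N _
  mul_le' := wnorm_mul_le N (fun _ => zero_le_one)

lemma l1_apply (f : MvPolynomial σ R) : l1 σ N f = wnorm N (fun _ => 1) f := rfl

lemma l1_one_le (h1 : N 1 ≤ 1) : l1 σ N 1 ≤ 1 := wnorm_one_le N h1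

lemma coeff_le_l1 (f : MvPolynomial σ R) (b : σ →₀ ℕ) : N (f.coeff b) ≤ l1 σ N f := by
  have := coeff_le_wnorm N (w := fun _ => 1) (fun _ => zero_le_one) f b
  rwa [mw_one, mul_one] at this

end wnorm

/-- absolute value on the integers -/
noncomputable def absZ : RingSeminorm ℤ where
  toFun x := |(x : ℝ)|
  map_zero' := by simp
  add_le' x y := by push_cast; exact abs_add_le _ _
  neg' x := by simp
  mul_le' x y := by push_cast; rw [abs_mul]

/-- absolute value on the reals -/
noncomputable def absR : RingSeminorm ℝ where
  toFun x := |x|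
  map_zero' := by simp
  add_le' x y := abs_add_le _ _
  neg' x := by simp
  mul_le' x y := by rw [abs_mul]

lemma absZ_apply (x : ℤ) : absZ x = |(x : ℝ)| := rfl
lemma absR_apply (x : ℝ) : absR x = |x| := rfl

end Sch


namespace Sch
open MvPolynomial

section hasse
variable {σ R : Type*} [Fintype σ] [CommRing R]

/-- product of binomials -/
def bin (b μ : σ →₀ ℕ) : ℕ := ∏ i, (b i).choose (μ i)

lemma bin_eq_zero {b μ : σ →₀ ℕ} (h : ¬ μ ≤ b) : bin b μ = 0 := by
  rw [Finsupp.le_def] at h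
  push Not at h
  obtain ⟨i, hi⟩ := h
  exact Finset.prod_eq_zero (Finset.mem_univ i) (Nat.choose_eq_zero_of_lt hi)

lemma bin_pos {b μ : σ →₀ ℕ} (h : μ ≤ b) : 0 < bin b μ :=
  Finset.prod_pos fun i _ => Nat.choose_pos (h i)

lemma bin_le (b μ : σ →₀ ℕ) : bin b μ ≤ 2 ^ b.degree := by
  rw [Finsupp.degree_eq_sum, ← Finset.prod_pow_eq_pow_sum]
  exact Finset.prod_le_prod' fun i _ => Nat.choose_le_two_pow _ _

lemma bin_mul (c b μ : σ →₀ ℕ) :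
    bin (c + b) b * bin (c + b + μ) μ = bin (b + μ) μ * bin (c + (b + μ)) (b + μ) := by
  unfold bin
  rw [← Finset.prod_mul_distrib, ← Finset.prod_mul_distrib]
  refine Finset.prod_congr rfl fun i _ => ?_
  simp only [Finsupp.add_apply]
  have := Nat.choose_mul (n := c i + b i + μ i) (k := b i + μ i) (s := μ i) (by omega)
  rw [show c i + (b i + μ i) = c i + b i + μ i by ring]
  rw [show c i + b i + μ i - μ i = c i + b i by omega, show b i + μ i - μ i = b i by omega] at this
  rw [mul_comm, ← this, mul_comm]

/-- Hasse derivative -/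
noncomputable def hD (μ : σ →₀ ℕ) (f : MvPolynomial σ R) : MvPolynomial σ R :=
  ∑ b ∈ f.support, monomial (b - μ) ((bin b μ : R) * f.coeff b)

lemma coeff_hD (μ : σ →₀ ℕ) (f : MvPolynomial σ R) (c : σ →₀ ℕ) :
    (hD μ f).coeff c = (bin (c + μ) μ : R) * f.coeff (c + μ) := by
  classical
  unfold hD
  rw [coeff_sum]
  simp only [coeff_monomial]
  rw [Finset.sum_eq_single (c + μ)]
  · simp
  · intro b _ hb
    by_cases h : μ ≤ b
    · rw [if_neg]
      rintro rfl
      exact hb (tsub_add_cancel_of_le h).symm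
    · simp [bin_eq_zero h]
  · intro h
    rw [notMem_support_iff.mp h]; simp

lemma hD_add (μ : σ →₀ ℕ) (f g : MvPolynomial σ R) : hD μ (f + g) = hD μ f + hD μ g := by
  ext c; simp [coeff_hD, mul_add]

lemma hD_smul (μ : σ →₀ ℕ) (a : R) (f : MvPolynomial σ R) : hD μ (a • f) = a • hD μ f := by
  ext c; simp [coeff_hD, mul_left_comm]

/-- Hasse derivative as a linear map -/
noncomputable def hDl (μ : σ →₀ ℕ) : MvPolynomial σ R →ₗ[R] MvPolynomial σ R where
  toFun := hD μ
  map_add' := hD_add μ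
  map_smul' := hD_smul μ

lemma hD_hD (b μ : σ →₀ ℕ) (f : MvPolynomial σ R) :
    hD b (hD μ f) = (bin (b + μ) μ : R) • hD (b + μ) f := by
  ext c
  rw [coeff_smul, coeff_hD, coeff_hD, coeff_hD, smul_eq_mul, ← mul_assoc, ← mul_assoc,
    ← Nat.cast_mul, ← Nat.cast_mul, bin_mul, add_assoc]

/-- translation -/
noncomputable def trans (ξ : σ → R) : MvPolynomial σ R →ₐ[R] MvPolynomial σ R :=
  aeval fun i => X i + C (ξ i)

lemma coeff_trans_monomial (ξ : σ → R) (c : σ →₀ ℕ) (a : R) (b : σ →₀ ℕ) :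
    (trans ξ (monomial c a)).coeff b = (bin c b : R) * a * ∏ i, ξ i ^ (c i - b i) := by
  classical
  unfold trans
  rw [aeval_monomial, Finsupp.prod_fintype _ _ (by simp)]
  simp only [add_pow]
  rw [Finset.prod_univ_sum, algebraMap_eq, coeff_C_mul, coeff_sum]
  have key : ∀ p : σ → ℕ, (∏ i, ((X i : MvPolynomial σ R) ^ p i * C (ξ i) ^ (c i - p i) *
      ((c i).choose (p i) : MvPolynomial σ R))) =
      monomial (Finsupp.equivFunOnFinite.symm p) (∏ i, (ξ i ^ (c i - p i) * ((c i).choose (p i) : R))) := by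
    intro p
    rw [monomial_eq, Finsupp.prod_fintype _ _ (by simp), map_prod, ← Finset.prod_mul_distrib]
    refine Finset.prod_congr rfl fun i _ => ?_
    simp
    ring
  simp only [key, coeff_monomial]
  by_cases hb : b ≤ c
  · rw [Finset.sum_eq_single (b : σ → ℕ)]
    · rw [if_pos (by ext; simp), Finset.prod_mul_distrib, bin]
      push_cast
      ring
    · intro p _ hp
      rw [if_neg]
      rintro rfl
      exact hp (by ext; simp)
    · intro h
      exfalso
      apply h
      simp only [Fintype.mem_piFinset, Finset.mem_range]
      intro i
      exact Nat.lt_succ_of_le (hb i)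
  · rw [bin_eq_zero hb, Finset.sum_eq_zero]
    · simp
    · intro p hp
      rw [if_neg]
      rintro rfl
      apply hb
      intro i
      simp only [Fintype.mem_piFinset, Finset.mem_range] at hp
      simpa using Nat.lt_succ_iff.mp (hp i)

lemma coeff_trans (ξ : σ → R) (f : MvPolynomial σ R) (b : σ →₀ ℕ) :
    (trans ξ f).coeff b = eval ξ (hD b f) := by
  classical
  conv_lhs => rw [f.as_sum]
  rw [map_sum, coeff_sum]
  unfold hD
  rw [map_sum]
  refine Finset.sum_congr rfl fun c _ => ?_
  rw [coeff_trans_monomial, eval_monomial, Finsupp.prod_fintype _ _ (by simp)]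
  rfl

lemma coeff_trans_hD (ξ : σ → R) (f : MvPolynomial σ R) (b μ : σ →₀ ℕ) :
    (trans ξ (hD μ f)).coeff b = (bin (b + μ) μ : R) * (trans ξ f).coeff (b + μ) := by
  rw [coeff_trans, coeff_trans, hD_hD, smul_eval]

lemma seminorm_natCast_mul_le (N : RingSeminorm R) (n : ℕ) (x : R) :
    N ((n : R) * x) ≤ n * N x := by
  induction n with
  | zero => simp
  | succ n ih =>
    push_cast
    rw [add_mul, add_mul, one_mul, one_mul]
    exact (map_add_le_add N _ _).trans (by gcongr)

lemma l1_hD_le (N : RingSeminorm R) (μ : σ →₀ ℕ) (f : MvPolynomial σ R) (D : ℕ)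
    (hf : ∀ b, f.coeff b ≠ 0 → b.degree ≤ D) : l1 σ N (hD μ f) ≤ 2 ^ D * l1 σ N f := by
  rw [l1_apply, l1_apply]
  unfold hD
  refine (wnorm_sum_le N (fun _ => zero_le_one) _ _).trans ?_
  unfold wnorm
  rw [Finset.mul_sum]
  apply Finset.sum_le_sum
  intro b hb
  have h1 := wnorm_monomial N (fun _ => 1) (b - μ) ((bin b μ : R) * f.coeff b)
  unfold wnorm at h1
  rw [h1, mw_one, mw_one, mul_one, mul_one]
  refine (seminorm_natCast_mul_le N _ _).trans ?_
  apply mul_le_mul_of_nonneg_right _ (apply_nonneg N _)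
  calc ((bin b μ : ℕ) : ℝ) ≤ ((2 ^ b.degree : ℕ) : ℝ) := by exact_mod_cast bin_le b μ
    _ ≤ 2 ^ D := by
      push_cast
      exact pow_le_pow_right₀ one_le_two (hf b (mem_support_iff.mp hb))

end hasse
end Sch


namespace Sch
open MvPolynomial

lemma exists_det_ne_zero {K I : Type*} [Field K] {s : ℕ} (v : I → Fin s → K)
    (h : ∀ y : Fin s → K, (∀ i, ∑ l, y l * v i l = 0) → y = 0) :
    ∃ i : Fin s → I, (Matrix.of fun a l => v (i a) l).det ≠ 0 := by
  classical
  have hspan : Submodule.span K (Set.range v) = ⊤ := by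
    by_contra hne
    obtain ⟨f, f0, hf⟩ := Submodule.exists_le_ker_of_lt_top _ (lt_top_iff_ne_top.mpr hne)
    apply f0
    have h1 : (fun l => f (Pi.single l 1)) = 0 := by
      apply h
      intro i
      have h2 : f (v i) = 0 := hf (Submodule.subset_span ⟨i, rfl⟩)
      rw [← h2]
      conv_rhs => rw [pi_eq_sum_univ' (v i), map_sum]
      refine Finset.sum_congr rfl fun l _ => ?_
      rw [map_smul, smul_eq_mul, mul_comm]
    apply LinearMap.pi_ext'
    intro l
    ext
    simpa using congrFun h1 l
  obtain ⟨b, hb, hbs, hbi⟩ := exists_linearIndependent K (Set.range v)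
  let B := Module.Basis.mk hbi (by rw [Subtype.range_coe, hbs, hspan])
  haveI : Fintype b := FiniteDimensional.fintypeBasisIndex B
  have hcard : Fintype.card b = s := by
    rw [← Module.finrank_eq_card_basis B]; simp
  let E : Fin s ≃ b := (Fintype.equivFinOfCardEq hcard).symm
  choose i hi using fun a : Fin s => hb (E a).2
  refine ⟨i, ?_⟩
  have h3 : LinearIndependent K (fun a => v (i a)) := by
    have : (fun a => v (i a)) = ((↑) : b → (Fin s → K)) ∘ E := by
      ext a; simp [hi]
    rw [this]
    exact hbi.comp _ E.injective
  have h4 := Matrix.linearIndependent_rows_iff_isUnit (A := Matrix.of fun a l => v (i a) l) |>.mp h3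
  exact ((Matrix.isUnit_iff_isUnit_det _).mp h4).ne_zero

section wronskian
variable {σ K : Type*} [Fintype σ] [Field K] [CharZero K]

lemma bin_rec (c μ : σ →₀ ℕ) (h : σ) (a : K) :
    ((c h : K) - a) * bin c μ =
      ((μ h : K) + 1) * bin c (μ + Finsupp.single h 1) + ((μ h : K) - a) * bin c μ := by
  classical
  have key : (μ h + 1) * bin c (μ + Finsupp.single h 1) + μ h * bin c μ = c h * bin c μ := by
    unfold bin
    rw [← Finset.mul_prod_erase _ _ (Finset.mem_univ h),
      ← Finset.mul_prod_erase _ (fun i => (c i).choose (μ i)) (Finset.mem_univ h)]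
    have : ∏ x ∈ Finset.univ.erase h, (c x).choose ((μ + Finsupp.single h 1 : σ →₀ ℕ) x) =
        ∏ x ∈ Finset.univ.erase h, (c x).choose (μ x) := by
      refine Finset.prod_congr rfl fun x hx => ?_
      simp [Finsupp.single_apply, (Finset.ne_of_mem_erase hx).symm]
    rw [this]
    simp only [Finsupp.add_apply, Finsupp.single_eq_same]
    have h2 := Nat.choose_succ_right_eq (c h) (μ h)
    rcases le_or_gt (μ h) (c h) with h3 | h3
    · obtain ⟨t, ht⟩ := Nat.exists_eq_add_of_le h3
      rw [← mul_assoc, mul_comm (μ h + 1), h2, ← mul_assoc, ← mul_assoc, ← add_mul, ht]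
      congr 1
      rw [show μ h + t - μ h = t by omega]
      ring
    · rw [Nat.choose_eq_zero_of_lt h3, Nat.choose_eq_zero_of_lt (by omega)]; simp
  have k2 : ((μ h : K) + 1) * bin c (μ + Finsupp.single h 1) + μ h * bin c μ = c h * bin c μ := by
    exact_mod_cast key
  linear_combination -k2

lemma exists_bin_det {s : ℕ} (e : Fin s → (σ →₀ ℕ)) (he : Function.Injective e) :
    ∃ μ : Fin s → (σ →₀ ℕ), (∀ i, (μ i).degree < s) ∧
      (Matrix.of fun i l => (bin (e l) (μ i) : K)).det ≠ 0 := by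
  classical
  obtain ⟨i, hi⟩ := exists_det_ne_zero (K := K) (I := {μ : σ →₀ ℕ // μ.degree < s})
    (fun μ l => (bin (e l) μ : K)) (by
    intro y hy
    have key : ∀ (h : Fin s → σ) (T : Finset (Fin s)) (μ : σ →₀ ℕ), μ.degree + T.card < s →
        ∑ l, y l * ((∏ l' ∈ T, ((e l (h l') : K) - (e l' (h l') : K))) * bin (e l) μ) = 0 := by
      intro h T
      induction T using Finset.induction_on with
      | empty =>
        intro μ hμ
        simpa using hy ⟨μ, by simpa using hμ⟩
      | insert a T ha ih =>
        intro μ hμ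
        rw [Finset.card_insert_of_notMem ha] at hμ
        have h1 := ih (μ + Finsupp.single (h a) 1) (by
          rw [map_add, Finsupp.degree_single]; omega)
        have h2 := ih μ (by omega)
        calc _ = ((μ (h a) : K) + 1) * ∑ l, y l * ((∏ l' ∈ T, ((e l (h l') : K) - (e l' (h l') : K))) *
              bin (e l) (μ + Finsupp.single (h a) 1)) + ((μ (h a) : K) - e a (h a)) *
              ∑ l, y l * ((∏ l' ∈ T, ((e l (h l') : K) - (e l' (h l') : K))) * bin (e l) μ) := by
              rw [Finset.mul_sum, Finset.mul_sum, ← Finset.sum_add_distrib]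
              refine Finset.sum_congr rfl fun l _ => ?_
              rw [Finset.prod_insert ha]
              linear_combination (y l * ∏ l' ∈ T, ((e l (h l') : K) - (e l' (h l') : K))) *
                bin_rec (e l) μ (h a) (e a (h a) : K)
          _ = 0 := by rw [h1, h2]; simp
    funext l
    rcases isEmpty_or_nonempty σ with hσ | hσ
    · have hsub : Subsingleton (Fin s) := ⟨fun a b => he (Subsingleton.elim _ _)⟩
      have := hy ⟨0, by simpa using l.pos⟩
      rw [Fintype.sum_subsingleton _ l] at this
      simpa [bin] using this
    have hex : ∀ l', ∃ h, l' ≠ l → e l h ≠ e l' h := by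
      intro l'
      by_cases hl : l' = l
      · exact ⟨hσ.some, fun h => absurd hl h⟩
      · have : e l ≠ e l' := fun h => hl (he h).symm
        obtain ⟨h, hh⟩ := Finsupp.ne_iff.mp this
        exact ⟨h, fun _ => hh⟩
    choose h hh using hex
    have := key h (Finset.univ.erase l) 0 (by
      have := l.pos
      rw [Finset.card_erase_of_mem (Finset.mem_univ l)]; simp; omega)
    rw [Finset.sum_eq_single l] at this
    · rcases mul_eq_zero.mp this with h0 | h0
      · exact h0
      · exfalso
        rcases mul_eq_zero.mp h0 with h0 | h0
        · obtain ⟨l', hl', h0⟩ := Finset.prod_eq_zero_iff.mp h0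
          apply hh l' (Finset.ne_of_mem_erase hl')
          exact_mod_cast sub_eq_zero.mp h0
        · simp [bin] at h0
    · intro l2 _ hl2
      rw [Finset.prod_eq_zero (Finset.mem_erase.mpr ⟨hl2, Finset.mem_univ _⟩) (sub_self _)]
      simp
    · simp)
  exact ⟨fun a => (i a).1, fun a => (i a).2, hi⟩

lemma exists_echelon [LinearOrder σ] {s : ℕ} (φ : Fin s → MvPolynomial σ K)
    (hφ : LinearIndependent K φ) (mo : MonomialOrder σ) :
    ∃ (P : Fin s → Fin s → K), (∀ l, ∑ i, P l i • φ i ≠ 0) ∧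
      Function.Injective fun l => mo.degree (∑ i, P l i • φ i) := by
  classical
  let Z : Finset (σ →₀ ℕ) := Finset.univ.biUnion fun i => (φ i).support
  let E : Finset (σ →₀ ℕ) := Z.filter fun e => ∃ P : Fin s → K, ∑ i, P i • φ i ≠ 0 ∧
    mo.degree (∑ i, P i • φ i) = e
  have hE : s ≤ E.card := by
    by_contra hlt
    push Not at hlt
    let T : (Fin s → K) →ₗ[K] (E → K) :=
      { toFun := fun P e => (∑ i, P i • φ i).coeff e.1
        map_add' := by intro P Q; ext e; simp [add_mul, Finset.sum_add_distrib, coeff_sum]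
        map_smul' := by intro a P; ext e; simp [coeff_sum, Finset.mul_sum, mul_assoc] }
    have := LinearMap.ker_ne_bot_of_finrank_lt (f := T) (by simpa using hlt)
    obtain ⟨P, hP, hP0⟩ := (Submodule.ne_bot_iff _).mp this
    have hne : ∑ i, P i • φ i ≠ 0 := by
      intro h0
      apply hP0
      funext i
      exact Fintype.linearIndependent_iff.mp hφ P h0 i
    have hmem : mo.degree (∑ i, P i • φ i) ∈ E := by
      refine Finset.mem_filter.mpr ⟨?_, P, hne, rfl⟩
      have h1 := mo.degree_mem_support hne
      rw [mem_support_iff, coeff_sum] at h1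
      obtain ⟨i, _, hi⟩ := Finset.exists_ne_zero_of_sum_ne_zero h1
      refine Finset.mem_biUnion.mpr ⟨i, Finset.mem_univ _, mem_support_iff.mpr ?_⟩
      intro h2
      apply hi
      simp [h2]
    have h2 : T P = 0 := hP
    have h3 := congrFun h2 ⟨_, hmem⟩
    exact mo.coeff_degree_ne_zero_iff.mpr hne h3
  obtain ⟨E', hE', hc⟩ := Finset.exists_subset_card_eq hE
  let ee : Fin s ≃ E' := (Finset.equivFinOfCardEq hc).symm
  choose P hP using fun l => (Finset.mem_filter.mp (hE' (ee l).2)).2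
  refine ⟨P, fun l => (hP l).1, ?_⟩
  intro l l' h
  simp only [(hP _).2] at h
  exact ee.injective (Subtype.ext h)

lemma coeff_prod_of_le {ι : Type*} (mo : MonomialOrder σ) (S : Finset ι) (f : ι → MvPolynomial σ K)
    (e : ι → (σ →₀ ℕ)) (h : ∀ i ∈ S, mo.toSyn (mo.degree (f i)) ≤ mo.toSyn (e i)) :
    (∏ i ∈ S, f i).coeff (∑ i ∈ S, e i) = ∏ i ∈ S, (f i).coeff (e i) ∧
      mo.toSyn (mo.degree (∏ i ∈ S, f i)) ≤ mo.toSyn (∑ i ∈ S, e i) := by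
  classical
  induction S using Finset.induction_on with
  | empty => simp
  | insert a S ha ih =>
    have := ih fun i hi => h i (Finset.mem_insert_of_mem hi)
    rw [Finset.prod_insert ha, Finset.sum_insert ha, Finset.prod_insert ha]
    have h1 := h a (Finset.mem_insert_self _ _)
    refine ⟨?_, ?_⟩
    · rw [mo.coeff_mul_of_add_of_degree_le h1 this.2, this.1]
    · refine mo.degree_mul_le.trans ?_
      rw [map_add, map_add]
      exact add_le_add h1 this.2

theorem wronskian [LinearOrder σ] {s : ℕ} (φ : Fin s → MvPolynomial σ K)
    (hφ : LinearIndependent K φ) :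
    ∃ μ : Fin s → (σ →₀ ℕ), (∀ i, (μ i).degree < s) ∧
      (Matrix.of fun i l => hD (μ i) (φ l)).det ≠ 0 := by
  classical
  let mo : MonomialOrder σ := MonomialOrder.lex
  obtain ⟨P, hP0, hPi⟩ := exists_echelon φ hφ mo
  set g : Fin s → MvPolynomial σ K := fun l => ∑ i, P l i • φ i with hg
  obtain ⟨μ, hμ, hdet⟩ := exists_bin_det (K := K) (fun l => mo.degree (g l)) hPi
  refine ⟨μ, hμ, fun h0 => ?_⟩
  have h1 : (Matrix.of fun i l => hD (μ i) (g l)) =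
      (Matrix.of fun i l => hD (μ i) (φ l)) * (Matrix.of fun i l => (C (P l i) : MvPolynomial σ K)) := by
    refine Matrix.ext fun i l => ?_
    rw [Matrix.mul_apply]
    simp only [Matrix.of_apply, hg]
    change hDl (R := K) (μ i) _ = _
    rw [map_sum]
    refine Finset.sum_congr rfl fun j _ => ?_
    rw [map_smul, mul_comm, C_mul']
    rfl
  have h2 : (Matrix.of fun i l => hD (μ i) (g l)).det = 0 := by rw [h1, Matrix.det_mul, h0, zero_mul]
  have h3 : (Matrix.of fun i l => monomial (μ i) (1:K) * hD (μ i) (g l)).det = 0 := by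
    have := Matrix.det_mul_column (fun i => monomial (μ i) (1:K)) (Matrix.of fun i l => hD (μ i) (g l))
    simp only [Matrix.of_apply] at this
    rw [this, h2, mul_zero]
  have hc : ∀ i l c, (monomial (μ i) (1:K) * hD (μ i) (g l)).coeff c = bin c (μ i) * (g l).coeff c := by
    intro i l c
    rw [coeff_monomial_mul']
    split_ifs with h
    · rw [coeff_hD, tsub_add_cancel_of_le h, one_mul]
    · rw [bin_eq_zero h]; simp
  have h4 := congrArg (coeff (∑ l, mo.degree (g l))) h3
  rw [Matrix.det_apply, coeff_sum, coeff_zero] at h4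
  have h5 : ∀ τ : Equiv.Perm (Fin s), coeff (∑ l, mo.degree (g l))
      (∏ l, (Matrix.of fun i l => monomial (μ i) (1:K) * hD (μ i) (g l)) (τ l) l) =
      ∏ l, ((bin (mo.degree (g l)) (μ (τ l)) : K) * (g l).coeff (mo.degree (g l))) := by
    intro τ
    rw [(coeff_prod_of_le mo Finset.univ _ _ _).1]
    · simp only [Matrix.of_apply, hc]
    · intro l _
      rw [mo.degree_le_iff]
      intro b hb
      apply mo.le_degree
      rw [mem_support_iff, Matrix.of_apply, hc] at hb
      exact mem_support_iff.mpr (right_ne_zero_of_mul hb)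
  apply hdet
  have h6 : (Matrix.of fun i l => (bin (mo.degree (g l)) (μ i) : K)).det *
      ∏ l, (g l).coeff (mo.degree (g l)) = 0 := by
    rw [← h4, Matrix.det_apply, Finset.sum_mul]
    refine Finset.sum_congr rfl fun τ _ => ?_
    rw [Units.smul_def, Units.smul_def, zsmul_eq_mul, zsmul_eq_mul, ← map_intCast (C : K →+* MvPolynomial σ K),
      coeff_C_mul, h5, Finset.prod_mul_distrib, mul_assoc]
    rfl
  refine (mul_eq_zero.mp h6).resolve_right ?_
  refine Finset.prod_ne_zero_iff.mpr ?_
  intro l _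
  exact mo.coeff_degree_ne_zero_iff.mpr (hP0 l)

end wronskian
end Sch


namespace Sch
open MvPolynomial

section ten
variable {R : Type*} [CommRing R] {n : ℕ}

/-- combine exponents -/
noncomputable def cns (ν : Unit →₀ ℕ) (μ : Fin n →₀ ℕ) : Fin (n + 1) →₀ ℕ := Finsupp.cons (ν ()) μ

@[simp] lemma cns_zero (ν : Unit →₀ ℕ) (μ : Fin n →₀ ℕ) : cns ν μ 0 = ν () := by simp [cns]
@[simp] lemma cns_succ (ν : Unit →₀ ℕ) (μ : Fin n →₀ ℕ) (i : Fin n) : cns ν μ i.succ = μ i := by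
  simp [cns]

lemma cns_add (ν ν' : Unit →₀ ℕ) (μ μ' : Fin n →₀ ℕ) :
    cns (ν + ν') (μ + μ') = cns ν μ + cns ν' μ' := by
  ext i
  refine Fin.cases ?_ (fun j => ?_) i <;> simp

lemma cns_inj {ν ν' : Unit →₀ ℕ} {μ μ' : Fin n →₀ ℕ} (h : cns ν μ = cns ν' μ') :
    ν = ν' ∧ μ = μ' := by
  constructor
  · ext; simpa using DFunLike.congr_fun h 0
  · ext i; simpa using DFunLike.congr_fun h i.succ

lemma cns_surj (c : Fin (n + 1) →₀ ℕ) : ∃ ν μ, c = cns ν μ := by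
  refine ⟨Finsupp.single () (c 0), c.tail, ?_⟩
  ext i
  refine Fin.cases ?_ (fun j => ?_) i
  · simp
  · simp [Finsupp.tail_apply]

lemma bin_cns (ν ν' : Unit →₀ ℕ) (μ μ' : Fin n →₀ ℕ) :
    bin (cns ν μ) (cns ν' μ') = bin ν ν' * bin μ μ' := by
  simp [bin, Fin.prod_univ_succ]

/-- external product -/
noncomputable def ten (f : MvPolynomial (Fin n) R) (g : MvPolynomial Unit R) :
    MvPolynomial (Fin (n + 1)) R := rename Fin.succ f * rename (fun _ => 0) g

lemma ten_monomial (b : Fin n →₀ ℕ) (c : Unit →₀ ℕ) (x y : R) :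
    ten (monomial b x) (monomial c y) = monomial (cns c b) (x * y) := by
  unfold ten
  rw [rename_monomial, rename_monomial, monomial_mul]
  have hexp : Finsupp.mapDomain Fin.succ b + Finsupp.mapDomain (fun _ => (0 : Fin (n + 1))) c =
      cns c b := ?_
  · rw [hexp]
  ext i
  refine Fin.cases ?_ (fun j => ?_) i
  · rw [Finsupp.add_apply, Finsupp.mapDomain_notin_range _ _ (by simp)]
    rw [Finsupp.unique_single c, Finsupp.mapDomain_single]
    simp
  · rw [Finsupp.add_apply, Finsupp.mapDomain_apply (Fin.succ_injective n)]
    rw [Finsupp.unique_single c, Finsupp.mapDomain_single]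
    simp

lemma coeff_ten (f : MvPolynomial (Fin n) R) (g : MvPolynomial Unit R) (ν : Unit →₀ ℕ)
    (μ : Fin n →₀ ℕ) : (ten f g).coeff (cns ν μ) = f.coeff μ * g.coeff ν := by
  classical
  induction f using MvPolynomial.induction_on' with
  | monomial b x =>
    induction g using MvPolynomial.induction_on' with
    | monomial c y =>
      rw [ten_monomial, coeff_monomial, coeff_monomial, coeff_monomial]
      by_cases h1 : b = μ
      · by_cases h2 : c = ν
        · simp [h1, h2]
        · rw [if_neg (fun h => h2 (cns_inj h).1), if_neg h2, mul_zero]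
      · rw [if_neg (fun h => h1 (cns_inj h).2), if_neg h1, zero_mul]
    | add p q hp hq =>
      have : ten (monomial b x) (p + q) = ten (monomial b x) p + ten (monomial b x) q := by
        simp [ten, mul_add]
      rw [this, coeff_add, hp, hq, coeff_add, mul_add]
  | add p q hp hq =>
    have : ten (p + q) g = ten p g + ten q g := by simp [ten, add_mul]
    rw [this, coeff_add, hp, hq, coeff_add, add_mul]

lemma hD_ten (f : MvPolynomial (Fin n) R) (g : MvPolynomial Unit R) (ν : Unit →₀ ℕ)
    (μ : Fin n →₀ ℕ) : hD (cns ν μ) (ten f g) = ten (hD μ f) (hD ν g) := by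
  ext c
  obtain ⟨c0, c1, rfl⟩ := cns_surj c
  rw [coeff_hD, ← cns_add, coeff_ten, coeff_ten, coeff_hD, coeff_hD, bin_cns]
  push_cast; ring

lemma trans_ten (ξ : Fin (n + 1) → R) (f : MvPolynomial (Fin n) R) (g : MvPolynomial Unit R) :
    trans ξ (ten f g) = ten (trans (fun i => ξ i.succ) f) (trans (fun _ => ξ 0) g) := by
  unfold ten
  rw [map_mul]
  congr 1
  · unfold trans
    rw [aeval_rename, ← AlgHom.comp_apply, comp_aeval]
    simp [Function.comp_def]
  · unfold trans
    rw [aeval_rename, ← AlgHom.comp_apply, comp_aeval]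
    simp [Function.comp_def]

end ten

section pull
variable {σ τ R R' : Type*} [CommRing R] [CommRing R']

/-- pull back coefficients along an injection of exponents -/
noncomputable def pull (e : (τ →₀ ℕ) → (σ →₀ ℕ)) (he : Function.Injective e)
    (f : MvPolynomial σ R) : MvPolynomial τ R :=
  ∑ b ∈ f.support.preimage e he.injOn, monomial b (f.coeff (e b))

lemma coeff_pull (e : (τ →₀ ℕ) → (σ →₀ ℕ)) (he : Function.Injective e) (f : MvPolynomial σ R)
    (b : τ →₀ ℕ) : (pull e he f).coeff b = f.coeff (e b) := by
  classical
  unfold pull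
  rw [coeff_sum]
  simp only [coeff_monomial]
  rw [Finset.sum_ite_eq' (f.support.preimage e he.injOn) b]
  split_ifs with h
  · rfl
  · rw [Finset.mem_preimage, notMem_support_iff] at h
    exact h.symm

lemma map_pull (φ : R →+* R') (e : (τ →₀ ℕ) → (σ →₀ ℕ)) (he : Function.Injective e)
    (f : MvPolynomial σ R) : map φ (pull e he f) = pull e he (map φ f) := by
  ext b; simp [coeff_pull, coeff_map]

lemma l1_pull_le (N : RingSeminorm R) (e : (τ →₀ ℕ) → (σ →₀ ℕ)) (he : Function.Injective e)
    (f : MvPolynomial σ R) : l1 τ N (pull e he f) ≤ l1 σ N f := by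
  classical
  rw [l1_apply, l1_apply]
  unfold wnorm
  simp only [mw_one, mul_one, coeff_pull]
  calc _ = ∑ c ∈ (pull e he f).support.image e, N (f.coeff c) := by
        rw [Finset.sum_image he.injOn]
    _ ≤ _ := by
      apply Finset.sum_le_sum_of_subset_of_nonneg
      · intro c hc
        obtain ⟨b, hb, rfl⟩ := Finset.mem_image.mp hc
        rw [mem_support_iff, coeff_pull] at hb
        exact mem_support_iff.mpr hb
      · intro c _ _
        exact apply_nonneg N _

end pull

section factor
variable {K : Type*} [Field K] {n : ℕ}

lemma exists_factor (F : MvPolynomial (Fin (n + 1)) K) (r : ℕ) (hF : F ≠ 0)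
    (hr : ∀ b, F.coeff b ≠ 0 → b 0 ≤ r) :
    ∃ (s : ℕ) (φ : Fin s → MvPolynomial (Fin n) K) (ψ : Fin s → MvPolynomial Unit K),
      0 < s ∧ s ≤ r + 1 ∧ LinearIndependent K φ ∧ LinearIndependent K ψ ∧ F = ∑ l, ten (φ l) (ψ l) := by
  classical
  let sl : ℕ → MvPolynomial (Fin n) K := fun j =>
    pull (fun b => cns (Finsupp.single () j) b) (fun _ _ h => (cns_inj h).2) F
  let V := Submodule.span K (Set.range fun j : Fin (r + 1) => sl j)
  have hfd : FiniteDimensional K V := FiniteDimensional.span_of_finite K (Set.finite_range _)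
  let B := Module.finBasis K V
  have hmem : ∀ j : Fin (r + 1), sl j ∈ V := fun j => Submodule.subset_span ⟨j, rfl⟩
  let ψ : Fin (Module.finrank K V) → MvPolynomial Unit K := fun l =>
    ∑ j : Fin (r + 1), monomial (Finsupp.single () (j : ℕ)) (B.repr ⟨sl j, hmem j⟩ l)
  have hψ : ∀ l (j : Fin (r + 1)), (ψ l).coeff (Finsupp.single () (j : ℕ)) = B.repr ⟨sl j, hmem j⟩ l := by
    intro l j
    simp only [ψ, coeff_sum, coeff_monomial]
    rw [Finset.sum_eq_single j]
    · simp
    · intro j' _ h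
      rw [if_neg]
      intro h'
      apply h
      exact Fin.ext (Finsupp.single_injective _ h')
    · simp
  have hFeq : F = ∑ l, ten ((B l : V) : MvPolynomial (Fin n) K) (ψ l) := by
    ext c
    obtain ⟨ν, μ, rfl⟩ := cns_surj c
    rw [coeff_sum]
    simp only [coeff_ten]
    rw [Finsupp.unique_single ν]
    change coeff (cns (Finsupp.single () (ν ())) μ) F = ∑ l, _ * coeff (Finsupp.single () (ν ())) (ψ l)
    by_cases hν : ν () < r + 1
    · have h1 := fun l => hψ l ⟨ν (), hν⟩
      simp only at h1
      simp only [h1]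
      have h2 := congrArg (fun v : V => (v : MvPolynomial (Fin n) K).coeff μ) (B.sum_repr ⟨sl (ν ()), hmem ⟨ν (), hν⟩⟩)
      simp only [Submodule.coe_sum, Submodule.coe_smul, coeff_sum, coeff_smul, smul_eq_mul] at h2
      rw [show coeff (cns (Finsupp.single () (ν ())) μ) F = coeff μ (sl (ν ())) from (coeff_pull _ _ _ _).symm, ← h2]
      exact Finset.sum_congr rfl fun l _ => mul_comm _ _
    · rw [Finset.sum_eq_zero]
      · by_contra h
        have := hr _ h
        simp at this
        omega
      · intro l _
        have : (ψ l).coeff (Finsupp.single () (ν ())) = 0 := by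
          simp only [ψ, coeff_sum, coeff_monomial]
          apply Finset.sum_eq_zero
          intro j _
          rw [if_neg]
          intro h
          have := Finsupp.single_injective _ h
          have := j.2
          omega
        rw [this, mul_zero]
  refine ⟨Module.finrank K V, fun l => (B l : V), ψ, ?_, ?_, ?_, ?_, hFeq⟩
  · rw [Nat.pos_iff_ne_zero]
    intro h0
    apply hF
    rw [hFeq]
    apply Finset.sum_eq_zero
    intro l _
    exact absurd l.2 (by omega)
  · have := finrank_range_le_card (R := K) (fun j : Fin (r + 1) => sl j)
    rw [Fintype.card_fin] at this
    exact this
  · exact B.linearIndependent.map' V.subtype (Submodule.ker_subtype V)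
  · rw [Fintype.linearIndependent_iff]
    intro y hy l
    let f : V →ₗ[K] K := B.constr K y
    have hf : f = 0 := by
      have hspan : Submodule.span K (Set.range fun j : Fin (r + 1) => (⟨sl j, hmem j⟩ : V)) = ⊤ := by
        apply Submodule.map_injective_of_injective V.injective_subtype
        rw [Submodule.map_span, Submodule.map_top, Submodule.range_subtype, ← Set.range_comp]
        rfl
      apply LinearMap.ext_on_range hspan
      intro j
      have h1 := congrArg (coeff (Finsupp.single () (j : ℕ))) hy
      simp only [coeff_sum, coeff_smul, hψ, smul_eq_mul, coeff_zero] at h1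
      rw [Module.Basis.constr_apply_fintype]
      simp only [Module.Basis.equivFun_apply, smul_eq_mul, LinearMap.zero_apply]
      rw [← h1]
      exact Finset.sum_congr rfl fun l _ => mul_comm _ _
    have := B.constr_basis K y l
    change f (B l) = _ at this
    rw [← this, hf]
    rfl

end factor
end Sch


namespace Sch
open MvPolynomial

section
variable {σ R R' : Type*} [CommRing R] [CommRing R']

lemma coeff_prod_split {ι : Type*} (S : Finset ι) (f : ι → MvPolynomial σ R) (c : σ →₀ ℕ)
    (h : (∏ i ∈ S, f i).coeff c ≠ 0) :
    ∃ d : ι → (σ →₀ ℕ), ∑ i ∈ S, d i = c ∧ ∀ i ∈ S, (f i).coeff (d i) ≠ 0 := by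
  classical
  induction S using Finset.induction_on generalizing c with
  | empty =>
    rw [Finset.prod_empty, coeff_one] at h
    refine ⟨fun _ => 0, ?_, by simp⟩
    by_contra h0
    exact h (if_neg (by simpa using h0))
  | insert a S ha ih =>
    rw [Finset.prod_insert ha, coeff_mul] at h
    obtain ⟨⟨x, y⟩, hx, hne⟩ := Finset.exists_ne_zero_of_sum_ne_zero h
    obtain ⟨d, hd, hd'⟩ := ih y (right_ne_zero_of_mul hne)
    refine ⟨fun i => if i = a then x else d i, ?_, ?_⟩
    · rw [Finset.sum_insert ha, if_pos rfl]
      rw [Finset.sum_congr rfl (g := d), hd]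
      · exact Finset.HasAntidiagonal.mem_antidiagonal.mp hx
      · intro i hi
        rw [if_neg (show i ≠ a from fun h => ha (h ▸ hi))]
    · intro i hi
      rcases Finset.mem_insert.mp hi with rfl | hi
      · simpa using left_ne_zero_of_mul hne
      · simp only [if_neg (show i ≠ a from fun h => ha (h ▸ hi))]
        exact hd' i hi

lemma coeff_det_split {s : ℕ} (M : Matrix (Fin s) (Fin s) (MvPolynomial σ R)) (c : σ →₀ ℕ)
    (h : M.det.coeff c ≠ 0) :
    ∃ (τ : Equiv.Perm (Fin s)) (d : Fin s → (σ →₀ ℕ)), ∑ k, d k = c ∧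
      ∀ k, (M (τ k) k).coeff (d k) ≠ 0 := by
  rw [Matrix.det_apply, coeff_sum] at h
  obtain ⟨τ, _, hτ⟩ := Finset.exists_ne_zero_of_sum_ne_zero h
  obtain ⟨d, hd, hd'⟩ := coeff_prod_split Finset.univ (fun k => M (τ k) k) c (by
    intro h0
    apply hτ
    rw [Units.smul_def, zsmul_eq_mul, ← map_intCast (C : R →+* MvPolynomial σ R), coeff_C_mul, h0, mul_zero])
  exact ⟨τ, d, hd, fun k => hd' k (Finset.mem_univ k)⟩

lemma seminorm_det_le (N : RingSeminorm R) (h1 : N 1 ≤ 1) {s : ℕ} (M : Matrix (Fin s) (Fin s) R) (b : ℝ)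
    (hM : ∀ i j, N (M i j) ≤ b) : N M.det ≤ s.factorial * b ^ s := by
  have hsum : ∀ (S : Finset (Equiv.Perm (Fin s))) (f : Equiv.Perm (Fin s) → R),
      N (∑ τ ∈ S, f τ) ≤ ∑ τ ∈ S, N (f τ) := by
    intro S f
    classical
    induction S using Finset.induction_on with
    | empty => simp
    | insert a S ha ih =>
      rw [Finset.sum_insert ha, Finset.sum_insert ha]
      exact (map_add_le_add N _ _).trans (by gcongr)
  have hprod : ∀ (S : Finset (Fin s)) (f : Fin s → R), (∀ i, N (f i) ≤ b) →
      N (∏ i ∈ S, f i) ≤ b ^ S.card := by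
    intro S f hf
    classical
    induction S using Finset.induction_on with
    | empty => simpa using h1
    | insert a S ha ih =>
      rw [Finset.prod_insert ha, Finset.card_insert_of_notMem ha, pow_succ, mul_comm (b ^ _)]
      exact (map_mul_le_mul N _ _).trans
        (mul_le_mul (hf a) ih (apply_nonneg N _) ((apply_nonneg N _).trans (hf a)))
  rw [Matrix.det_apply]
  refine (hsum _ _).trans ?_
  calc _ ≤ ∑ τ : Equiv.Perm (Fin s), b ^ s := by
        apply Finset.sum_le_sum
        intro τ _
        have : N (Equiv.Perm.sign τ • ∏ i, M (τ i) i) = N (∏ i, M (τ i) i) := by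
          rcases Int.units_eq_one_or (Equiv.Perm.sign τ) with h | h <;> simp [h]
        rw [this]
        simpa using hprod Finset.univ (fun i => M (τ i) i) (fun i => hM _ _)
    _ = _ := by simp [Fintype.card_perm]

lemma map_hD [Fintype σ] (φ : R →+* R') (μ : σ →₀ ℕ) (f : MvPolynomial σ R) :
    map φ (hD μ f) = hD μ (map φ f) := by
  ext c; simp [coeff_hD, coeff_map]

end

lemma cns_injR {n : ℕ} (j : Unit →₀ ℕ) : Function.Injective fun b : Fin n →₀ ℕ => cns j b :=
  fun _ _ h => (cns_inj h).2
lemma cns_injL {n : ℕ} (b : Fin n →₀ ℕ) : Function.Injective fun j : Unit →₀ ℕ => cns j b :=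
  fun _ _ h => (cns_inj h).1

section roth
variable {A K : Type*} [CommRing A] [IsDomain A] [CharZero A] [Field K] [Algebra A K] [IsFractionRing A K]
  (N : RingSeminorm A)

/-- The one variable property -/
def Star (ξ : K) (H : ℝ) : Prop :=
  ∀ (V : MvPolynomial Unit A) (n : ℕ), V ≠ 0 →
    (∀ b : Unit →₀ ℕ, b () < n → (trans (fun _ => ξ) (map (algebraMap A K) V)).coeff b = 0) →
    H ^ n ≤ l1 Unit N V

lemma trans_ne_zero {σ : Type*} [Fintype σ] (ξ : σ → K) (f : MvPolynomial σ K) (hf : f ≠ 0) : trans ξ f ≠ 0 := by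
  intro h
  apply hf
  have h1 : trans (fun i => - ξ i) (trans ξ f) = f := by
    unfold trans
    rw [← AlgHom.comp_apply, comp_aeval]
    simp
  rw [← h1, h, map_zero]

/-- analytic lower bound for the index of the determinant -/
lemma sum_index_lower (s r0 : ℕ) (t ω : ℝ) (ht : 0 < t) (ht1 : t ≤ 1) (hω : ω ≤ t / 8) (hs : s ≤ 2 * r0)
    (ν : Fin s → ℕ) (hν : ∀ k, ν k < s) (hinj : Function.Injective ν) (x : Fin s → ℝ)
    (hx0 : ∀ k, 0 ≤ x k) (hx : ∀ k, t - ν k / r0 - 2 * ω ≤ x k) :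
    s * t ^ 2 / 16 ≤ ∑ k, x k := by
  classical
  rcases Nat.eq_zero_or_pos s with rfl | hspos
  · simp
  have hr0 : (0:ℝ) < r0 := by
    have : 0 < r0 := by omega
    exact_mod_cast this
  have hs' : (s : ℝ) ≤ 2 * r0 := by exact_mod_cast hs
  have hsp : (0:ℝ) < s := by exact_mod_cast hspos
  let ν' : Fin s → Fin s := fun k => ⟨ν k, hν k⟩
  have hbij : Function.Bijective ν' := by
    apply Finite.injective_iff_bijective.mp
    intro a b h
    exact hinj (congrArg Fin.val h)
  let e := Equiv.ofBijective ν' hbij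
  have h1 : ∑ k, x k = ∑ j, x (e.symm j) := (Equiv.sum_comp e.symm x).symm
  rw [h1]
  have h2 : ∀ j : Fin s, t - (j : ℕ) / r0 - 2 * ω ≤ x (e.symm j) := by
    intro j
    have := hx (e.symm j)
    have h3 : ν (e.symm j) = j := congrArg Fin.val (e.apply_symm_apply j)
    rwa [h3] at this
  have h3 : ∀ j : Fin s, (if ((j : ℕ) : ℝ) ≤ t * s / 4 then t / 4 else 0) ≤ x (e.symm j) := by
    intro j
    split_ifs with h
    · refine le_trans ?_ (h2 j)
      have : ((j : ℕ) : ℝ) / r0 ≤ t / 2 := by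
        rw [div_le_iff₀ hr0]
        nlinarith
      linarith
    · exact hx0 _
  refine le_trans ?_ (Finset.sum_le_sum fun j _ => h3 j)
  rw [← Finset.sum_filter, Finset.sum_const, nsmul_eq_mul]
  have hcard : t * s / 4 ≤ ((Finset.univ.filter fun j : Fin s => ((j : ℕ) : ℝ) ≤ t * s / 4).card : ℝ) := by
    set q := ⌊t * s / 4⌋₊ with hq
    have hqs : q < s := by
      have : (q : ℝ) ≤ t * s / 4 := Nat.floor_le (by positivity)
      have : (q : ℝ) < s := by nlinarith
      exact_mod_cast this
    have hle : q + 1 ≤ (Finset.univ.filter fun j : Fin s => ((j : ℕ) : ℝ) ≤ t * s / 4).card := by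
      have : (Finset.univ.map (Fin.castLEEmb (by omega : q + 1 ≤ s))) ⊆
          (Finset.univ.filter fun j : Fin s => ((j : ℕ) : ℝ) ≤ t * s / 4) := by
        intro j hj
        obtain ⟨i, _, rfl⟩ := Finset.mem_map.mp hj
        simp only [Finset.mem_filter, Finset.mem_univ, true_and, Fin.castLEEmb_apply, Fin.val_castLE]
        refine le_trans ?_ (Nat.floor_le (by positivity : 0 ≤ t * s / 4))
        have := i.2
        exact_mod_cast (by omega : (i : ℕ) ≤ q)
      simpa using Finset.card_le_card this
    calc t * s / 4 ≤ q + 1 := (Nat.lt_floor_add_one _).le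
      _ ≤ _ := by exact_mod_cast hle
  nlinarith

theorem roth (h1 : N 1 ≤ 1) (m : ℕ) : ∀ t : ℝ, 0 < t → t ≤ 1 → ∃ ω : ℝ, 0 < ω ∧
    ∀ (F : MvPolynomial (Fin m) A) (r : Fin m → ℕ) (ξ : Fin m → K) (H : Fin m → ℝ) (S B : ℝ),
      F ≠ 0 → (∀ h, 1 ≤ r h) → (∀ b, F.coeff b ≠ 0 → ∀ h, b h ≤ r h) →
      (∀ h h', h < h' → (r h : ℝ) ≤ ω * r h') → 0 < S → 0 ≤ B → (∀ h, 0 < H h) →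
      (∀ h, S ≤ r h * Real.log (H h)) → (∀ h, Star N (ξ h) (H h)) → l1 (Fin m) N F ≤ Real.exp B →
      B + ∑ h, (r h : ℝ) ≤ ω * S →
      ∃ b, ∑ h, (b h : ℝ) / r h < t ∧ (trans ξ (map (algebraMap A K) F)).coeff b ≠ 0 := by
  classical
  have hinj : Function.Injective (algebraMap A K) := IsFractionRing.injective A K
  haveI : CharZero K := charZero_of_injective_algebraMap hinj
  induction m with
  | zero =>
    intro t ht _
    refine ⟨1, one_pos, ?_⟩
    intro F r ξ H S B hF _ _ _ _ _ _ _ _ _ _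
    refine ⟨0, by simpa using ht, ?_⟩
    obtain ⟨a, rfl⟩ := C_surjective (Fin 0) F
    have ha : a ≠ 0 := fun h => hF (by rw [h, map_zero])
    rw [map_C]
    unfold trans
    rw [aeval_C, algebraMap_eq, coeff_C, if_pos rfl]
    exact fun h => ha (hinj (by rw [h, map_zero]))
  | succ n ih =>
    intro t ht ht1
    obtain ⟨ω', hω', ih⟩ := ih (t ^ 2 / 64) (by positivity) (by nlinarith)
    refine ⟨min (ω' / 4) (t ^ 2 / 256), by positivity, ?_⟩
    intro F r ξ H S B hF hr hdeg hrr hS hB hH hSH hstar hFn hBS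
    set ω := min (ω' / 4) (t ^ 2 / 256) with hω
    have hω1 : ω ≤ ω' / 4 := min_le_left _ _
    have hω2 : ω ≤ t ^ 2 / 256 := min_le_right _ _
    have hωpos : 0 < ω := by positivity
    have hω8 : ω ≤ t / 8 := by nlinarith
    set F' := map (algebraMap A K) F with hF'
    have hF'0 : F' ≠ 0 := fun h => hF (map_injective _ hinj (by rw [← hF', h, map_zero]))
    have hdeg' : ∀ b, F'.coeff b ≠ 0 → ∀ h, b h ≤ r h := by
      intro b hb
      apply hdeg
      intro h0
      apply hb
      rw [hF', coeff_map, h0, map_zero]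
    obtain ⟨s, φ, ψ, hs0, hs1, hφ, hψ, hfac⟩ := exists_factor F' (r 0) hF'0 (fun b hb => hdeg' b hb 0)
    obtain ⟨μ, hμ, hU⟩ := wronskian φ hφ
    obtain ⟨ν, hν, hV⟩ := wronskian ψ hψ
    set U := (Matrix.of fun i l => hD (μ i) (φ l)).det with hUdef
    set V := (Matrix.of fun i l => hD (ν i) (ψ l)).det with hVdef
    set W := (Matrix.of fun i k => hD (cns (ν k) (μ i)) F).det with hW
    have hWmap : map (algebraMap A K) W = (Matrix.of fun i k => hD (cns (ν k) (μ i)) F').det := by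
      rw [hW, RingHom.map_det]
      congr 1
      refine Matrix.ext fun i k => ?_
      simp [map_hD, hF']
    have hWten : map (algebraMap A K) W = ten U V := by
      rw [hWmap]
      have : (Matrix.of fun i k => hD (cns (ν k) (μ i)) F') =
          (Matrix.of fun i l => rename Fin.succ (hD (μ i) (φ l))) *
          (Matrix.of fun k l => rename (fun _ => (0 : Fin (n + 1))) (hD (ν k) (ψ l))).transpose := by
        refine Matrix.ext fun i k => ?_
        rw [Matrix.mul_apply]
        simp only [Matrix.of_apply, Matrix.transpose_apply]
        conv_lhs => rw [hfac]
        change hDl (R := K) _ _ = _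
        rw [map_sum]
        exact Finset.sum_congr rfl fun l _ => hD_ten _ _ _ _
      rw [this, Matrix.det_mul, Matrix.det_transpose]
      unfold ten
      rw [hUdef, hVdef, AlgHom.map_det, AlgHom.map_det]
      rfl
    -- norm bound
    set D := ∑ h, r h with hDdef
    have hDr : ∑ h, (r h : ℝ) = D := by rw [hDdef]; push_cast; rfl
    rw [hDr] at hBS
    have hr0D : r 0 ≤ D := Finset.single_le_sum (f := r) (fun _ _ => Nat.zero_le _) (Finset.mem_univ 0)
    have hs2 : s ≤ 2 * r 0 := by have := hr 0; omega
    have hr0pos : (0:ℝ) < r 0 := by exact_mod_cast hr 0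
    have hsR : (0:ℝ) < s := by exact_mod_cast hs0
    have hWn : l1 (Fin (n + 1)) N W ≤ Real.exp (s * (B + 3 * D)) := by
      have hent : ∀ i k, l1 (Fin (n + 1)) N ((Matrix.of fun i k => hD (cns (ν k) (μ i)) F) i k) ≤
          Real.exp (D + B) := by
        intro i k
        refine (l1_hD_le N _ F D ?_).trans ?_
        · intro b hb
          rw [Finsupp.degree_eq_sum]
          exact Finset.sum_le_sum fun h _ => hdeg b hb h
        · rw [Real.exp_add]
          gcongr
          rw [← Real.exp_one_pow]
          gcongr
          have := Real.exp_one_gt_d9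
          linarith
      refine (seminorm_det_le (l1 (Fin (n + 1)) N) (l1_one_le N h1) _ _ hent).trans ?_
      have hf : ((s.factorial : ℕ) : ℝ) ≤ Real.exp (s * s) := by
        calc ((s.factorial : ℕ) : ℝ) ≤ ((s ^ s : ℕ) : ℝ) := by exact_mod_cast Nat.factorial_le_pow s
          _ = (s : ℝ) ^ s := by push_cast; rfl
          _ ≤ (Real.exp s) ^ s := by
            gcongr
            have := Real.add_one_le_exp (s : ℝ)
            linarith
          _ = _ := by rw [← Real.exp_nat_mul]
      calc _ ≤ Real.exp (s * s) * (Real.exp (D + B)) ^ s := by gcongr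
        _ = Real.exp (s * s + s * (D + B)) := by rw [← Real.exp_nat_mul, ← Real.exp_add]
        _ ≤ _ := by
          apply Real.exp_le_exp.mpr
          have : (s : ℝ) ≤ 2 * D := by exact_mod_cast (by omega : s ≤ 2 * D)
          nlinarith
    -- the slices
    obtain ⟨j0, hj0⟩ := exists_coeff_ne_zero hV
    obtain ⟨b0, hb0⟩ := exists_coeff_ne_zero hU
    set U' : MvPolynomial (Fin n) A := pull (fun b => cns j0 b) (cns_injR j0) W with hU'
    set V' : MvPolynomial Unit A := pull (fun b => cns b b0) (cns_injL b0) W with hV'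
    have hU'm : map (algebraMap A K) U' = V.coeff j0 • U := by
      ext b
      rw [hU', map_pull, coeff_pull, hWten, coeff_ten, coeff_smul, smul_eq_mul, mul_comm]
    have hV'm : map (algebraMap A K) V' = U.coeff b0 • V := by
      ext b
      rw [hV', map_pull, coeff_pull, hWten, coeff_ten, coeff_smul, smul_eq_mul]
    have hU'0 : U' ≠ 0 := by
      intro h
      rw [h, map_zero] at hU'm
      exact (smul_ne_zero hj0 hU) hU'm.symm
    have hV'0 : V' ≠ 0 := by
      intro h
      rw [h, map_zero] at hV'm
      exact (smul_ne_zero hb0 hV) hV'm.symm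
    have hWdeg : ∀ c, W.coeff c ≠ 0 → ∀ h, c h ≤ s * r h := by
      intro c hc h
      obtain ⟨τ, d, hd, hd'⟩ := coeff_det_split _ c hc
      rw [← hd, Finsupp.coe_finset_sum, Finset.sum_apply]
      calc _ ≤ ∑ k : Fin s, r h := by
            apply Finset.sum_le_sum
            intro k _
            have h2 := hd' k
            rw [Matrix.of_apply, coeff_hD] at h2
            have := hdeg _ (right_ne_zero_of_mul h2) h
            rw [Finsupp.add_apply] at this
            omega
        _ = _ := by simp
    obtain ⟨b, hbt, hbne⟩ := ih U' (fun h => s * r h.succ) (fun h => ξ h.succ) (fun h => H h.succ) (s * S)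
      (s * (B + 3 * D)) hU'0 (fun h => Nat.mul_pos hs0 (hr _)) (by
        intro b hb h
        rw [hU', coeff_pull] at hb
        simpa using hWdeg _ hb h.succ) (by
        intro h h' hh
        have := hrr h.succ h'.succ (Fin.succ_lt_succ_iff.mpr hh)
        push_cast
        have h3 : (r h.succ : ℝ) ≤ ω' * r h'.succ := this.trans (by gcongr; linarith)
        nlinarith) (by positivity) (by positivity) (fun h => hH _) (by
        intro h
        have := hSH h.succ
        push_cast
        rw [mul_assoc]
        gcongr) (fun h => hstar _) ((l1_pull_le N _ _ W).trans hWn) (by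
        have h2 : ∑ h : Fin n, ((s * r h.succ : ℕ) : ℝ) ≤ s * D := by
          push_cast
          rw [← Finset.mul_sum, ← hDr, Fin.sum_univ_succ]
          gcongr
          linarith
        have h3 : 0 ≤ (D : ℝ) := Nat.cast_nonneg _
        have h4 : B + 4 * D ≤ ω' * S := by nlinarith
        nlinarith)
    -- order of V at ξ 0
    have hVt : trans (fun _ => ξ 0) V ≠ 0 := trans_ne_zero _ _ hV
    have hex : ∃ j : ℕ, (trans (fun _ => ξ 0) V).coeff (Finsupp.single () j) ≠ 0 := by
      obtain ⟨c, hc⟩ := exists_coeff_ne_zero hVt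
      refine ⟨c (), ?_⟩
      rwa [Finsupp.unique_single c] at hc
    set j := Nat.find hex with hj
    have hjne := Nat.find_spec hex
    have hVn := hstar 0 V' j hV'0 (by
      intro b hb
      rw [hV'm, map_smul, coeff_smul]
      have := Nat.find_min hex hb
      push Not at this
      rw [Finsupp.unique_single b]
      change _ • coeff (Finsupp.single () (b ())) _ = _
      rw [this, smul_zero])
    have hlog : (j : ℝ) * Real.log (H 0) ≤ s * (B + 3 * D) := by
      have h2 : H 0 ^ j ≤ Real.exp (s * (B + 3 * D)) := hVn.trans ((l1_pull_le N _ _ W).trans hWn)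
      rw [← Real.log_pow]
      calc _ ≤ Real.log (Real.exp (s * (B + 3 * D))) := Real.log_le_log (pow_pos (hH 0) _) h2
        _ = _ := Real.log_exp _
    have hjr : (j : ℝ) / r 0 ≤ 3 * ω * s := by
      rw [div_le_iff₀ hr0pos]
      have h2 := hSH 0
      have h3 : (j : ℝ) * S ≤ r 0 * (s * (B + 3 * D)) := by
        calc (j : ℝ) * S ≤ j * (r 0 * Real.log (H 0)) := by gcongr
          _ = r 0 * (j * Real.log (H 0)) := by ring
          _ ≤ _ := by gcongr
      have h4 : B + 3 * D ≤ 3 * (ω * S) := by linarith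
      have h5 : (j : ℝ) * S ≤ (3 * ω * s * r 0) * S := by
        calc (j : ℝ) * S ≤ r 0 * (s * (B + 3 * D)) := h3
          _ ≤ r 0 * (s * (3 * (ω * S))) := by gcongr
          _ = _ := by ring
      exact le_of_mul_le_mul_right h5 hS
    -- conclude
    by_contra hcon
    push Not at hcon
    have hWc : (trans ξ (map (algebraMap A K) W)).coeff (cns (Finsupp.single () j) b) ≠ 0 := by
      rw [hWten, trans_ten, coeff_ten]
      refine mul_ne_zero ?_ hjne
      rw [hU'm, map_smul, coeff_smul, smul_eq_mul] at hbne
      exact right_ne_zero_of_mul hbne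
    rw [hWmap, AlgHom.map_det] at hWc
    obtain ⟨τ, d, hd, hd'⟩ := coeff_det_split _ _ hWc
    have hνinj : Function.Injective fun k => ν k () := by
      intro a b hab
      by_contra hne
      apply hV
      rw [hVdef]
      apply Matrix.det_zero_of_row_eq hne
      have : ν a = ν b := by ext; exact hab
      funext l
      simp [this]
    have hlow := sum_index_lower s (r 0) t ω ht ht1 hω8 hs2 (fun k => ν k ()) (by
      intro k
      have := hν k
      rw [Finsupp.degree_eq_sum] at this
      simpa using this) hνinj (fun k => ∑ h, (d k h : ℝ) / r h) (fun k => by positivity) (by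
      intro k
      have h2 := hd' k
      rw [AlgHom.mapMatrix_apply, Matrix.map_apply, Matrix.of_apply, coeff_trans_hD] at h2
      have h3 : t ≤ ∑ h, ((d k + cns (ν k) (μ (τ k))) h : ℝ) / r h := by
        by_contra hlt
        push Not at hlt
        exact (right_ne_zero_of_mul h2) (hcon _ hlt)
      have h4 : ∑ h, ((d k + cns (ν k) (μ (τ k))) h : ℝ) / r h =
          ∑ h, (d k h : ℝ) / r h + (ν k () : ℝ) / r 0 + ∑ h : Fin n, (μ (τ k) h : ℝ) / r h.succ := by
        simp only [Finsupp.add_apply, Nat.cast_add, add_div, Finset.sum_add_distrib]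
        rw [add_assoc]
        congr 1
        rw [Fin.sum_univ_succ]
        simp
      have h5 : ∑ h : Fin n, (μ (τ k) h : ℝ) / r h.succ ≤ 2 * ω := by
        calc _ ≤ ∑ h : Fin n, (μ (τ k) h : ℝ) * (ω / r 0) := by
              apply Finset.sum_le_sum
              intro h _
              rw [div_eq_mul_inv]
              gcongr
              have hp : (0:ℝ) < r h.succ := by exact_mod_cast hr _
              rw [inv_eq_one_div, div_le_div_iff₀ hp hr0pos, one_mul]
              exact hrr 0 h.succ (Fin.succ_pos h)
          _ = ((μ (τ k)).degree : ℝ) * (ω / r 0) := by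
              rw [← Finset.sum_mul, Finsupp.degree_eq_sum]; push_cast; rfl
          _ ≤ (2 * r 0) * (ω / r 0) := by
              gcongr
              have := hμ (τ k)
              exact_mod_cast (by omega : (μ (τ k)).degree ≤ 2 * r 0)
          _ = 2 * ω := by field_simp
      linarith)
    have hup : ∑ k, ∑ h, (d k h : ℝ) / r h = (j : ℝ) / r 0 + ∑ h : Fin n, (b h : ℝ) / r h.succ := by
      rw [Finset.sum_comm]
      have h2 : ∀ h, ∑ k, (d k h : ℝ) / r h = (cns (Finsupp.single () j) b h : ℝ) / r h := by
        intro h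
        rw [← hd, Finsupp.coe_finset_sum, Finset.sum_apply, ← Finset.sum_div]
        push_cast
        rfl
      rw [Finset.sum_congr rfl fun h _ => h2 h, Fin.sum_univ_succ]
      simp
    have hbs : ∑ h : Fin n, (b h : ℝ) / r h.succ < s * (t ^ 2 / 64) := by
      have h2 : ∑ h : Fin n, (b h : ℝ) / r h.succ = s * ∑ h : Fin n, (b h : ℝ) / ((s * r h.succ : ℕ) : ℝ) := by
        rw [Finset.mul_sum]
        refine Finset.sum_congr rfl fun h _ => ?_
        have hp : (0:ℝ) < r h.succ := by exact_mod_cast hr _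
        push_cast
        field_simp
      rw [h2]
      gcongr
    rw [hup] at hlow
    nlinarith

end roth
end Sch


namespace Sch
open MvPolynomial

section star
variable {R : Type*} [CommRing R]

/-- one variable polynomials -/
noncomputable def tp : MvPolynomial Unit R →ₐ[R] Polynomial R := aeval fun _ => Polynomial.X

lemma coeff_tp (f : MvPolynomial Unit R) (d : ℕ) :
    (tp f).coeff d = f.coeff (Finsupp.single () d) := by
  classical
  induction f using MvPolynomial.induction_on' with
  | monomial b x =>
    rw [coeff_monomial, tp, aeval_monomial, Finsupp.prod_fintype _ _ (by simp)]
    simp only [Finset.univ_unique, Finset.prod_singleton, Polynomial.algebraMap_eq,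
      Polynomial.coeff_C_mul_X_pow]
    rw [Finsupp.unique_single b]
    by_cases h : d = b ()
    · subst h; simp
    · rw [if_neg, if_neg]
      · intro h'
        have := Finsupp.single_injective _ h'
        exact h this.symm
      · simpa using h
  | add p q hp hq => rw [map_add, Polynomial.coeff_add, hp, hq, coeff_add]

lemma l1_int_ge_one {τ : Type*} (f : MvPolynomial τ ℤ) (hf : f ≠ 0) : 1 ≤ l1 τ absZ f := by
  obtain ⟨b, hb⟩ := exists_coeff_ne_zero hf
  refine le_trans ?_ (coeff_le_l1 absZ f b)
  rw [absZ_apply]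
  exact_mod_cast Int.one_le_abs hb

lemma l1_C_mul_ge {τ : Type*} (a : ℤ) (f : MvPolynomial τ ℤ) (hf : f ≠ 0) :
    |(a : ℝ)| ≤ l1 τ absZ (C a * f) := by
  obtain ⟨b, hb⟩ := exists_coeff_ne_zero hf
  refine le_trans ?_ (coeff_le_l1 absZ _ b)
  rw [absZ_apply, coeff_C_mul]
  push_cast
  rw [abs_mul]
  have : (1:ℝ) ≤ |((coeff b f : ℤ) : ℝ)| := by exact_mod_cast Int.one_le_abs hb
  nlinarith [abs_nonneg (a : ℝ)]

lemma star_abs {A K : Type*} [CommRing A] [IsDomain A] [IsGCDMonoid A] [Field K] [Algebra A K]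
    [IsFractionRing A K] (w L : A) (hw : w ≠ 0)
    (hp : (Polynomial.C w * Polynomial.X + Polynomial.C L).IsPrimitive) (V : MvPolynomial Unit A) (n : ℕ)
    (hV : V ≠ 0)
    (hvan : ∀ b : Unit →₀ ℕ, b () < n →
      (trans (fun _ => -(algebraMap A K L) / algebraMap A K w) (map (algebraMap A K) V)).coeff b = 0) :
    ∃ q : A, q ≠ 0 ∧ ∃ d, V.coeff d = w ^ n * q := by
  classical
  set ξ : K := -(algebraMap A K L) / algebraMap A K w with hξ
  have hinj : Function.Injective (algebraMap A K) := IsFractionRing.injective A K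
  have hw' : (algebraMap A K w) ≠ 0 := by
    intro h
    exact hw (hinj (by rw [h, map_zero]))
  set p : Polynomial A := Polynomial.C w * Polynomial.X + Polynomial.C L with hpdef
  have hpn : (p ^ n).IsPrimitive := by
    let _ : NormalizedGCDMonoid A := Nonempty.some inferInstance
    induction n with
    | zero => simp
    | succ n ih =>
      rw [pow_succ]
      exact (ih fun b hb => hvan b (by omega)).mul hp
  have hdiv : (p ^ n).map (algebraMap A K) ∣ (tp V).map (algebraMap A K) := by
    have h1 : Polynomial.X ^ n ∣ tp (trans (fun _ => ξ) (map (algebraMap A K) V)) := by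
      rw [Polynomial.X_pow_dvd_iff]
      intro d hd
      rw [coeff_tp]
      exact hvan _ (by simpa using hd)
    have h2 : (tp (trans (fun _ => ξ) (map (algebraMap A K) V))).comp (Polynomial.X - Polynomial.C ξ) =
        (tp V).map (algebraMap A K) := by
      have h3 : ((Polynomial.compRingHom (Polynomial.X - Polynomial.C ξ)).comp
          ((tp (R := K)).toRingHom.comp ((trans fun _ => ξ).toRingHom))).comp (map (algebraMap A K)) =
          (Polynomial.mapRingHom (algebraMap A K)).comp (tp (R := A)).toRingHom := by
        apply MvPolynomial.ringHom_ext
        · intro a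
          simp [tp, trans]
        · intro i
          simp [tp, trans]
      exact DFunLike.congr_fun h3 V
    have h4 : (Polynomial.X - Polynomial.C ξ) ^ n ∣ (tp V).map (algebraMap A K) := by
      rw [← h2]
      obtain ⟨q, hq⟩ := h1
      rw [hq, Polynomial.mul_comp, Polynomial.pow_comp, Polynomial.X_comp]
      exact dvd_mul_right _ _
    have h5 : p.map (algebraMap A K) = Polynomial.C (algebraMap A K w) * (Polynomial.X - Polynomial.C ξ) := by
      simp only [p, Polynomial.map_add, Polynomial.map_mul, Polynomial.map_C, Polynomial.map_X]
      rw [mul_sub, ← Polynomial.C_mul, hξ, mul_div_cancel₀ _ hw', Polynomial.C_neg, sub_neg_eq_add]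
    rw [Polynomial.map_pow, h5, mul_pow]
    have hu : IsUnit ((Polynomial.C (algebraMap A K w)) ^ n) :=
      (Polynomial.isUnit_C.mpr hw'.isUnit).pow n
    exact (hu.mul_left_dvd).mpr h4
  obtain ⟨q, hq⟩ := hpn.dvd_of_fraction_map_dvd_fraction_map hdiv
  have hVt : tp V ≠ 0 := by
    obtain ⟨b, hb⟩ := exists_coeff_ne_zero hV
    intro h0
    apply hb
    rw [Finsupp.unique_single b]
    change coeff (Finsupp.single () (b ())) V = 0
    rw [← coeff_tp, h0, Polynomial.coeff_zero]
  have hq0 : q ≠ 0 := by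
    rintro rfl
    exact hVt (by rw [hq, mul_zero])
  refine ⟨q.leadingCoeff, Polynomial.leadingCoeff_ne_zero.mpr hq0, Finsupp.single () (tp V).natDegree, ?_⟩
  rw [← coeff_tp]
  change (tp V).leadingCoeff = _
  rw [hq, Polynomial.leadingCoeff_mul, Polynomial.leadingCoeff_pow, hpdef, Polynomial.leadingCoeff_linear hw]

lemma star_linear {τ : Type} (L : MvPolynomial τ ℤ) (w : ℤ) (hw : w ≠ 0)
    (hprim : ∀ a : ℤ, a ∣ w → C a ∣ L → IsUnit a) :
    Star (A := MvPolynomial τ ℤ) (K := FractionRing (MvPolynomial τ ℤ)) (l1 τ absZ)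
      (-(algebraMap _ (FractionRing (MvPolynomial τ ℤ)) L) / algebraMap _ _ (C w : MvPolynomial τ ℤ))
      |(w : ℝ)| := by
  classical
  intro V n hV hvan
  have hwA : (C w : MvPolynomial τ ℤ) ≠ 0 := by simpa using hw
  obtain ⟨q, hq, d, hd⟩ := star_abs (C w : MvPolynomial τ ℤ) L hwA (by
    intro r hr
    rw [Polynomial.C_dvd_iff_dvd_coeff] at hr
    have h1 := hr 1
    have h0 := hr 0
    simp [Polynomial.coeff_C] at h1 h0
    obtain ⟨b, hb, rfl⟩ := (dvd_C_iff_exists hw).mp h1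
    exact (hprim b hb h0).map C) V n hV hvan
  calc |(w : ℝ)| ^ n = |((w ^ n : ℤ) : ℝ)| := by push_cast; rw [abs_pow]
    _ ≤ l1 τ absZ (V.coeff d) := by
      rw [hd, ← map_pow]
      exact l1_C_mul_ge _ _ hq
    _ ≤ _ := coeff_le_l1 (l1 τ absZ) V _

end star
end Sch


namespace Sch
open MvPolynomial

section compound

/-- index set of the compound matrices -/
abbrev Ix (k q : ℕ) := Set.powersetCard (Fin k) q

/-- the increasing enumeration -/
def em {k q : ℕ} (S : Ix k q) : Fin q ↪o Fin k := Set.powersetCard.ofFinEmbEquiv.symm S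

/-- compound matrix -/
def cmp {R : Type*} [CommRing R] {k : ℕ} (q : ℕ) (B : Matrix (Fin k) (Fin k) R) :
    Matrix (Ix k q) (Ix k q) R := Matrix.of fun S' S => (B.submatrix (em S') (em S)).det

variable {R : Type*} [CommRing R] {k q : ℕ}

lemma cmp_eq (B : Matrix (Fin k) (Fin k) R) :
    cmp q B = LinearMap.toMatrix ((Pi.basisFun R (Fin k)).exteriorPower q)
      ((Pi.basisFun R (Fin k)).exteriorPower q) (exteriorPower.map q (Matrix.toLin' B)) := by
  ext S' S
  rw [LinearMap.toMatrix_apply, exteriorPower.basis_apply, exteriorPower.map_apply_ιMulti_family,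
    exteriorPower.basis_repr_apply, exteriorPower.ιMulti_family,
    exteriorPower.ιMultiDual_apply_ιMulti, cmp, Matrix.of_apply, ← Matrix.det_transpose]
  congr 1
  ext i j
  simp [em]

lemma cmp_mul (A B : Matrix (Fin k) (Fin k) R) : cmp q (A * B) = cmp q A * cmp q B := by
  rw [cmp_eq, cmp_eq, cmp_eq, Matrix.toLin'_mul, exteriorPower.map_comp,
    LinearMap.toMatrix_comp _ ((Pi.basisFun R (Fin k)).exteriorPower q)]

lemma cmp_one : cmp q (1 : Matrix (Fin k) (Fin k) R) = 1 := by
  rw [cmp_eq, Matrix.toLin'_one, exteriorPower.map_id, LinearMap.toMatrix_id]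

lemma cmp_map {R' : Type*} [CommRing R'] (f : R →+* R') (B : Matrix (Fin k) (Fin k) R) :
    cmp q (B.map f) = (cmp q B).map f := by
  ext S' S
  simp only [cmp, Matrix.of_apply, Matrix.map_apply]
  rw [RingHom.map_det]
  rfl

lemma cmp_transpose (B : Matrix (Fin k) (Fin k) R) : cmp q B.transpose = (cmp q B).transpose := by
  ext S' S
  simp only [cmp, Matrix.of_apply, Matrix.transpose_apply]
  rw [← Matrix.det_transpose]
  rfl

/-- weight of a subset -/
def wt {M : Type*} [CommMonoid M] (f : Fin k → M) (S : Ix k q) : M := ∏ s, f (em S s)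

lemma wt_eq {M : Type*} [CommMonoid M] (f : Fin k → M) (S : Ix k q) :
    wt f S = ∏ i ∈ S.1, f i := by
  have : S.1 = Finset.univ.map (em S).toEmbedding := by
    ext i
    have := Set.powersetCard.mem_range_ofFinEmbEquiv_symm_iff_mem S i
    simp only [Finset.mem_map, Finset.mem_univ, true_and]
    exact this.symm
  rw [this, Finset.prod_map]
  rfl

lemma cmp_diagonal (d : Fin k → R) : cmp q (Matrix.diagonal d) = Matrix.diagonal (wt d) := by
  ext S' S
  by_cases h : S' = S
  · subst h
    rw [Matrix.diagonal_apply_eq, cmp, Matrix.of_apply, Matrix.submatrix_diagonal _ _ (em S').injective,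
      Matrix.det_diagonal]
    rfl
  · rw [Matrix.diagonal_apply_ne _ h, cmp, Matrix.of_apply]
    obtain ⟨i, his, hit⟩ := (Set.powersetCard.exists_mem_notMem_iff_ne S' S).mp h
    obtain ⟨s, rfl⟩ := (Set.powersetCard.mem_range_ofFinEmbEquiv_symm_iff_mem S' i).mpr his
    apply Matrix.det_eq_zero_of_row_eq_zero s
    intro j
    rw [Matrix.submatrix_apply, Matrix.diagonal_apply_ne]
    intro h'
    apply hit
    rw [← Set.powersetCard.mem_range_ofFinEmbEquiv_symm_iff_mem]
    exact ⟨j, h'.symm⟩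

lemma det_bound_col {q : ℕ} (B : Matrix (Fin q) (Fin q) ℝ) (C : ℝ) (f : Fin q → ℝ)
    (h : ∀ i j, |B i j| ≤ C * f j) : |B.det| ≤ q.factorial * C ^ q * ∏ j, f j := by
  rw [Matrix.det_apply]
  refine (Finset.abs_sum_le_sum_abs _ _).trans ?_
  have : ∀ σ ∈ (Finset.univ : Finset (Equiv.Perm (Fin q))),
      |Equiv.Perm.sign σ • ∏ i, B (σ i) i| ≤ C ^ q * ∏ j, f j := by
    intro σ _
    have e : |Equiv.Perm.sign σ • ∏ i, B (σ i) i| = ∏ i, |B (σ i) i| := by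
      rcases Int.units_eq_one_or (Equiv.Perm.sign σ) with h | h <;> simp [h, Finset.abs_prod]
    rw [e]
    refine (Finset.prod_le_prod (fun _ _ => abs_nonneg _) (fun i _ => h (σ i) i)).trans ?_
    rw [Finset.prod_mul_distrib]
    simp
  refine (Finset.sum_le_sum this).trans ?_
  simp [Fintype.card_perm, mul_assoc]

lemma cmp_bound_col (B : Matrix (Fin k) (Fin k) ℝ) (C : ℝ) (f : Fin k → ℝ)
    (h : ∀ i j, |B i j| ≤ C * f j) (S' S : Ix k q) :
    |cmp q B S' S| ≤ q.factorial * C ^ q * wt f S :=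
  det_bound_col _ C _ fun i j => h _ _

lemma cmp_bound_row (B : Matrix (Fin k) (Fin k) ℝ) (C : ℝ) (f : Fin k → ℝ)
    (h : ∀ i j, |B i j| ≤ C * f i) (S' S : Ix k q) :
    |cmp q B S' S| ≤ q.factorial * C ^ q * wt f S' := by
  have := cmp_bound_col (q := q) B.transpose C f (fun i j => h j i) S S'
  rwa [cmp_transpose] at this

lemma prod_wt (k q : ℕ) : ∃ c : ℕ, ∀ f : Fin k → ℝ, ∏ S : Ix k q, wt f S = (∏ i, f i) ^ c := by
  classical
  rcases Nat.eq_zero_or_pos k with rfl | hk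
  · refine ⟨0, fun f => ?_⟩
    rw [pow_zero]
    apply Finset.prod_eq_one
    intro S _
    rw [wt_eq]
    apply Finset.prod_eq_one
    intro i
    exact i.elim0
  let cnt : Fin k → ℕ := fun i => ((Finset.univ : Finset (Ix k q)).filter fun S => i ∈ S.1).card
  have hc : ∀ i j, cnt i ≤ cnt j := by
    intro i j
    let e : Equiv.Perm (Fin k) := Equiv.swap i j
    refine Finset.card_le_card_of_injOn
      (fun S : Ix k q => (⟨S.1.map e.toEmbedding, by
        have := S.2
        simp only [Set.powersetCard.mem_iff] at this ⊢
        simpa using this⟩ : Ix k q)) ?_ ?_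
    · intro S hS
      simp only [Finset.coe_filter, Finset.mem_univ, true_and, Set.mem_setOf_eq] at hS ⊢
      rw [Finset.mem_map]
      exact ⟨i, hS, by simp [e]⟩
    · intro S _ S' _ h
      have := congrArg Subtype.val h
      exact Subtype.ext (Finset.map_injective _ this)
  refine ⟨cnt ⟨0, hk⟩, fun f => ?_⟩
  have h1 : ∀ S : Ix k q, wt f S = ∏ i, if i ∈ S.1 then f i else 1 := by
    intro S
    rw [wt_eq, Finset.prod_ite_mem, Finset.univ_inter]
  simp_rw [h1]
  rw [Finset.prod_comm, ← Finset.prod_pow]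
  refine Finset.prod_congr rfl fun i _ => ?_
  rw [Finset.prod_ite]
  rw [Finset.prod_const_one, mul_one, Finset.prod_const]
  congr 1
  exact le_antisymm (hc _ _) (hc _ _)

/-- sorting a nonvanishing minor -/
lemma exists_sorted (v : Fin k → Fin q → ℝ) (i : Fin q → Fin k)
    (h : (Matrix.of fun a l => v (i a) l).det ≠ 0) :
    ∃ S : Ix k q, (∀ s, em S s ∈ Set.range i) ∧ (Matrix.of fun a l => v (em S a) l).det ≠ 0 := by
  classical
  have hinj : Function.Injective i := by
    intro a b hab
    by_contra hne
    exact h (Matrix.det_zero_of_row_eq hne (by ext l; simp [hab]))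
  let S : Ix k q := ⟨Finset.univ.map ⟨i, hinj⟩, by simp [Set.powersetCard.mem_iff]⟩
  have hr : ∀ x, x ∈ Set.range (em S) ↔ x ∈ Set.range i := by
    intro x
    rw [em, Set.powersetCard.mem_range_ofFinEmbEquiv_symm_iff_mem]
    change x ∈ Finset.univ.map ⟨i, hinj⟩ ↔ _
    simp
  have hs : ∀ s, em S s ∈ Set.range i := fun s => (hr _).1 ⟨s, rfl⟩
  refine ⟨S, hs, ?_⟩
  choose g hg using hs
  have ginj : Function.Injective g := by
    intro a b hab
    have := congrArg i hab
    rw [hg, hg] at this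
    exact (em S).injective this
  let e : Equiv.Perm (Fin q) := Equiv.ofBijective g (Finite.injective_iff_bijective.1 ginj)
  have : (Matrix.of fun a l => v (em S a) l) = (Matrix.of fun a l => v (i a) l).submatrix e id := by
    ext a l
    simp [e, hg]
  rw [this, Matrix.det_permute]
  intro h0
  rcases mul_eq_zero.1 h0 with h1 | h1
  · rcases Int.units_eq_one_or (Equiv.Perm.sign e) with h | h <;> simp [h] at h1
  · exact h h1

lemma em_le (S : Ix k q) (s : Fin q) : (em S s : ℕ) + (q - s) ≤ k := by
  have : ∀ n : ℕ, ∀ s : Fin q, (s : ℕ) + n + 1 = q → (em S s : ℕ) + (n + 1) ≤ k := by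
    intro n
    induction n with
    | zero => intro s _; have := (em S s).2; omega
    | succ n ih =>
      intro s hs
      have h1 := ih ⟨s + 1, by omega⟩ (by simp; omega)
      have h2 : em S s < em S ⟨s + 1, by omega⟩ := (em S).strictMono (by simp [Fin.lt_def])
      have h3 : (em S s : ℕ) < (em S ⟨s + 1, by omega⟩ : ℕ) := h2
      omega
  have h := this (q - s - 1) s (by omega)
  omega

/-- the top index -/
def topIx (k q : ℕ) (h : q ≤ k) : Ix k q :=
  Set.powersetCard.ofFinEmbEquiv
    (OrderEmbedding.ofStrictMono (fun s : Fin q => (⟨k - q + s, by omega⟩ : Fin k))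
      (by intro a b hab; have h' : (a : ℕ) < b := hab; change k - q + (a : ℕ) < k - q + b; omega))

lemma em_topIx (h : q ≤ k) (s : Fin q) : (em (topIx k q h) s : ℕ) = k - q + s := by
  rw [em, topIx, Equiv.symm_apply_apply]
  rfl

lemma wt_le_top (h : q ≤ k) (hq : 0 < q) (hqk : q < k) (f : Fin k → ℝ) (hpos : ∀ i, 0 < f i)
    (hmono : Monotone f) (θ : ℝ) (hθ : f ⟨k - q - 1, by omega⟩ ≤ θ * f ⟨k - q, by omega⟩)
    (S : Ix k q) (hS : S ≠ topIx k q h) : wt f S ≤ θ * wt f (topIx k q h) := by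
  have hle : ∀ s, em S s ≤ em (topIx k q h) s := by
    intro s
    rw [Fin.le_def, em_topIx]
    have := em_le S s
    omega
  have h0 : (em S ⟨0, hq⟩ : ℕ) < k - q := by
    by_contra hc
    apply hS
    have : ∀ n : ℕ, ∀ hn : n < q, k - q + n ≤ (em S ⟨n, hn⟩ : ℕ) := by
      intro n
      induction n with
      | zero => intro _; omega
      | succ n ih =>
        intro hn
        have h1 := ih (by omega)
        have h2 : em S ⟨n, by omega⟩ < em S ⟨n + 1, hn⟩ := (em S).strictMono (by simp [Fin.lt_def])
        have h3 : (em S ⟨n, by omega⟩ : ℕ) < (em S ⟨n + 1, hn⟩ : ℕ) := h2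
        omega
    apply Set.powersetCard.ofFinEmbEquiv.symm.injective
    ext s
    have a := this s s.2
    have b := hle s
    rw [Fin.le_def, em_topIx] at b
    have c := em_topIx h s
    change (em S s : ℕ) = (em (topIx k q h) s : ℕ)
    simp only [Fin.eta] at a
    omega
  obtain ⟨r, rfl⟩ : ∃ r, q = r + 1 := ⟨q - 1, by omega⟩
  rw [wt, wt, Fin.prod_univ_succ, Fin.prod_univ_succ, ← mul_assoc]
  refine mul_le_mul ?_ (Finset.prod_le_prod (fun _ _ => (hpos _).le) fun s _ => hmono (hle _))
    (Finset.prod_nonneg fun _ _ => (hpos _).le) ?_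
  · have e1 : f (em S 0) ≤ f ⟨k - (r + 1) - 1, by omega⟩ := by
      apply hmono
      rw [Fin.le_def]
      have : (em S 0 : ℕ) < k - (r + 1) := h0
      simp only
      omega
    have e2 : em (topIx k (r + 1) h) 0 = ⟨k - (r + 1), by omega⟩ := by
      ext
      rw [em_topIx]
      simp
    rw [e2]
    linarith
  · have e2 : em (topIx k (r + 1) h) 0 = ⟨k - (r + 1), by omega⟩ := by
      ext
      rw [em_topIx]
      simp
    rw [e2]
    exact (hpos _).le.trans hθ

end compound
end Sch


namespace Sch
open MvPolynomial

section lattice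

lemma exists_unimodular {k : ℕ} (x : Fin (k + 1) → ℤ) :
    ∃ U : Matrix (Fin (k + 1)) (Fin (k + 1)) ℤ, IsUnit U.det ∧ ∃ c : ℤ, ∀ i, x i = c * U i 0 := by
  classical
  by_cases hx : x = 0
  · exact ⟨1, by simp, 0, by simp [hx]⟩
  obtain ⟨n, snf⟩ := Submodule.smithNormalForm (Pi.basisFun ℤ (Fin (k + 1))) (Submodule.span ℤ {x})
  have hn : 0 < n := by
    rcases Nat.eq_zero_or_pos n with rfl | h
    · exfalso
      apply hx
      have := (snf.bN.repr).injective
        (Subsingleton.elim (snf.bN.repr ⟨x, Submodule.mem_span_singleton_self x⟩) (snf.bN.repr 0))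
      exact congrArg Subtype.val this
    · exact h
  let i0 : Fin n := ⟨0, hn⟩
  obtain ⟨y, hy⟩ := Submodule.mem_span_singleton.1 (snf.bN i0).2
  have hy0 : y ≠ 0 := by
    rintro rfl
    rw [zero_smul] at hy
    exact snf.bN.ne_zero i0 (Subtype.ext hy.symm)
  rw [snf.snf] at hy
  set j := snf.f i0
  have hrep : ∀ l, l ≠ j → snf.bM.repr x l = 0 := by
    intro l hl
    have h1 := congrArg (fun z => snf.bM.repr z l) hy
    simp only [map_smul, Finsupp.smul_apply, Module.Basis.repr_self, smul_eq_mul] at h1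
    rw [Finsupp.single_eq_of_ne hl, mul_zero] at h1
    exact (mul_eq_zero.1 h1).resolve_left hy0
  have hxe : x = snf.bM.repr x j • snf.bM j := by
    conv_lhs => rw [← snf.bM.sum_repr x]
    rw [Finset.sum_eq_single j]
    · intro b _ hb
      rw [hrep b hb, zero_smul]
    · simp
  let b := snf.bM.reindex (Equiv.swap j 0)
  refine ⟨(Pi.basisFun ℤ (Fin (k + 1))).toMatrix b, ?_, snf.bM.repr x j, ?_⟩
  · exact Matrix.isUnit_det_of_right_inverse
      ((Pi.basisFun ℤ (Fin (k + 1))).toMatrix_mul_toMatrix_flip b)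
  · intro i
    conv_lhs => rw [hxe]
    simp [b, Module.Basis.toMatrix_apply]

/-- integer matrices as real matrices -/
abbrev ir {n : Type*} (U : Matrix n n ℤ) : Matrix n n ℝ := U.map (Int.castRingHom ℝ)

/-- integer vectors as real vectors -/
abbrev iv {n : Type*} (x : n → ℤ) : n → ℝ := fun i => (x i : ℝ)

lemma exists_shortest {k : ℕ} (g : Matrix (Fin (k + 1)) (Fin (k + 1)) ℝ) (hg : g.det ≠ 0) :
    ∃ x : Fin (k + 1) → ℤ, x ≠ 0 ∧ ∀ y : Fin (k + 1) → ℤ, y ≠ 0 →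
      ‖g.mulVec (iv x)‖ ≤ ‖g.mulVec (iv y)‖ := by
  classical
  let x0 : Fin (k + 1) → ℤ := fun _ => 1
  have hx0 : x0 ≠ 0 := fun h => one_ne_zero (congrFun h 0)
  set r := ‖g.mulVec (iv x0)‖ with hr
  let s : Set (Fin (k + 1) → ℤ) := {x | x ≠ 0 ∧ ‖g.mulVec (iv x)‖ ≤ r}
  have hfin : s.Finite := by
    let b : Fin (k + 1) → ℤ := fun i => ⌈∑ j, |g⁻¹ i j| * r⌉
    refine (Set.finite_Icc (-b) b).subset ?_
    rintro x ⟨-, hx⟩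
    have hb : ∀ i, |x i| ≤ b i := by
      intro i
      have h1 : iv x = g⁻¹.mulVec (g.mulVec (iv x)) := by
        rw [Matrix.mulVec_mulVec, Matrix.nonsing_inv_mul _ (isUnit_iff_ne_zero.2 hg),
          Matrix.one_mulVec]
      have h2 : |(x i : ℝ)| ≤ ∑ j, |g⁻¹ i j| * r := by
        have : (x i : ℝ) = iv x i := rfl
        rw [this, h1, Matrix.mulVec, dotProduct]
        refine (Finset.abs_sum_le_sum_abs _ _).trans (Finset.sum_le_sum fun j _ => ?_)
        rw [abs_mul]
        refine mul_le_mul_of_nonneg_left ?_ (abs_nonneg _)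
        exact (norm_le_pi_norm (g.mulVec (iv x)) j).trans hx
      have h3 := h2.trans (Int.le_ceil _)
      exact_mod_cast h3
    exact ⟨fun i => (abs_le.1 (hb i)).1, fun i => (abs_le.1 (hb i)).2⟩
  obtain ⟨x, hx, hmin⟩ := hfin.exists_minimalFor (fun x => ‖g.mulVec (iv x)‖) s ⟨x0, hx0, le_rfl⟩
  refine ⟨x, hx.1, fun y hy => ?_⟩
  by_contra hc
  push Not at hc
  exact absurd (hmin ⟨hy, hc.le.trans hx.2⟩ hc.le) (not_le.2 hc)

lemma schur_det {k : ℕ} (g : Matrix (Fin (k + 1)) (Fin (k + 1)) ℝ) (h0 : g 0 0 ≠ 0) :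
    g.det = g 0 0 * (Matrix.of fun i j : Fin k =>
      g i.succ j.succ - g i.succ 0 / g 0 0 * g 0 j.succ).det := by
  let B : Matrix (Fin (k + 1)) (Fin (k + 1)) ℝ := Matrix.of fun i j =>
    g i j - (if i = 0 then 0 else g i 0 / g 0 0) * g 0 j
  have hB : g.det = B.det := by
    refine Matrix.det_eq_of_forall_row_eq_smul_add_const
      (fun i => if i = 0 then 0 else g i 0 / g 0 0) 0 (by simp) ?_
    intro i j
    simp [B]
  rw [hB, Matrix.det_succ_column_zero, Fin.sum_univ_succ]
  have : ∀ i : Fin k, B i.succ 0 = 0 := by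
    intro i
    simp [B, h0]
  simp only [this]
  simp only [mul_zero, zero_mul, Finset.sum_const_zero, add_zero]
  have e : B 0 0 = g 0 0 := by simp [B]
  rw [e]
  simp only [Fin.coe_ofNat_eq_mod, Nat.zero_mod, pow_zero, one_mul]
  congr 2

theorem reduction (k : ℕ) : ∃ C : ℝ, 1 ≤ C ∧ ∀ g : Matrix (Fin k) (Fin k) ℝ, g.det ≠ 0 →
    ∃ U : Matrix (Fin k) (Fin k) ℤ, IsUnit U.det ∧ ∃ (π : Equiv.Perm (Fin k)) (lam : Fin k → ℝ),
      Monotone lam ∧ (∀ i, 0 < lam i) ∧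
      (∀ i j, |(g * ir U) (π i) j| ≤ lam i) ∧ (∀ i j, |(g * ir U) (π i) j| ≤ lam j) ∧
      ∏ i, lam i ≤ C * |g.det| ∧
      ∀ j : Fin k, (j : ℕ) = 0 → ∀ x : Fin k → ℤ, x ≠ 0 → lam j ≤ ‖g.mulVec (iv x)‖ := by
  induction k with
  | zero =>
    refine ⟨1, le_rfl, fun g _ => ⟨1, by simp, 1, fun _ => 1, ?_, ?_, ?_, ?_, ?_, ?_⟩⟩
    · intro i; exact i.elim0
    · intro i; exact i.elim0
    · intro i; exact i.elim0
    · intro i; exact i.elim0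
    · simp
    · intro i; exact i.elim0
  | succ k ih =>
    obtain ⟨C, hC1, hC⟩ := ih
    refine ⟨2 ^ k * C, one_le_mul_of_one_le_of_one_le (one_le_pow₀ (by norm_num)) hC1,
      fun g hg => ?_⟩
    obtain ⟨x, hx0, hmin⟩ := exists_shortest g hg
    obtain ⟨U1, hU1, c, hxc⟩ := exists_unimodular x
    have hc0 : c ≠ 0 := by
      rintro rfl
      exact hx0 (funext fun i => by simp [hxc i])
    -- first column
    have hu0 : (fun i => U1 i 0) ≠ 0 := by
      intro h
      exact hx0 (funext fun i => by rw [hxc i, show U1 i 0 = 0 from congrFun h i]; simp)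
    set b : Fin (k + 1) → ℝ := g.mulVec (iv fun i => U1 i 0) with hb
    have hxb : g.mulVec (iv x) = (c : ℝ) • b := by
      rw [hb, ← Matrix.mulVec_smul]
      congr 1
      ext i
      change (x i : ℝ) = c * (U1 i 0 : ℝ)
      exact_mod_cast hxc i
    have hbmin : ∀ y : Fin (k + 1) → ℤ, y ≠ 0 → ‖b‖ ≤ ‖g.mulVec (iv y)‖ := by
      intro y hy
      refine le_trans ?_ (hmin y hy)
      rw [hxb, norm_smul]
      have : (1 : ℝ) ≤ ‖(c : ℝ)‖ := by
        rw [Real.norm_eq_abs]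
        exact_mod_cast Int.one_le_abs hc0
      nlinarith [norm_nonneg b]
    obtain ⟨i0, -, hi0⟩ := Finset.exists_max_image (Finset.univ : Finset (Fin (k + 1)))
      (fun i => |b i|) ⟨0, Finset.mem_univ _⟩
    have hbi0 : ‖b‖ = |b i0| := by
      apply le_antisymm
      · exact (pi_norm_le_iff_of_nonneg (abs_nonneg _)).2 fun i => hi0 i (Finset.mem_univ _)
      · exact norm_le_pi_norm b i0
    -- determinants
    have hirdet : ∀ {n : ℕ} (V : Matrix (Fin n) (Fin n) ℤ), IsUnit V.det → |(ir V).det| = 1 := by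
      intro n V hV
      have : (ir V).det = ((V.det : ℤ) : ℝ) := by
        rw [ir, ← RingHom.mapMatrix_apply, ← RingHom.map_det]
        rfl
      rw [this]
      rcases Int.isUnit_iff.1 hV with h | h <;> simp [h]
    set g1 := g * ir U1 with hg1
    have hg1b : ∀ i, g1 i 0 = b i := by
      intro i
      simp [hg1, hb, Matrix.mul_apply, Matrix.mulVec, dotProduct]
    have hg1d : |g1.det| = |g.det| := by
      rw [hg1, Matrix.det_mul, abs_mul, hirdet _ hU1, mul_one]
    set g2 := g1.submatrix (Equiv.swap 0 i0) id with hg2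
    have hg2d : |g2.det| = |g.det| := by
      rw [hg2, Matrix.det_permute, abs_mul, hg1d]
      rcases Int.units_eq_one_or (Equiv.Perm.sign (Equiv.swap 0 i0)) with h | h <;> simp [h]
    have hg2i : ∀ i, |g2 i 0| ≤ ‖b‖ := by
      intro i
      simp only [hg2, Matrix.submatrix_apply, id, hg1b]
      exact norm_le_pi_norm b _
    have hg200 : |g2 0 0| = ‖b‖ := by
      simp [hg2, hg1b, hbi0]
    have hbpos : 0 < ‖b‖ := by
      refine norm_pos_iff.2 fun h0 => ?_
      have h1 : g⁻¹.mulVec b = iv fun i => U1 i 0 := by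
        rw [hb, Matrix.mulVec_mulVec, Matrix.nonsing_inv_mul _ (isUnit_iff_ne_zero.2 hg),
          Matrix.one_mulVec]
      rw [h0, Matrix.mulVec_zero] at h1
      apply hu0
      ext i
      have := congrFun h1 i
      simp only [iv, Pi.zero_apply] at this ⊢
      exact_mod_cast this.symm
    have hβ : g2 0 0 ≠ 0 := by
      intro h
      rw [h, abs_zero] at hg200
      exact hbpos.ne hg200
    set G : Matrix (Fin k) (Fin k) ℝ := Matrix.of fun i j : Fin k =>
      g2 i.succ j.succ - g2 i.succ 0 / g2 0 0 * g2 0 j.succ with hG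
    have hdet : g2.det = g2 0 0 * G.det := schur_det g2 hβ
    have hgd : |g.det| = ‖b‖ * |G.det| := by rw [← hg2d, hdet, abs_mul, hg200]
    have hGd : G.det ≠ 0 := by
      intro h
      rw [h, abs_zero, mul_zero, abs_eq_zero] at hgd
      exact hg hgd
    obtain ⟨U', hU', π', lam', hmono, hpos, hrow, hcol, hprod, -⟩ := hC G hGd
    -- the lift
    let ρ : Fin k → ℝ := fun j => ∑ l : Fin k, g2 0 l.succ * (U' l j : ℝ)
    let t : Fin k → ℤ := fun j => - round (ρ j / g2 0 0)
    let U2 : Matrix (Fin (k + 1)) (Fin (k + 1)) ℤ := Matrix.of fun i j =>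
      Fin.cases (Fin.cases 1 (fun j => t j) j) (fun i => Fin.cases 0 (fun j => U' i j) j) i
    have hU200 : U2 0 0 = 1 := rfl
    have hU20 : ∀ j : Fin k, U2 0 j.succ = t j := fun _ => rfl
    have hU2s0 : ∀ i : Fin k, U2 i.succ 0 = 0 := fun _ => rfl
    have hU2s : ∀ i j : Fin k, U2 i.succ j.succ = U' i j := fun _ _ => rfl
    have hU2 : IsUnit U2.det := by
      have : U2.det = U'.det := by
        rw [Matrix.det_succ_column_zero, Fin.sum_univ_succ]
        simp only [hU2s0, hU200]
        simp only [Fin.coe_ofNat_eq_mod, Nat.zero_mod, pow_zero, mul_one, one_mul, mul_zero,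
          zero_mul, Finset.sum_const_zero, add_zero]
        congr 1
      rw [this]
      exact hU'
    set θ : Fin k → ℝ := fun j => ρ j / g2 0 0 + t j with hθ
    have hθ2 : ∀ j, |θ j| ≤ 1 / 2 := by
      intro j
      have := abs_sub_round (ρ j / g2 0 0)
      simpa [hθ, t, sub_eq_add_neg] using this
    set W := g2 * ir U2 with hW
    have hW0 : ∀ i, W i 0 = g2 i 0 := by
      intro i
      simp [hW, Matrix.mul_apply, Fin.sum_univ_succ, hU200, hU2s0]
    have hWt : ∀ j : Fin k, W 0 j.succ = g2 0 0 * θ j := by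
      intro j
      simp only [hW, Matrix.mul_apply, Fin.sum_univ_succ, Matrix.map_apply, hU20, hU2s, hθ]
      simp only [Int.coe_castRingHom]
      change _ + ρ j = _
      field_simp
      ring
    have hWs : ∀ i j : Fin k, W i.succ j.succ = (G * ir U') i j + g2 i.succ 0 * θ j := by
      intro i j
      have e : (G * ir U') i j = (∑ l : Fin k, g2 i.succ l.succ * (U' l j : ℝ))
          - g2 i.succ 0 / g2 0 0 * ρ j := by
        simp only [hG, Matrix.mul_apply, Matrix.of_apply, Matrix.map_apply, ρ, Finset.mul_sum]
        rw [← Finset.sum_sub_distrib]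
        refine Finset.sum_congr rfl fun l _ => ?_
        simp only [Int.coe_castRingHom]
        ring
      rw [e]
      simp only [hW, Matrix.mul_apply, Fin.sum_univ_succ, Matrix.map_apply, hU20, hU2s, hθ]
      simp only [Int.coe_castRingHom]
      field_simp
      ring
    set U := U1 * U2 with hUdef
    have hUu : IsUnit U.det := by
      rw [hUdef, Matrix.det_mul]
      exact hU1.mul hU2
    have hgU : g * ir U = g1 * ir U2 := by
      rw [hUdef, hg1, Matrix.mul_assoc]
      congr 1
      exact Matrix.map_mul
    have hgUW : ∀ i j, (g * ir U) (Equiv.swap 0 i0 i) j = W i j := by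
      intro i j
      rw [hgU, hW, hg2]
      simp [Matrix.mul_apply]
    let π : Equiv.Perm (Fin (k + 1)) := Equiv.Perm.decomposeFin.symm (i0, π')
    have hπ0 : ∀ j, (g * ir U) (π 0) j = W 0 j := by
      intro j
      rw [← hgUW]
      simp [π]
    have hπs : ∀ i j, (g * ir U) (π (Fin.succ i)) j = W (π' i).succ j := by
      intro i j
      rw [← hgUW]
      simp [π]
    let lam : Fin (k + 1) → ℝ := Fin.cons ‖b‖ (fun i => 2 * lam' i)
    -- key: lam 0 ≤ lam (succ j)
    have hcolne : ∀ j, (fun i => U i j) ≠ 0 := by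
      intro j h
      have : U.det = 0 := Matrix.det_eq_zero_of_column_eq_zero j fun i => congrFun h i
      rw [this] at hUu
      exact not_isUnit_zero hUu
    have hkey : ∀ j : Fin k, ‖b‖ ≤ 2 * lam' j := by
      intro j
      by_contra hcon
      push Not at hcon
      have h1 := hbmin _ (hcolne j.succ)
      have h2 : ∀ i, |W i j.succ| < ‖b‖ := by
        intro i
        refine Fin.cases ?_ (fun i => ?_) i
        · rw [hWt, abs_mul, hg200]
          nlinarith [hθ2 j]
        · rw [hWs]
          refine (abs_add_le _ _).trans_lt ?_
          rw [abs_mul]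
          have h3 : |(G * ir U') i j| ≤ lam' j := by
            have := hcol (π'.symm i) j
            rwa [Equiv.apply_symm_apply] at this
          nlinarith [hθ2 j, hg2i i.succ, abs_nonneg (θ j), abs_nonneg (g2 i.succ 0)]
      have h4 : ‖g.mulVec (iv fun i => U i j.succ)‖ < ‖b‖ := by
        refine (pi_norm_lt_iff hbpos).2 fun i => ?_
        have h5 := h2 (Equiv.swap 0 i0 i)
        rw [← hgUW, Equiv.swap_apply_self] at h5
        simpa [Matrix.mul_apply, Matrix.mulVec, dotProduct] using h5
      linarith
    refine ⟨U, hUu, π, lam, ?_, ?_, ?_, ?_, ?_, ?_⟩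
    · intro i j hij
      induction i using Fin.cases with
      | zero =>
        induction j using Fin.cases with
        | zero => exact le_rfl
        | succ j => exact hkey j
      | succ i =>
        induction j using Fin.cases with
        | zero => simp [Fin.le_def] at hij
        | succ j =>
          have := hmono (Fin.succ_le_succ_iff.1 hij)
          simp only [lam, Fin.cons_succ]
          linarith
    · intro i
      induction i using Fin.cases with
      | zero => exact hbpos
      | succ i => simpa [lam] using hpos i
    · intro i j
      induction i using Fin.cases with
      | zero =>
        rw [hπ0]
        simp only [lam, Fin.cons_zero]
        induction j using Fin.cases with
        | zero => rw [hW0]; exact hg2i 0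
        | succ j =>
          rw [hWt, abs_mul, hg200]
          nlinarith [hθ2 j]
      | succ i =>
        rw [hπs]
        simp only [lam, Fin.cons_succ]
        induction j using Fin.cases with
        | zero => rw [hW0]; exact (hg2i _).trans (hkey i)
        | succ j =>
          rw [hWs]
          refine (abs_add_le _ _).trans ?_
          rw [abs_mul]
          have h3 := hrow i j
          nlinarith [hθ2 j, hg2i (π' i).succ, abs_nonneg (θ j), abs_nonneg (g2 (π' i).succ 0),
            hkey i]
    · intro i j
      induction j using Fin.cases with
      | zero =>
        simp only [lam, Fin.cons_zero]
        induction i using Fin.cases with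
        | zero => rw [hπ0, hW0]; exact hg2i 0
        | succ i => rw [hπs, hW0]; exact hg2i _
      | succ j =>
        simp only [lam, Fin.cons_succ]
        induction i using Fin.cases with
        | zero =>
          rw [hπ0, hWt, abs_mul, hg200]
          nlinarith [hθ2 j, hkey j]
        | succ i =>
          rw [hπs, hWs]
          refine (abs_add_le _ _).trans ?_
          rw [abs_mul]
          have h3 := hcol i j
          nlinarith [hθ2 j, hg2i (π' i).succ, abs_nonneg (θ j), abs_nonneg (g2 (π' i).succ 0),
            hkey j]
    · rw [Fin.prod_univ_succ]
      simp only [lam, Fin.cons_zero, Fin.cons_succ]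
      rw [Finset.prod_mul_distrib, Finset.prod_const, Finset.card_univ, Fintype.card_fin, hgd]
      have : ‖b‖ * (2 ^ k * ∏ i, lam' i) ≤ ‖b‖ * (2 ^ k * (C * |G.det|)) := by gcongr
      refine this.trans (le_of_eq ?_)
      ring
    · intro j hj y hy
      have : j = 0 := Fin.ext hj
      subst this
      exact hbmin y hy

end lattice
end Sch


namespace Sch
open MvPolynomial

section liouville
attribute [local instance] Matrix.linftyOpNormedRing Matrix.linftyOpNormedAddCommGroup

variable {R : Type} [CommRing R] [IsDomain R] {D : ℕ} (b : Module.Basis (Fin D) ℤ R)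

/-- the size of an algebraic integer -/
noncomputable def sz : RingSeminorm R where
  toFun x := ‖Algebra.leftMulMatrix b x‖
  map_zero' := by simp
  add_le' x y := by rw [map_add]; exact norm_add_le _ _
  neg' x := by rw [map_neg, norm_neg]
  mul_le' x y := by rw [map_mul]; exact norm_mul_le _ _

lemma sz_apply (x : R) : sz b x = ‖Algebra.leftMulMatrix b x‖ := rfl

lemma entry_le_norm (M : Matrix (Fin D) (Fin D) ℤ) (i j : Fin D) : |(M i j : ℝ)| ≤ ‖M‖ := by
  rw [Matrix.linfty_opNorm_def]
  have h1 : ‖M i j‖₊ ≤ ∑ j, ‖M i j‖₊ :=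
    Finset.single_le_sum (f := fun j => ‖M i j‖₊) (fun _ _ => zero_le) (Finset.mem_univ j)
  have h2 : (∑ j, ‖M i j‖₊) ≤ Finset.univ.sup fun i => ∑ j, ‖M i j‖₊ :=
    Finset.le_sup (f := fun i => ∑ j, ‖M i j‖₊) (Finset.mem_univ i)
  have h3 := h1.trans h2
  have h4 : (‖M i j‖₊ : ℝ) = |(M i j : ℝ)| := by
    rw [coe_nnnorm, Int.norm_eq_abs]
  rw [← h4]
  exact_mod_cast h3

lemma sz_one : sz b 1 ≤ 1 := by
  rw [sz_apply, map_one, Matrix.linfty_opNorm_def]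
  have : (Finset.univ.sup fun i : Fin D => ∑ j, ‖(1 : Matrix (Fin D) (Fin D) ℤ) i j‖₊) ≤ 1 := by
    refine Finset.sup_le fun i _ => ?_
    rw [Finset.sum_eq_single i]
    · simp
    · intro j _ hj
      rw [Matrix.one_apply_ne hj.symm]
      simp
    · simp
  exact_mod_cast this

lemma sz_coord : ∃ C : ℝ, 1 ≤ C ∧ ∀ x i, |(b.repr x i : ℝ)| ≤ C * sz b x := by
  refine ⟨1 + ∑ j, |(b.repr 1 j : ℝ)|, ?_, fun x i => ?_⟩
  · have : 0 ≤ ∑ j, |(b.repr 1 j : ℝ)| := Finset.sum_nonneg fun _ _ => abs_nonneg _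
    linarith
  have h : (b.repr x i : ℝ) = ∑ j, (Algebra.leftMulMatrix b x i j : ℝ) * (b.repr 1 j : ℝ) := by
    have h1 := congrFun (Algebra.leftMulMatrix_mulVec_repr b x 1) i
    rw [mul_one, Matrix.mulVec, dotProduct] at h1
    rw [← h1]
    push_cast
    rfl
  rw [h]
  refine (Finset.abs_sum_le_sum_abs _ _).trans ?_
  have : ∀ j ∈ Finset.univ, |(Algebra.leftMulMatrix b x i j : ℝ) * (b.repr 1 j : ℝ)|
      ≤ sz b x * |(b.repr 1 j : ℝ)| := by
    intro j _
    rw [abs_mul]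
    exact mul_le_mul_of_nonneg_right (entry_le_norm _ i j) (abs_nonneg _)
  refine (Finset.sum_le_sum this).trans ?_
  rw [← Finset.mul_sum]
  nlinarith [apply_nonneg (sz b) x]

lemma liouville (φ : R →+* ℝ) : ∃ c : ℝ, 0 < c ∧ ∀ x : R, x ≠ 0 → ∀ s : ℝ, 1 ≤ s → sz b x ≤ s →
    c / s ^ D ≤ |φ x| := by
  classical
  let w : Fin D → ℝ := fun j => φ (b j)
  have hw : ∃ j, w j ≠ 0 := by
    by_contra hcon
    push Not at hcon
    have h1 : (1 : ℝ) = 0 := by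
      rw [← φ.map_one, ← b.sum_repr 1, map_sum]
      refine Finset.sum_eq_zero fun j _ => ?_
      rw [zsmul_eq_mul, map_mul]
      have : φ (b j) = 0 := hcon j
      rw [this, mul_zero]
    exact one_ne_zero h1
  obtain ⟨j, hj⟩ := hw
  set W := ∑ i, |w i| with hWdef
  have hW : |w j| ≤ W := Finset.single_le_sum (f := fun i => |w i|) (fun _ _ => abs_nonneg _)
    (Finset.mem_univ j)
  have hjp : 0 < |w j| := abs_pos.2 hj
  have hWp : 0 < W := lt_of_lt_of_le hjp hW
  have hF : (0 : ℝ) < D.factorial := by exact_mod_cast D.factorial_pos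
  refine ⟨|w j| / (W * D.factorial), by positivity, fun x hx s hs hxs => ?_⟩
  set Ψ : Matrix (Fin D) (Fin D) ℝ := ir (Algebra.leftMulMatrix b x) with hΨ
  have hent : ∀ i j, |Ψ i j| ≤ s := fun i j => (entry_le_norm _ i j).trans hxs
  have heig : Matrix.vecMul w Ψ = φ x • w := by
    ext l
    have h1 := congrArg φ (b.sum_repr (x * b l))
    rw [map_sum, φ.map_mul] at h1
    simp only [Matrix.vecMul, dotProduct, Pi.smul_apply, smul_eq_mul]
    change _ = φ x * φ (b l)
    rw [← h1]
    refine Finset.sum_congr rfl fun i _ => ?_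
    rw [zsmul_eq_mul, map_mul, map_intCast, mul_comm]
    simp [hΨ, Algebra.leftMulMatrix_eq_repr_mul, w]
  have hdet : (1 : ℝ) ≤ |Ψ.det| := by
    have e : Ψ.det = (((Algebra.leftMulMatrix b x).det : ℤ) : ℝ) := by
      rw [hΨ, ir, ← RingHom.mapMatrix_apply, ← RingHom.map_det]
      rfl
    rw [e]
    have hne : (Algebra.leftMulMatrix b x).det ≠ 0 := by
      haveI := Module.Free.of_basis b
      haveI := Module.Finite.of_basis b
      rw [← Algebra.norm_eq_matrix_det]
      exact Algebra.norm_ne_zero_iff.2 hx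
    exact_mod_cast Int.one_le_abs hne
  have hadj : Ψ.det * w j = φ x * Matrix.vecMul w Ψ.adjugate j := by
    have h1 : Matrix.vecMul (Matrix.vecMul w Ψ) Ψ.adjugate = Ψ.det • w := by
      rw [Matrix.vecMul_vecMul, Matrix.mul_adjugate, Matrix.vecMul_smul, Matrix.vecMul_one]
    rw [heig, Matrix.smul_vecMul] at h1
    exact (congrFun h1 j).symm
  have hadjb : ∀ i l, |Ψ.adjugate i l| ≤ D.factorial * s ^ D := by
    intro i l
    rw [Matrix.adjugate_apply]
    have := det_bound_col (Ψ.updateRow l (Pi.single i 1)) s (fun _ => 1) (by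
      intro a c
      rw [mul_one, Matrix.updateRow_apply]
      split_ifs
      · rw [Pi.single_apply]
        split_ifs <;> simp <;> linarith
      · exact hent a c)
    simpa using this
  have hv : |Matrix.vecMul w Ψ.adjugate j| ≤ W * (D.factorial * s ^ D) := by
    rw [Matrix.vecMul, dotProduct]
    refine (Finset.abs_sum_le_sum_abs _ _).trans ?_
    rw [hWdef, Finset.sum_mul]
    refine Finset.sum_le_sum fun i _ => ?_
    rw [abs_mul]
    exact mul_le_mul_of_nonneg_left (hadjb i j) (abs_nonneg _)
  have h2 : |w j| ≤ |φ x| * (W * (D.factorial * s ^ D)) := by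
    have h3 : |Ψ.det| * |w j| ≤ |φ x| * (W * (D.factorial * s ^ D)) := by
      rw [← abs_mul, hadj, abs_mul]
      exact mul_le_mul_of_nonneg_left hv (abs_nonneg _)
    nlinarith
  have hsp : 0 < s ^ D := by positivity
  rw [div_div, div_le_iff₀ (by positivity)]
  linarith [mul_assoc W (D.factorial : ℝ) (s ^ D)]

end liouville

lemma exists_ring {k : ℕ} (α : Fin k → ℝ) (hα : ∀ i, IsAlgebraic ℚ (α i)) :
    ∃ (R : Type) (_ : CommRing R) (_ : IsDomain R) (D : ℕ) (_ : Module.Basis (Fin D) ℤ R)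
      (φ : R →+* ℝ) (N : ℤ) (a : Fin k → R),
      Function.Injective φ ∧ N ≠ 0 ∧ ∀ i, φ (a i) = N * α i := by
  classical
  have h1 : ∀ i, ∃ y : ℤ, y ≠ 0 ∧ IsIntegral ℤ (y • α i) := by
    intro i
    have : IsAlgebraic ℤ (α i) := (IsFractionRing.isAlgebraic_iff ℤ ℚ ℝ).2 (hα i)
    exact this.exists_integral_multiple
  choose y hy0 hy using h1
  let N : ℤ := ∏ i, y i
  have hintg : ∀ i, IsIntegral ℤ (N • α i) := by
    intro i
    have : N = (∏ l ∈ Finset.univ.erase i, y l) * y i := by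
      rw [Finset.prod_erase_mul _ _ (Finset.mem_univ i)]
    rw [this, mul_smul, zsmul_eq_mul]
    exact (isIntegral_algebraMap (R := ℤ)).mul (hy i)
  let s : Set ℝ := Set.range fun i => N • α i
  let A := Algebra.adjoin ℤ s
  have hfin : (Subalgebra.toSubmodule A).FG := fg_adjoin_of_finite (Set.finite_range _) (by
    rintro _ ⟨i, rfl⟩
    exact hintg i)
  haveI : Module.Finite ℤ A := Module.Finite.iff_fg.2 hfin
  haveI : Module.Free ℤ A := inferInstance
  let b := Module.finBasis ℤ A
  refine ⟨A, inferInstance, inferInstance, _, b, A.val.toRingHom, N,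
    fun i => ⟨N • α i, Algebra.subset_adjoin ⟨i, rfl⟩⟩, Subtype.val_injective,
    Finset.prod_ne_zero_iff.2 fun i _ => hy0 i, fun i => ?_⟩
  change N • α i = _
  rw [zsmul_eq_mul]

end Sch


namespace Sch
open MvPolynomial

section cheb
variable {ι : Type} [Fintype ι] [DecidableEq ι]

lemma sum_piAntidiag_zero (r : ℕ) (c : ι → ℝ) (hc : ∑ s, c s = 0) :
    ∑ b ∈ Finset.piAntidiag (Finset.univ : Finset ι) r, ∑ s, c s * (b s : ℝ) = 0 := by
  have hsym : ∀ s t : ι, ∑ b ∈ Finset.piAntidiag (Finset.univ : Finset ι) r, (b s : ℝ)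
      = ∑ b ∈ Finset.piAntidiag (Finset.univ : Finset ι) r, (b t : ℝ) := by
    intro s t
    have hmem : ∀ b ∈ Finset.piAntidiag (Finset.univ : Finset ι) r,
        b ∘ Equiv.swap s t ∈ Finset.piAntidiag (Finset.univ : Finset ι) r := by
      intro b hb
      simp only [Finset.mem_piAntidiag, Finset.mem_univ, implies_true, and_true] at hb ⊢
      rw [← hb]
      exact Equiv.sum_comp (Equiv.swap s t) b
    refine Finset.sum_bij' (fun b _ => b ∘ Equiv.swap s t) (fun b _ => b ∘ Equiv.swap s t)
      hmem hmem ?_ ?_ ?_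
    · intro b _; ext x; simp
    · intro b _; ext x; simp
    · intro b _; simp
  rw [Finset.sum_comm]
  by_cases hne : Nonempty ι
  · obtain ⟨t⟩ := hne
    simp_rw [← Finset.mul_sum]
    rw [Finset.sum_congr rfl fun s _ => by rw [hsym s t], ← Finset.sum_mul, hc, zero_mul]
  · haveI := not_nonempty_iff.1 hne
    simp

lemma sum_piFinset_sq {m : ℕ} {κ : Type} [DecidableEq κ] (t : Fin m → Finset κ)
    (X : Fin m → κ → ℝ) (B : ℝ)
    (h0 : ∀ h, ∑ b ∈ t h, X h b = 0) (hB : ∀ h, ∀ b ∈ t h, |X h b| ≤ B) :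
    ∑ b ∈ Fintype.piFinset t, (∑ h, X h (b h)) ^ 2 ≤ (Fintype.piFinset t).card * (m * B ^ 2) := by
  have e : ∀ b : Fin m → κ, (∑ h, X h (b h)) ^ 2 = ∑ h, ∑ h', X h (b h) * X h' (b h') := by
    intro b
    rw [sq, Finset.sum_mul_sum]
  simp_rw [e]
  rw [Finset.sum_comm]
  have key : ∀ h ∈ (Finset.univ : Finset (Fin m)),
      ∑ b ∈ Fintype.piFinset t, ∑ h', X h (b h) * X h' (b h')
        ≤ (Fintype.piFinset t).card * B ^ 2 := by
    intro h _
    rw [Finset.sum_comm, Finset.sum_eq_single h]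
    · rw [← nsmul_eq_mul]
      refine Finset.sum_le_card_nsmul _ _ _ fun b hb => ?_
      have := hB h (b h) (Fintype.mem_piFinset.1 hb h)
      rw [← sq, ← sq_abs]
      exact pow_le_pow_left₀ (abs_nonneg _) this 2
    · intro h' _ hne
      have e2 : ∀ b : Fin m → κ, X h (b h) * X h' (b h') =
          ∏ g, (if g = h then X h (b g) else 1) * (if g = h' then X h' (b g) else 1) := by
        intro b
        rw [Finset.prod_mul_distrib, Finset.prod_ite_eq', Finset.prod_ite_eq']
        simp
      simp_rw [e2]
      rw [← Finset.prod_univ_sum t (fun g x => (if g = h then X h x else 1) *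
        (if g = h' then X h' x else 1))]
      refine Finset.prod_eq_zero (Finset.mem_univ h) ?_
      simp only [if_true, if_neg hne.symm, mul_one]
      exact h0 h
    · simp
  refine (Finset.sum_le_sum key).trans (le_of_eq ?_)
  simp
  ring

/-- exponents of the given multidegree -/
def bx {m : ℕ} (ι : Type) [Fintype ι] [DecidableEq ι] (r : Fin m → ℕ) : Finset (Fin m → ι → ℕ) :=
  Fintype.piFinset fun h => Finset.piAntidiag Finset.univ (r h)

lemma mem_bx {m : ℕ} (r : Fin m → ℕ) (b : Fin m → ι → ℕ) : b ∈ bx ι r ↔ ∀ h, ∑ s, b h s = r h := by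
  simp [bx, Fintype.mem_piFinset, Finset.mem_piAntidiag]

/-- the linear functional of exponents -/
noncomputable def slope {m : ℕ} (r : Fin m → ℕ) (c : Fin m → ι → ℝ) (b : Fin m → ι → ℕ) : ℝ :=
  ∑ h, (∑ s, c h s * (b h s : ℝ)) / r h

lemma abs_inner_le (r : ℕ) (c : ι → ℝ) (B : ℝ) (hcB : ∀ s, |c s| ≤ B) (b : ι → ℕ)
    (hb : ∑ s, b s = r) : |∑ s, c s * (b s : ℝ)| ≤ B * r := by
  rw [← hb]
  push_cast
  rw [Finset.mul_sum]
  refine (Finset.abs_sum_le_sum_abs _ _).trans (Finset.sum_le_sum fun s _ => ?_)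
  rw [abs_mul, Nat.abs_cast]
  exact mul_le_mul_of_nonneg_right (hcB s) (Nat.cast_nonneg _)

lemma cheb {m : ℕ} (r : Fin m → ℕ) (hr : ∀ h, 1 ≤ r h) (c : Fin m → ι → ℝ)
    (hc : ∀ h, ∑ s, c h s = 0) (B : ℝ) (hcB : ∀ h s, |c h s| ≤ B) (θ : ℝ) (hθ : 0 < θ) :
    (((bx ι r).filter fun b => θ * m ≤ slope r c b).card : ℝ) * (θ * m) ^ 2 ≤
      (bx ι r).card * (m * B ^ 2) := by
  have h1 := sum_piFinset_sq (fun h => Finset.piAntidiag (Finset.univ : Finset ι) (r h))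
    (fun h b => (∑ s, c h s * (b s : ℝ)) / r h) B (by
      intro h
      rw [← Finset.sum_div, sum_piAntidiag_zero _ _ (hc h), zero_div]) (by
      intro h b hb
      have hr' : (0 : ℝ) < r h := by exact_mod_cast hr h
      rw [abs_div, Nat.abs_cast, div_le_iff₀ hr']
      refine abs_inner_le _ _ _ (hcB h) _ ?_
      simpa using hb)
  refine le_trans ?_ h1
  rw [← nsmul_eq_mul]
  refine le_trans (Finset.card_nsmul_le_sum _ (fun b => (slope r c b) ^ 2) _ ?_) ?_
  · intro b hb
    have := (Finset.mem_filter.1 hb).2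
    exact pow_le_pow_left₀ (by positivity) this 2
  · exact Finset.sum_le_sum_of_subset_of_nonneg (Finset.filter_subset _ _)
      fun _ _ _ => sq_nonneg _

lemma card_bx_le {m : ℕ} (r : Fin m → ℕ) :
    ((bx ι r).card : ℝ) ≤ (2 ^ Fintype.card ι : ℝ) ^ (∑ h, r h) := by
  rw [bx, Fintype.card_piFinset, Nat.cast_prod, ← Finset.prod_pow_eq_pow_sum]
  refine Finset.prod_le_prod (fun _ _ => Nat.cast_nonneg _) fun h _ => ?_
  have h1 : (Finset.piAntidiag (Finset.univ : Finset ι) (r h)) ⊆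
      Fintype.piFinset fun _ : ι => Finset.range (r h + 1) := by
    intro b hb
    rw [Fintype.mem_piFinset]
    intro s
    have hs : ∑ s, b s = r h := by simpa using hb
    rw [Finset.mem_range, ← hs]
    have := Finset.single_le_sum (f := b) (fun _ _ => Nat.zero_le _) (Finset.mem_univ s)
    omega
  have h2 := Finset.card_le_card h1
  rw [Fintype.card_piFinset] at h2
  simp only [Finset.card_range, Finset.prod_const, Finset.card_univ] at h2
  have h3 : r h + 1 ≤ 2 ^ r h := Nat.lt_two_pow_self
  have h4 : (r h + 1) ^ Fintype.card ι ≤ (2 ^ Fintype.card ι) ^ r h := by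
    rw [← pow_mul, mul_comm, pow_mul]
    exact Nat.pow_le_pow_left h3 _
  exact_mod_cast h2.trans h4

lemma bx_nonempty [Nonempty ι] {m : ℕ} (r : Fin m → ℕ) : (bx ι r).Nonempty := by
  obtain ⟨s0⟩ := ‹Nonempty ι›
  refine ⟨fun h => Pi.single s0 (r h), ?_⟩
  rw [mem_bx]
  intro h
  simp

end cheb

attribute [local instance] Matrix.seminormedAddCommGroup Matrix.normedAddCommGroup in
lemma siegel {α β : Type} [Fintype α] [Fintype β] [Nonempty β] (A : Matrix α β ℤ)
    (h : 2 * Fintype.card α ≤ Fintype.card β) (K : ℝ) (hK : 1 ≤ K)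
    (hA : ∀ i j, |(A i j : ℝ)| ≤ K) :
    ∃ t : β → ℤ, t ≠ 0 ∧ A.mulVec t = 0 ∧ ∀ j, |(t j : ℝ)| ≤ Fintype.card β * K := by
  classical
  have hb : 0 < Fintype.card β := Fintype.card_pos
  have hb1 : (1 : ℝ) ≤ Fintype.card β := by exact_mod_cast hb
  rcases Nat.eq_zero_or_pos (Fintype.card α) with h0 | h0
  · haveI := Fintype.card_eq_zero_iff.1 h0
    refine ⟨fun _ => 1, ?_, Subsingleton.elim _ _, fun j => ?_⟩
    · intro h
      exact one_ne_zero (congrFun h (Classical.arbitrary β))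
    · simp only [Int.cast_one, abs_one]
      nlinarith
  · obtain ⟨t, ht0, htA, htn⟩ := Int.Matrix.exists_ne_zero_int_vec_norm_le A (by omega) h0
    refine ⟨t, ht0, htA, fun j => ?_⟩
    have hAK : ‖A‖ ≤ K := by
      rw [Matrix.norm_le_iff (by linarith)]
      intro i j
      rw [Int.norm_eq_abs]
      exact hA i j
    have h1 : |(t j : ℝ)| ≤ ‖t‖ := by
      have := norm_le_pi_norm t j
      rwa [Int.norm_eq_abs] at this
    refine h1.trans (htn.trans ?_)
    set n : ℝ := (Fintype.card β : ℝ)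
    set m : ℝ := (Fintype.card α : ℝ)
    have hm : 2 * m ≤ n := by simp only [m, n]; exact_mod_cast h
    have hmp : 0 < m := by simp only [m]; exact_mod_cast h0
    have hbase : 1 ≤ n * max 1 ‖A‖ := one_le_mul_of_one_le_of_one_le hb1 (le_max_left _ _)
    have hexp : m / (n - m) ≤ 1 := by
      rw [div_le_one (by linarith)]
      linarith
    refine (Real.rpow_le_rpow_of_exponent_le hbase hexp).trans ?_
    rw [Real.rpow_one]
    exact mul_le_mul_of_nonneg_left (max_le hK hAK) (by linarith)

end Sch


namespace Sch
open MvPolynomial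

section lsub
variable {A A' : Type*} [CommRing A] [CommRing A'] {m : ℕ} {ι : Type} [Fintype ι] [DecidableEq ι]

/-- linear substitution -/
noncomputable def lsub (B : Fin m → Matrix ι ι A) :
    MvPolynomial (Fin m × ι) A →ₐ[A] MvPolynomial (Fin m × ι) A :=
  aeval fun p => ∑ t, C (B p.1 p.2 t) * X (p.1, t)

lemma lsub_X (B : Fin m → Matrix ι ι A) (p : Fin m × ι) :
    lsub B (X p) = ∑ t, C (B p.1 p.2 t) * X (p.1, t) := by simp [lsub]

lemma lsub_lsub (B B' : Fin m → Matrix ι ι A) (f : MvPolynomial (Fin m × ι) A) :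
    lsub B' (lsub B f) = lsub (fun h => B h * B' h) f := by
  have : (lsub B').comp (lsub B) = lsub (fun h => B h * B' h) := by
    apply MvPolynomial.algHom_ext
    intro p
    rw [AlgHom.comp_apply, lsub_X, lsub_X, map_sum]
    simp_rw [map_mul, lsub_X, algHom_C, Finset.mul_sum]
    rw [Finset.sum_comm]
    refine Finset.sum_congr rfl fun t _ => ?_
    rw [Matrix.mul_apply, map_sum, Finset.sum_mul]
    refine Finset.sum_congr rfl fun u _ => ?_
    rw [C_mul, MvPolynomial.algebraMap_eq]
    ring
  rw [← this]
  rfl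

lemma lsub_one (f : MvPolynomial (Fin m × ι) A) : lsub (fun _ => 1) f = f := by
  have : lsub (fun _ : Fin m => (1 : Matrix ι ι A)) = AlgHom.id A _ := by
    apply MvPolynomial.algHom_ext
    intro p
    rw [lsub_X, Finset.sum_eq_single p.2]
    · simp
    · intro b _ hb
      rw [Matrix.one_apply_ne hb.symm]
      simp
    · simp
  rw [this]
  rfl

lemma map_lsub (φ : A →+* A') (B : Fin m → Matrix ι ι A) (f : MvPolynomial (Fin m × ι) A) :
    map φ (lsub B f) = lsub (fun h => (B h).map φ) (map φ f) := by
  induction f using MvPolynomial.induction_on with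
  | C a => simp [lsub]
  | add p q hp hq => simp only [map_add, hp, hq]
  | mul_X p n hp =>
    rw [map_mul, map_mul, map_mul, map_mul, hp, lsub_X, map_X, lsub_X, map_sum]
    simp

/-- multidegree weights -/
def mhw (m : ℕ) (ι : Type) : Fin m × ι → (Fin m → ℕ) := fun p => Pi.single p.1 1

lemma weight_mhw (b : Fin m × ι →₀ ℕ) (h : Fin m) :
    Finsupp.weight (mhw m ι) b h = ∑ s, b (h, s) := by
  rw [Finsupp.weight_apply, Finsupp.sum_fintype _ _ (by simp), Fintype.sum_prod_type,
    Finset.sum_apply, Finset.sum_eq_single h]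
  · simp [mhw]
  · intro h' _ hne
    simp [mhw, Finset.sum_apply, Pi.single_apply, hne.symm]
  · simp

lemma mh_coeff {r : Fin m → ℕ} {f : MvPolynomial (Fin m × ι) A}
    (hf : IsWeightedHomogeneous (mhw m ι) f r) {b : Fin m × ι →₀ ℕ} (hb : f.coeff b ≠ 0)
    (h : Fin m) : ∑ s, b (h, s) = r h := by
  rw [← weight_mhw, hf hb]

lemma mh_of {r : Fin m → ℕ} {f : MvPolynomial (Fin m × ι) A}
    (hf : ∀ b, f.coeff b ≠ 0 → ∀ h, ∑ s, b (h, s) = r h) :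
    IsWeightedHomogeneous (mhw m ι) f r := by
  intro b hb
  ext h
  rw [weight_mhw, hf b hb]

lemma mh_map (φ : A →+* A') {r : Fin m → ℕ} {f : MvPolynomial (Fin m × ι) A}
    (hf : IsWeightedHomogeneous (mhw m ι) f r) :
    IsWeightedHomogeneous (mhw m ι) (map φ f) r := by
  intro b hb
  refine hf fun h0 => hb ?_
  rw [coeff_map, h0, map_zero]

lemma mh_lsub (B : Fin m → Matrix ι ι A) {r : Fin m → ℕ} {f : MvPolynomial (Fin m × ι) A}
    (hf : IsWeightedHomogeneous (mhw m ι) f r) :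
    IsWeightedHomogeneous (mhw m ι) (lsub B f) r := by
  classical
  have h1 : lsub B f = ∑ b ∈ f.support, lsub B (monomial b (f.coeff b)) := by
    conv_lhs => rw [f.as_sum]
    rw [map_sum]
  rw [h1]
  refine IsWeightedHomogeneous.sum _ _ _ fun b hb => ?_
  rw [← hf (mem_support_iff.1 hb), lsub, aeval_monomial, Finsupp.prod_fintype _ _ (by simp),
    MvPolynomial.algebraMap_eq, Finsupp.weight_apply, Finsupp.sum_fintype _ _ (by simp)]
  rw [← zero_add (∑ i, b i • mhw m ι i)]
  refine (isWeightedHomogeneous_C _ _).mul (IsWeightedHomogeneous.prod _ _ _ fun p _ => ?_)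
  refine IsWeightedHomogeneous.pow (IsWeightedHomogeneous.sum _ _ _ fun t _ => ?_) _
  rw [← zero_add (mhw m ι p)]
  exact (isWeightedHomogeneous_C _ _).mul (isWeightedHomogeneous_X _ _ (p.1, t))

lemma mw_const (K : ℝ) (b : Fin m × ι →₀ ℕ) (r : Fin m → ℕ) (hb : ∀ h, ∑ s, b (h, s) = r h) :
    mw (fun _ => K) b = K ^ (∑ h, r h) := by
  rw [mw, Finsupp.prod_fintype _ _ (by simp), Finset.prod_pow_eq_pow_sum, Fintype.sum_prod_type]
  congr 1
  exact Finset.sum_congr rfl fun h _ => hb h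

lemma wnorm_const (N : RingSeminorm A) (K : ℝ) {r : Fin m → ℕ} {f : MvPolynomial (Fin m × ι) A}
    (hf : IsWeightedHomogeneous (mhw m ι) f r) :
    wnorm N (fun _ => K) f = l1 _ N f * K ^ (∑ h, r h) := by
  rw [l1_apply, wnorm, wnorm, Finset.sum_mul]
  refine Finset.sum_congr rfl fun b hb => ?_
  have := mh_coeff hf (mem_support_iff.1 hb)
  rw [mw_const K b r this, mw_const 1 b r this, one_pow, mul_one]

lemma l1_lsub_le (N : RingSeminorm A) (h1 : N 1 ≤ 1) (B : Fin m → Matrix ι ι A) (K : ℝ)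
    (hK : ∀ h s, ∑ t, N (B h s t) ≤ K) {r : Fin m → ℕ} {f : MvPolynomial (Fin m × ι) A}
    (hf : IsWeightedHomogeneous (mhw m ι) f r) :
    l1 _ N (lsub B f) ≤ l1 _ N f * K ^ (∑ h, r h) := by
  rw [← wnorm_const N K hf, l1_apply]
  refine wnorm_eval₂_le N N (fun _ => zero_le_one) h1 _ _ ?_ ?_ f
  · intro c
    rw [MvPolynomial.algebraMap_eq, wnorm_C]
  · intro p
    refine (wnorm_sum_le N (fun _ => zero_le_one) _ _).trans (le_trans ?_ (hK p.1 p.2))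
    refine Finset.sum_le_sum fun t _ => ?_
    refine (wnorm_mul_le N (fun _ => zero_le_one) _ _).trans ?_
    rw [wnorm_C]
    exact mul_le_of_le_one_right (apply_nonneg N _) (wnorm_X_le N (fun _ => zero_le_one) h1 _)

/-- exponent as a finitely supported function -/
noncomputable def fx (b : Fin m → ι → ℕ) : Fin m × ι →₀ ℕ := Finsupp.equivFunOnFinite.symm fun p => b p.1 p.2

lemma fx_apply (b : Fin m → ι → ℕ) (p : Fin m × ι) : fx b p = b p.1 p.2 := rfl

lemma fx_inj : Function.Injective (fx : (Fin m → ι → ℕ) → _) := by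
  intro b b' h
  ext i s
  have := DFunLike.congr_fun h (i, s)
  exact this

end lsub

/-- the auxiliary polynomial -/
theorem aux_poly {R : Type} [CommRing R] [IsDomain R] {D : ℕ} (b : Module.Basis (Fin D) ℤ R)
    {ι : Type} [Fintype ι] [DecidableEq ι] [Nonempty ι] (M : Matrix ι ι R) (B θ : ℝ)
    (hθ : 0 < θ) : ∃ m : ℕ, 1 ≤ m ∧ ∃ K : ℝ, 1 ≤ K ∧ ∀ r : Fin m → ℕ, (∀ h, 1 ≤ r h) →
      ∀ c : Fin m → ι → ℝ, (∀ h, ∑ s, c h s = 0) → (∀ h s, |c h s| ≤ B) →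
      ∃ P : MvPolynomial (Fin m × ι) ℤ, P ≠ 0 ∧ IsWeightedHomogeneous (mhw m ι) P r ∧
        l1 _ absZ P ≤ K ^ (∑ h, r h) ∧
        ∀ a : Fin m × ι →₀ ℕ, θ * m ≤ slope r c (fun h s => a (h, s)) →
          (lsub (fun _ => M) (map (Int.castRingHom R) P)).coeff a = 0 := by
  classical
  obtain ⟨m, hm⟩ := exists_nat_ge (2 * D * B ^ 2 / θ ^ 2 + 1)
  have hm1 : (1 : ℝ) ≤ m := by
    have : 0 ≤ 2 * D * B ^ 2 / θ ^ 2 := by positivity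
    linarith
  have hm2 : 2 * D * B ^ 2 ≤ m * θ ^ 2 := by
    rw [← div_le_iff₀ (by positivity)]
    linarith
  obtain ⟨C0, hC01, hC0⟩ := sz_coord b
  set K0 : ℝ := 1 + ∑ s, ∑ t, sz b (M s t) with hK0
  have hsum : ∀ s, 0 ≤ ∑ t, sz b (M s t) := fun s => Finset.sum_nonneg fun t _ => apply_nonneg _ _
  have hK01 : 1 ≤ K0 := by
    have : 0 ≤ ∑ s, ∑ t, sz b (M s t) := Finset.sum_nonneg fun s _ => hsum s
    linarith
  have hrow : ∀ s, ∑ t, sz b (M s t) ≤ K0 := by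
    intro s
    have := Finset.single_le_sum (f := fun s => ∑ t, sz b (M s t)) (fun s _ => hsum s)
      (Finset.mem_univ s)
    linarith
  set E : ℝ := 2 ^ Fintype.card ι with hE
  have hE1 : 1 ≤ E := one_le_pow₀ (by norm_num)
  refine ⟨m, by exact_mod_cast hm1, E * (E * (C0 * K0)), ?_, ?_⟩
  · exact one_le_mul_of_one_le_of_one_le hE1 (one_le_mul_of_one_le_of_one_le hE1
      (one_le_mul_of_one_le_of_one_le hC01 hK01))
  intro r hr c hc hcB
  have hsr : 1 ≤ ∑ h, r h := by
    have h0 : 0 < m := by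
      have : (0 : ℝ) < m := by linarith
      exact_mod_cast this
    exact (hr ⟨0, h0⟩).trans (Finset.single_le_sum (f := r) (fun _ _ => Nat.zero_le _)
      (Finset.mem_univ _))
  let bad := (bx ι r).filter fun b => θ * m ≤ slope r c b
  let β := {x // x ∈ bx ι r}
  let α := {x // x ∈ bad} × Fin D
  obtain ⟨x0, hx0⟩ := bx_nonempty (ι := ι) r
  haveI : Nonempty β := ⟨⟨x0, hx0⟩⟩
  have hcardβ : Fintype.card β = (bx ι r).card := Fintype.card_coe _
  have hcard : 2 * Fintype.card α ≤ Fintype.card β := by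
    have h1 := cheb r hr c hc B hcB θ hθ
    rw [Fintype.card_prod, Fintype.card_coe, Fintype.card_fin, hcardβ]
    have h2 : (2 * (bad.card * D) : ℝ) ≤ (bx ι r).card := by
      have h3 : (bad.card : ℝ) * (θ * m) ^ 2 ≤ (bx ι r).card * (m * B ^ 2) := h1
      have h4 : (0 : ℝ) < m * m * θ ^ 2 := by positivity
      have h5 : (2 * (bad.card * D) : ℝ) * (m * m * θ ^ 2) ≤ (bx ι r).card * (m * m * θ ^ 2) := by
        calc (2 * (bad.card * D) : ℝ) * (m * m * θ ^ 2)
            = 2 * D * (bad.card * (θ * m) ^ 2) := by ring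
          _ ≤ 2 * D * ((bx ι r).card * (m * B ^ 2)) := by gcongr
          _ = (bx ι r).card * m * (2 * D * B ^ 2) := by ring
          _ ≤ (bx ι r).card * m * (m * θ ^ 2) := by gcongr
          _ = _ := by ring
      exact le_of_mul_le_mul_right h5 h4
    exact_mod_cast h2
  let mon : β → MvPolynomial (Fin m × ι) R := fun y => lsub (fun _ => M) (monomial (fx y.1) 1)
  let Am : Matrix α β ℤ := Matrix.of fun x y => b.repr ((mon y).coeff (fx x.1.1)) x.2
  have hmh : ∀ y : β, ∀ z : R, IsWeightedHomogeneous (mhw m ι) (monomial (fx y.1) z) r := by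
    intro y z
    refine mh_of fun a ha h => ?_
    rw [coeff_monomial] at ha
    have : fx y.1 = a := by
      by_contra hne
      rw [if_neg hne] at ha
      exact ha rfl
    rw [← this]
    exact (mem_bx r y.1).1 y.2 h
  have hl1 : ∀ y : β, l1 _ (sz b) (mon y) ≤ K0 ^ (∑ h, r h) := by
    intro y
    refine (l1_lsub_le (sz b) (sz_one b) _ K0 (fun _ s => hrow s) (hmh y 1)).trans ?_
    rw [l1_apply, wnorm_monomial, mw_one, mul_one]
    exact mul_le_of_le_one_left (by positivity) (sz_one b)
  have hAm : ∀ i j, |(Am i j : ℝ)| ≤ (C0 * K0) ^ (∑ h, r h) := by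
    intro i j
    refine (hC0 _ _).trans ?_
    rw [mul_pow]
    refine mul_le_mul (le_self_pow₀ hC01 (by omega)) ?_ (apply_nonneg _ _) (by positivity)
    exact (coeff_le_l1 (sz b) _ _).trans (hl1 j)
  obtain ⟨t, ht0, htA, htb⟩ := siegel Am hcard ((C0 * K0) ^ (∑ h, r h))
    (one_le_pow₀ (one_le_mul_of_one_le_of_one_le hC01 hK01)) hAm
  let P : MvPolynomial (Fin m × ι) ℤ := ∑ y : β, monomial (fx y.1) (t y)
  have hPc : ∀ y : β, P.coeff (fx y.1) = t y := by
    intro y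
    simp only [P, coeff_sum, coeff_monomial]
    rw [Finset.sum_eq_single y]
    · simp
    · intro z _ hz
      rw [if_neg]
      intro h
      exact hz (Subtype.ext (fx_inj h))
    · simp
  have hPmh : IsWeightedHomogeneous (mhw m ι) P r := by
    refine IsWeightedHomogeneous.sum _ _ _ fun y _ => mh_of fun a ha h => ?_
    rw [coeff_monomial] at ha
    have : fx y.1 = a := by
      by_contra hne
      rw [if_neg hne] at ha
      exact ha rfl
    rw [← this]
    exact (mem_bx r y.1).1 y.2 h
  refine ⟨P, ?_, hPmh, ?_, ?_⟩
  · intro h0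
    apply ht0
    ext y
    rw [← hPc y, h0]
    simp
  · refine (wnorm_sum_le absZ (fun _ => zero_le_one) _ _).trans ?_
    have h1 : ∀ y ∈ (Finset.univ : Finset β), wnorm absZ (fun _ => 1) (monomial (fx y.1) (t y))
        ≤ (bx ι r).card * (C0 * K0) ^ (∑ h, r h) := by
      intro y _
      rw [wnorm_monomial, mw_one, mul_one, absZ_apply, ← hcardβ]
      exact htb y
    refine (Finset.sum_le_card_nsmul _ _ _ h1).trans ?_
    rw [nsmul_eq_mul, Finset.card_univ, hcardβ, mul_pow E (E * (C0 * K0)), mul_pow E (C0 * K0)]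
    have h2 : ((bx ι r).card : ℝ) ≤ E ^ (∑ h, r h) := card_bx_le (ι := ι) r
    have h3 : 0 ≤ (C0 * K0) ^ (∑ h, r h) := by positivity
    exact mul_le_mul h2 (mul_le_mul_of_nonneg_right h2 h3) (by positivity) (by positivity)
  · intro a ha
    by_cases hmem : (fun h s => a (h, s)) ∈ bx ι r
    · have hbad : (fun h s => a (h, s)) ∈ bad := Finset.mem_filter.2 ⟨hmem, ha⟩
      have hfa : fx (fun h s => a (h, s)) = a := by
        ext p
        rfl
      have h1 : (lsub (fun _ => M) (map (Int.castRingHom R) P)).coeff a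
          = ∑ y : β, (t y) • (mon y).coeff a := by
        have : map (Int.castRingHom R) P = ∑ y : β, (t y) • monomial (fx y.1) (1 : R) := by
          simp only [P, map_sum, map_monomial]
          refine Finset.sum_congr rfl fun y _ => ?_
          rw [MvPolynomial.smul_monomial]
          simp
        rw [this, map_sum, coeff_sum]
        refine Finset.sum_congr rfl fun y _ => ?_
        rw [map_zsmul, coeff_smul]
      rw [h1]
      apply b.repr.injective
      rw [map_sum, map_zero]
      ext i
      have h2 := congrFun htA (⟨_, hbad⟩, i)
      simp only [Matrix.mulVec, dotProduct, Am, Matrix.of_apply, hfa, Pi.zero_apply] at h2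
      rw [Finsupp.coe_zero, Pi.zero_apply, ← h2, Finsupp.finset_sum_apply]
      refine Finset.sum_congr rfl fun y _ => ?_
      rw [map_zsmul, Finsupp.smul_apply, smul_eq_mul, mul_comm]
    · by_contra hne
      apply hmem
      rw [mem_bx]
      intro h
      exact mh_coeff (mh_lsub _ (mh_map _ hPmh)) hne h

end Sch


namespace Sch
open MvPolynomial

section rothend
variable {m : ℕ} {ι : Type} [Fintype ι] [DecidableEq ι]

/-- one distinguished variable per block -/
noncomputable def spl (j : Fin m → ι) :
    MvPolynomial (Fin m × ι) ℤ →+* MvPolynomial (Fin m) (MvPolynomial (Fin m × ι) ℤ) :=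
  eval₂Hom (Int.castRingHom _) fun p => if p.2 = j p.1 then X p.1 else C (X p)

lemma spl_X (j : Fin m → ι) (p : Fin m × ι) :
    spl j (X p) = if p.2 = j p.1 then X p.1 else C (X p) := by
  simp [spl]

lemma spl_ne_zero (j : Fin m → ι) {P : MvPolynomial (Fin m × ι) ℤ} (hP : P ≠ 0) :
    spl j P ≠ 0 := by
  intro h
  apply hP
  have h1 : ((eval₂Hom (RingHom.id (MvPolynomial (Fin m × ι) ℤ))
      fun h => X (h, j h)).comp (spl j)) = RingHom.id _ := by
    apply MvPolynomial.ringHom_ext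
    · intro r
      simp [spl]
    · rintro ⟨h, s⟩
      rw [RingHom.comp_apply, spl_X]
      by_cases hs : s = j h
      · simp [hs]
      · simp [hs]
  have h2 := congrArg (fun f => f P) h1
  simp only [RingHom.comp_apply, h, map_zero, RingHom.id_apply] at h2
  exact h2.symm

lemma l1_spl (j : Fin m → ι) (P : MvPolynomial (Fin m × ι) ℤ) :
    l1 _ (l1 _ absZ) (spl j P) ≤ l1 _ absZ P := by
  rw [l1_apply (N := absZ), l1_apply]
  have h1 : (l1 (Fin m × ι) absZ) 1 ≤ 1 := l1_one_le absZ (by simp [absZ_apply])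
  refine wnorm_eval₂_le absZ (l1 _ absZ) (fun _ => zero_le_one) h1 _ _ ?_ ?_ P
  · intro c
    have : (Int.castRingHom (MvPolynomial (Fin m) (MvPolynomial (Fin m × ι) ℤ))) c
        = C (C c) := by simp
    rw [this, wnorm_C, l1_apply, wnorm_C]
  · intro p
    split_ifs
    · exact wnorm_X_le _ (fun _ => zero_le_one) h1 _
    · rw [wnorm_C, l1_apply]
      exact wnorm_X_le _ (fun _ => zero_le_one) (by simp [absZ_apply]) _

lemma spl_deg (j : Fin m → ι) {P : MvPolynomial (Fin m × ι) ℤ} {r : Fin m → ℕ}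
    (hP : IsWeightedHomogeneous (mhw m ι) P r) (b : Fin m →₀ ℕ) (hb : (spl j P).coeff b ≠ 0)
    (h : Fin m) : b h ≤ r h := by
  classical
  refine (monomial_le_degreeOf h (mem_support_iff.2 hb)).trans ?_
  rw [spl, coe_eval₂Hom, eval₂_eq]
  refine (degreeOf_sum_le _ _ _).trans (Finset.sup_le fun a ha => ?_)
  refine (degreeOf_mul_le _ _ _).trans ?_
  have h0 : degreeOf h ((Int.castRingHom (MvPolynomial (Fin m) (MvPolynomial (Fin m × ι) ℤ)))
      (P.coeff a)) = 0 := by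
    have : (Int.castRingHom (MvPolynomial (Fin m) (MvPolynomial (Fin m × ι) ℤ)))
      (P.coeff a) = C (C (P.coeff a)) := by simp
    rw [this, degreeOf_C]
  rw [h0, zero_add]
  refine (degreeOf_prod_le _ _ _).trans ?_
  have h1 : ∀ p ∈ a.support, degreeOf h ((if p.2 = j p.1 then X p.1 else C (X p) :
      MvPolynomial (Fin m) (MvPolynomial (Fin m × ι) ℤ)) ^ a p) ≤
      if p.1 = h then a p else 0 := by
    intro p _
    refine (degreeOf_pow_le _ _ _).trans ?_
    by_cases h2 : p.2 = j p.1
    · rw [if_pos h2, degreeOf_X]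
      by_cases h3 : p.1 = h
      · simp [h3]
      · simp [h3, Ne.symm h3]
    · rw [if_neg h2, degreeOf_C]
      simp
  refine (Finset.sum_le_sum h1).trans ?_
  rw [← mh_coeff hP (mem_support_iff.1 ha) h]
  refine (Finset.sum_le_sum_of_subset (Finset.subset_univ _)).trans ?_
  rw [Fintype.sum_prod_type, Finset.sum_eq_single h]
  · simp
  · intro h' _ hne
    simp [hne]
  · simp

end rothend

abbrev PZ (m : ℕ) (ι : Type) := MvPolynomial (Fin m × ι) ℤ

abbrev KZ (m : ℕ) (ι : Type) := FractionRing (PZ m ι)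

theorem roth_end (m : ℕ) (ι : Type) [Fintype ι] [DecidableEq ι] (t : ℝ) (ht : 0 < t)
    (ht1 : t ≤ 1) : ∃ ω : ℝ, 0 < ω ∧ ∀ (P : MvPolynomial (Fin m × ι) ℤ) (r : Fin m → ℕ)
      (Z Z' : Fin m → Matrix ι ι ℤ) (T j : Fin m → ι) (S B : ℝ), P ≠ 0 →
      IsWeightedHomogeneous (mhw m ι) P r → (∀ h, 1 ≤ r h) →
      (∀ h h', h < h' → (r h : ℝ) ≤ ω * r h') → 0 < S → 0 ≤ B →
      (∀ h, Z h * Z' h = 1) → (∀ h, Z' h (T h) (j h) ≠ 0) →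
      (∀ h, S ≤ r h * Real.log |(Z' h (T h) (j h) : ℝ)|) →
      l1 _ absZ P ≤ Real.exp B → B + ∑ h, (r h : ℝ) ≤ ω * S →
      ∃ b, (lsub Z P).coeff b ≠ 0 ∧ ∑ h, (b (h, T h) : ℝ) / r h < t := by
  classical
  obtain ⟨ω, hω, H⟩ := roth (A := MvPolynomial (Fin m × ι) ℤ)
    (K := FractionRing (MvPolynomial (Fin m × ι) ℤ)) (l1 _ absZ)
    (l1_one_le absZ (by simp [absZ_apply])) m t ht ht1
  refine ⟨ω, hω, ?_⟩
  intro P r Z Z' T j S B hP hPh hr hord hS hB hZ hv hSr hl1 hBS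
  have hZ' : ∀ h, Z' h * Z h = 1 := fun h => mul_eq_one_comm.1 (hZ h)
  let L : Fin m → (PZ m ι) := fun h => ∑ s ∈ Finset.univ.erase (j h), C (Z' h (T h) s) * X (h, s)
  let ξ : Fin m → KZ m ι := fun h => -(algebraMap (PZ m ι) (KZ m ι) (L h)) / algebraMap (PZ m ι) (KZ m ι) (C (Z' h (T h) (j h)))
  have hstar : ∀ h, Star (A := PZ m ι) (K := KZ m ι) (l1 _ absZ) (ξ h) |(Z' h (T h) (j h) : ℝ)| := by
    intro h
    refine star_linear (L h) _ (hv h) ?_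
    intro a ha haL
    have hdvd : ∀ s, a ∣ Z' h (T h) s := by
      intro s
      by_cases hs : s = j h
      · rw [hs]; exact ha
      · have h1 := (C_dvd_iff_dvd_coeff _ _).1 haL (Finsupp.single (h, s) 1)
        have h2 : (L h).coeff (Finsupp.single (h, s) 1) = Z' h (T h) s := by
          simp only [L, coeff_sum, coeff_C_mul]
          rw [Finset.sum_eq_single s]
          · simp
          · intro s' _ hne
            rw [coeff_X', if_neg]
            · simp
            · intro heq
              have := Finsupp.single_left_injective one_ne_zero heq
              exact hne (by simpa using this)
          · intro hns
            exact absurd (Finset.mem_erase.2 ⟨hs, Finset.mem_univ _⟩) hns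
        rwa [h2] at h1
    have h3 := congrFun (congrFun (hZ' h) (T h)) (T h)
    rw [Matrix.mul_apply, Matrix.one_apply_eq] at h3
    rw [Int.isUnit_iff_natAbs_eq]
    have h4 : a ∣ 1 := by
      rw [← h3]
      exact Finset.dvd_sum fun s _ => Dvd.dvd.mul_right (hdvd s) _
    exact Int.isUnit_iff_natAbs_eq.1 (isUnit_of_dvd_one h4)
  obtain ⟨b', hb', hcb'⟩ := H (spl j P) r ξ (fun h => |(Z' h (T h) (j h) : ℝ)|) S B
    (spl_ne_zero j hP) hr (spl_deg j hPh) hord hS hB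
    (fun h => abs_pos.2 (by exact_mod_cast hv h)) hSr hstar ((l1_spl j P).trans hl1) hBS
  by_contra hcon
  push Not at hcon
  apply hcb'
  let ψ : (PZ m ι) →+* MvPolynomial (Fin m) (KZ m ι) :=
    ((trans ξ : MvPolynomial (Fin m) (KZ m ι) →ₐ[KZ m ι] MvPolynomial (Fin m) (KZ m ι)) :
      MvPolynomial (Fin m) (KZ m ι) →+* MvPolynomial (Fin m) (KZ m ι)).comp
      ((map (algebraMap (PZ m ι) (KZ m ι))).comp (spl j))
  have hψ : trans ξ (map (algebraMap (PZ m ι) (KZ m ι)) (spl j P)) = ψ P := rfl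
  have hψX : ∀ p : Fin m × ι, ψ (X p) = if p.2 = j p.1 then X p.1 + C (ξ p.1)
      else C (algebraMap (PZ m ι) (KZ m ι) (X p)) := by
    intro p
    simp only [ψ, RingHom.comp_apply, spl_X]
    split_ifs <;> simp [trans]
  have hψC : ∀ z : ℤ, ψ (C z) = C (algebraMap (PZ m ι) (KZ m ι) (C z)) := by
    intro z
    simp
  have hP2 : P = lsub Z' (lsub Z P) := by
    rw [lsub_lsub]
    have : (fun h => Z h * Z' h) = fun _ => 1 := funext hZ
    rw [this, lsub_one]
  have hT : ∀ h, ψ (∑ s, C (Z' h (T h) s) * X (h, s))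
      = C (algebraMap (PZ m ι) (KZ m ι) (C (Z' h (T h) (j h)))) * X h := by
    intro h
    rw [← Finset.add_sum_erase _ _ (Finset.mem_univ (j h)), map_add, map_mul, hψC, hψX, if_pos rfl]
    have h1 : ψ (∑ s ∈ Finset.univ.erase (j h), C (Z' h (T h) s) * X (h, s))
        = C (algebraMap (PZ m ι) (KZ m ι) (L h)) := by
      simp only [L, map_sum, map_mul, hψC]
      refine Finset.sum_congr rfl fun s hs => ?_
      rw [hψX, if_neg (Finset.ne_of_mem_erase hs)]
    rw [h1, mul_add, ← C_mul, add_assoc, ← C_add]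
    have h2 : algebraMap (PZ m ι) (KZ m ι) (C (Z' h (T h) (j h))) ≠ 0 := by
      rw [Ne, FaithfulSMul.algebraMap_eq_zero_iff, C_eq_zero]
      exact hv h
    have h3 : algebraMap (PZ m ι) (KZ m ι) (C (Z' h (T h) (j h))) * ξ h + algebraMap (PZ m ι) (KZ m ι) (L h) = 0 := by
      simp only [ξ]
      field_simp
      ring
    rw [h3, C_0, add_zero]
  rw [hψ, hP2, (lsub Z P).as_sum, map_sum, map_sum, coeff_sum]
  refine Finset.sum_eq_zero fun b hb => ?_
  have hbt := hcon b (mem_support_iff.1 hb)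
  rw [lsub, aeval_monomial, Finsupp.prod_fintype _ _ (by simp), map_mul, map_prod,
    Fintype.prod_prod_type]
  have hfac : ∀ h, ∏ s, ψ ((∑ t, C (Z' h s t) * X (h, t)) ^ b (h, s))
      = X h ^ b (h, T h) * (C (algebraMap (PZ m ι) (KZ m ι) (C (Z' h (T h) (j h)))) ^ b (h, T h) *
        ∏ s ∈ Finset.univ.erase (T h), ψ ((∑ t, C (Z' h s t) * X (h, t)) ^ b (h, s))) := by
    intro h
    rw [← Finset.mul_prod_erase _ _ (Finset.mem_univ (T h)), map_pow, hT, mul_pow]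
    ring
  simp only [hfac]
  rw [Finset.prod_mul_distrib]
  have hmon : (∏ h, (X h : MvPolynomial (Fin m) (KZ m ι)) ^ b (h, T h))
      = monomial (Finsupp.equivFunOnFinite.symm fun h => b (h, T h)) 1 := by
    rw [monomial_eq, Finsupp.prod_fintype _ _ (by simp)]
    simp
  rw [hmon, mul_left_comm, coeff_monomial_mul', if_neg]
  intro hle
  have : ∑ h, (b (h, T h) : ℝ) / r h ≤ ∑ h, (b' h : ℝ) / r h := by
    refine Finset.sum_le_sum fun h _ => ?_
    have := hle h
    have h2 : (b (h, T h) : ℝ) ≤ b' h := by exact_mod_cast this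
    gcongr
  linarith

end Sch


namespace Sch
open MvPolynomial

lemma chain (Pr : ℝ → Prop) (hPr : ∀ l0 : ℝ, ∃ l ≥ l0, Pr l) (ω L0 : ℝ) (hω : 0 < ω)
    (hL0 : 0 < L0) (m : ℕ) : ∃ l : Fin m → ℝ, (∀ h, Pr (l h)) ∧ (∀ h, L0 ≤ l h) ∧
      ∀ h h', h < h' → l h' ≤ ω * l h := by
  induction m with
  | zero => exact ⟨fun _ => 0, fun h => h.elim0, fun h => h.elim0, fun h => h.elim0⟩
  | succ m ih =>
    obtain ⟨l, h1, h2, h3⟩ := ih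
    obtain ⟨l', hl', hp'⟩ := hPr (L0 + (∑ h, l h) / ω)
    have hpos : ∀ h, 0 ≤ l h := fun h => hL0.le.trans (h2 h)
    have hs : 0 ≤ ∑ h, l h := Finset.sum_nonneg fun h _ => hpos h
    refine ⟨Fin.cons l' l, ?_, ?_, ?_⟩
    · intro h
      refine Fin.cases ?_ (fun i => ?_) h
      · simpa using hp'
      · simpa using h1 i
    · intro h
      refine Fin.cases ?_ (fun i => ?_) h
      · have : 0 ≤ (∑ h, l h) / ω := by positivity
        simp only [Fin.cons_zero]
        linarith
      · simpa using h2 i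
    · intro h h'
      refine Fin.cases ?_ (fun i' => ?_) h'
      · intro hh
        exact absurd hh (Fin.not_lt_zero _)
      · refine Fin.cases ?_ (fun i => ?_) h
        · intro _
          simp only [Fin.cons_zero, Fin.cons_succ]
          have h4 : l i' ≤ ∑ h, l h :=
            Finset.single_le_sum (f := l) (fun h _ => hpos h) (Finset.mem_univ i')
          have h5 : (∑ h, l h) / ω ≤ l' := by linarith
          rw [div_le_iff₀ hω] at h5
          linarith
        · intro hh
          simp only [Fin.cons_succ]
          exact h3 i i' (by simpa using hh)

section
variable {m : ℕ} {ι : Type} [Fintype ι] [DecidableEq ι]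

lemma mw_exp {σ : Type*} [Fintype σ] (y : σ → ℝ) (b : σ →₀ ℕ) :
    mw (fun p => Real.exp (y p)) b = Real.exp (∑ p, y p * b p) := by
  rw [mw, Finsupp.prod_fintype _ _ (by simp), Real.exp_sum]
  refine Finset.prod_congr rfl fun p _ => ?_
  rw [← Real.exp_nat_mul, mul_comm]

lemma lsub_smul_one {A : Type*} [CommRing A] (c : A) {r : Fin m → ℕ}
    {f : MvPolynomial (Fin m × ι) A} (hf : IsWeightedHomogeneous (mhw m ι) f r) :
    lsub (fun _ => c • (1 : Matrix ι ι A)) f = C (c ^ (∑ h, r h)) * f := by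
  have hX : ∀ p : Fin m × ι, (∑ t, C ((c • (1 : Matrix ι ι A)) p.2 t) * X (p.1, t) :
      MvPolynomial (Fin m × ι) A) = C c * X p := by
    intro p
    rw [Finset.sum_eq_single p.2]
    · simp
    · intro b _ hb
      rw [Matrix.smul_apply, Matrix.one_apply_ne hb.symm]
      simp
    · simp
  conv_lhs => rw [f.as_sum]
  conv_rhs => rw [f.as_sum]
  rw [map_sum, Finset.mul_sum]
  refine Finset.sum_congr rfl fun b hb => ?_
  have hb' := mh_coeff hf (mem_support_iff.1 hb)
  rw [lsub, aeval_monomial, C_mul_monomial]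
  simp only [hX]
  rw [Finsupp.prod_fintype _ _ (by simp)]
  simp only [mul_pow]
  rw [Finset.prod_mul_distrib, Finset.prod_pow_eq_pow_sum, Fintype.sum_prod_type]
  simp only [hb']
  rw [monomial_eq, Finsupp.prod_fintype _ _ (by simp), MvPolynomial.algebraMap_eq, C_mul, C_pow]
  ring

lemma l1_map_le {σ : Type*} (P : MvPolynomial σ ℤ) :
    l1 σ absR (map (Int.castRingHom ℝ) P) ≤ l1 σ absZ P := by
  have hm : map (Int.castRingHom ℝ) P = eval₂ (C.comp (Int.castRingHom ℝ)) X P := by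
    induction P using MvPolynomial.induction_on with
    | C a => rw [map_C, eval₂_C, RingHom.comp_apply]
    | add p q hp hq => rw [map_add, hp, hq, eval₂_add]
    | mul_X p n hp => rw [map_mul, hp, eval₂_mul, map_X, eval₂_X]
  rw [l1_apply, l1_apply, hm]
  refine wnorm_eval₂_le (w := fun _ => 1) absZ absR (fun _ => zero_le_one) (by simp [absR_apply])
    ((C : ℝ →+* MvPolynomial σ ℝ).comp (Int.castRingHom ℝ)) X ?_ ?_ P
  · intro c
    rw [RingHom.comp_apply]
    rw [wnorm_C]
    simp [absR_apply, absZ_apply]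
  · intro i
    exact wnorm_X_le _ (fun _ => zero_le_one) (by simp [absR_apply]) _

lemma small_coeff {R : Type} [CommRing R] (φ : R →+* ℝ) [Nonempty ι]
    (M : Matrix ι ι ℝ) (M' : Matrix ι ι R) (N : ℤ) (hN : N ≠ 0)
    (hM : M'.map φ * M = (N : ℝ) • 1) (K1 : ℝ) (hK1 : 1 ≤ K1) (hM' : ∀ s, ∑ t, |φ (M' s t)| ≤ K1)
    (K : ℝ) (hK : 1 ≤ K) (η B θ ε1 τ : ℝ) (hη : 0 < η) (hB : 0 < B)
    (hτ : 0 < τ) (P : MvPolynomial (Fin m × ι) ℤ)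
    (r : Fin m → ℕ) (hr : ∀ h, 1 ≤ r h) (l : Fin m → ℝ)
    (hl1 : ∀ h, τ ≤ r h * l h) (hl2 : ∀ h, r h * l h ≤ (1 + ε1) * τ)
    (hPh : IsWeightedHomogeneous (mhw m ι) P r) (hPK : l1 _ absZ P ≤ K ^ (∑ h, r h))
    (c : Fin m → ι → ℝ) (hcB : ∀ h s, |c h s| ≤ B)
    (hvan : ∀ a : Fin m × ι →₀ ℕ, θ * m ≤ slope r c (fun h s => a (h, s)) →
          (lsub (fun _ => M') (map (Int.castRingHom R) P)).coeff a = 0)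
    (Z : Fin m → Matrix ι ι ℤ) (T : Fin m → ι)
    (hZ : ∀ h σ S, |(M * ir (Z h)) σ S| ≤ Real.exp (l h * c h σ) *
      (if S = T h then Real.exp (l h * B) else Real.exp (-(l h * η))))
    (b : Fin m × ι →₀ ℕ) (hb : (lsub Z P).coeff b ≠ 0) :
    0 ≤ (∑ h, (r h : ℝ)) * (Real.log K + Real.log K1 + Real.log (Fintype.card ι)) +
      τ * (θ * m + ε1 * B * m) +
      τ * (-η * m + (1 + ε1) * (B + η) * ∑ h, (b (h, T h) : ℝ) / r h) := by
  have hr0 : ∀ h, (0 : ℝ) < r h := fun h => by exact_mod_cast hr h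
  have hn : (1 : ℝ) ≤ Fintype.card ι := by exact_mod_cast Fintype.card_pos
  set n : ℝ := (Fintype.card ι : ℝ) with hnd
  set p : MvPolynomial (Fin m × ι) ℝ :=
    map φ (lsub (fun _ => M') (map (Int.castRingHom R) P)) with hp
  have hphi : (map φ) (map (Int.castRingHom R) P) = map (Int.castRingHom ℝ) P := by
    rw [MvPolynomial.map_map,
      RingHom.ext_int (φ.comp (Int.castRingHom R)) (Int.castRingHom ℝ)]
  have hp2 : p = lsub (fun _ => M'.map φ) (map (Int.castRingHom ℝ) P) := by
    rw [hp, map_lsub, hphi]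
  have hRh : IsWeightedHomogeneous (mhw m ι) (map (Int.castRingHom ℝ) P) r := mh_map _ hPh
  have hph : IsWeightedHomogeneous (mhw m ι) p r := by
    rw [hp2]; exact mh_lsub _ hRh
  -- q in terms of p
  have hq : lsub (fun h => M * ir (Z h)) p
      = C ((N : ℝ) ^ (∑ h, r h)) * map (Int.castRingHom ℝ) (lsub Z P) := by
    rw [hp2, lsub_lsub]
    have h1 : (fun h => M'.map φ * (M * ir (Z h))) = fun h => ((N : ℝ) • (1 : Matrix ι ι ℝ)) * ir (Z h) := by
      funext h
      rw [← Matrix.mul_assoc, hM]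
    rw [h1, ← lsub_lsub (fun _ => (N : ℝ) • (1 : Matrix ι ι ℝ)), lsub_smul_one _ hRh, map_mul,
      map_lsub]
    simp only [algHom_C, MvPolynomial.algebraMap_eq]
  have hqb : 1 ≤ |(lsub (fun h => M * ir (Z h)) p).coeff b| := by
    rw [hq, coeff_C_mul, coeff_map, abs_mul, abs_pow]
    have h1 : (1 : ℝ) ≤ |(N : ℝ)| := by
      exact_mod_cast Int.one_le_abs hN
    have h2 : (1 : ℝ) ≤ |(Int.castRingHom ℝ) ((lsub Z P).coeff b)| := by
      rw [eq_intCast]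
      exact_mod_cast Int.one_le_abs hb
    exact one_le_mul_of_one_le_of_one_le (one_le_pow₀ h1) h2
  have hbr : ∀ h, ∑ s, b (h, s) = r h := mh_coeff (mh_lsub Z hPh) hb
  -- weights
  let y : Fin m × ι → ℝ := fun p => if p.2 = T p.1 then -(l p.1 * B) else l p.1 * η
  let y' : Fin m × ι → ℝ := fun p => Real.log n + l p.1 * c p.1 p.2
  have hw : ∀ p, 0 ≤ Real.exp (y p) := fun p => (Real.exp_pos _).le
  have hbound : wnorm absR (fun p => Real.exp (y p)) (lsub (fun h => M * ir (Z h)) p)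
      ≤ wnorm absR (fun p => Real.exp (y' p)) p := by
    refine wnorm_eval₂_le absR absR hw (by simp [absR_apply]) _ _ ?_ ?_ p
    · intro c
      rw [MvPolynomial.algebraMap_eq, wnorm_C]
    · rintro ⟨h, σ⟩
      refine (wnorm_sum_le absR hw _ _).trans ?_
      have h1 : ∀ t ∈ (Finset.univ : Finset ι), wnorm absR (fun p => Real.exp (y p))
          (C ((M * ir (Z h)) σ t) * X (h, t)) ≤ Real.exp (l h * c h σ) := by
        intro t _
        refine (wnorm_mul_le absR hw _ _).trans ?_
        rw [wnorm_C, absR_apply]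
        refine (mul_le_mul (hZ h σ t) (wnorm_X_le absR hw (by simp [absR_apply]) _)
          (wnorm_nonneg absR hw _) ?_).trans ?_
        · split_ifs <;> positivity
        · simp only [y]
          split_ifs
          · rw [mul_assoc, ← Real.exp_add, add_neg_cancel, Real.exp_zero, mul_one]
          · rw [mul_assoc, ← Real.exp_add, neg_add_cancel, Real.exp_zero, mul_one]
      refine (Finset.sum_le_card_nsmul _ _ _ h1).trans ?_
      simp only [y']
      rw [nsmul_eq_mul, Finset.card_univ, Real.exp_add, Real.exp_log (by linarith)]
  have hl1p : l1 _ absR p ≤ (K * K1) ^ (∑ h, r h) := by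
    rw [hp2]
    refine (l1_lsub_le absR (by simp [absR_apply]) _ K1 ?_ hRh).trans ?_
    · intro h s
      simpa [absR_apply] using hM' s
    · rw [mul_pow]
      exact mul_le_mul_of_nonneg_right ((l1_map_le P).trans hPK) (by positivity)
  set X0 : ℝ := (∑ h, (r h : ℝ)) * Real.log n + τ * (θ * m + ε1 * B * m) with hX0
  have hmw : ∀ a, p.coeff a ≠ 0 → mw (fun p => Real.exp (y' p)) a ≤ Real.exp X0 := by
    intro a ha
    have har : ∀ h, ∑ s, a (h, s) = r h := mh_coeff hph ha
    have hs : slope r c (fun h s => a (h, s)) < θ * m := by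
      by_contra hcon
      push Not at hcon
      apply ha
      rw [hp, coeff_map, hvan a hcon, map_zero]
    rw [mw_exp, Real.exp_le_exp, Fintype.sum_prod_type, hX0]
    simp only [y', add_mul, Finset.sum_add_distrib]
    have h1 : ∑ h, ∑ s, Real.log n * (a (h, s) : ℝ) = (∑ h, (r h : ℝ)) * Real.log n := by
      rw [Finset.sum_mul]
      refine Finset.sum_congr rfl fun h _ => ?_
      rw [← Finset.mul_sum, ← har h, mul_comm]
      push_cast
      rfl
    have h2 : ∀ h, ∑ s, l h * c h s * (a (h, s) : ℝ) ≤
        τ * ((∑ s, c h s * (a (h, s) : ℝ)) / r h) + τ * (ε1 * B) := by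
      intro h
      have h3 := abs_inner_le (r h) (c h) B (hcB h) (fun s => a (h, s)) (har h)
      set u := ∑ s, c h s * (a (h, s) : ℝ) with hu
      have h4 : ∑ s, l h * c h s * (a (h, s) : ℝ) = l h * u := by
        rw [hu, Finset.mul_sum]
        exact Finset.sum_congr rfl fun s _ => by ring
      rw [h4]
      have h5 : l h * u = (r h * l h) * (u / r h) := by
        have := (hr0 h).ne'
        field_simp
      have h6 : u / r h ≤ B := by
        rw [div_le_iff₀ (hr0 h)]
        exact (le_abs_self _).trans h3
      rw [h5]
      have h7 : (r h * l h - τ) * (u / r h) ≤ (r h * l h - τ) * B :=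
        mul_le_mul_of_nonneg_left h6 (by linarith [hl1 h])
      have h8 : (r h * l h - τ) * B ≤ (ε1 * τ) * B :=
        mul_le_mul_of_nonneg_right (by linarith [hl2 h]) hB.le
      nlinarith
    have h9 := Finset.sum_le_sum fun h (_ : h ∈ Finset.univ) => h2 h
    rw [Finset.sum_add_distrib, ← Finset.mul_sum, Finset.sum_const, Finset.card_univ,
      Fintype.card_fin, nsmul_eq_mul] at h9
    have h10 : τ * ∑ h, (∑ s, c h s * (a (h, s) : ℝ)) / r h ≤ τ * (θ * m) :=
      mul_le_mul_of_nonneg_left hs.le hτ.le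
    rw [h1]
    nlinarith
  have hwn : wnorm absR (fun p => Real.exp (y' p)) p ≤ l1 _ absR p * Real.exp X0 := by
    rw [l1_apply, wnorm, wnorm, Finset.sum_mul]
    refine Finset.sum_le_sum fun a ha => ?_
    rw [mw_one, mul_one]
    exact mul_le_mul_of_nonneg_left (hmw a (mem_support_iff.1 ha)) (apply_nonneg _ _)
  have hmwb : mw (fun p => Real.exp (y p)) b = Real.exp (∑ h, l h * (η * r h - (B + η) * b (h, T h))) := by
    rw [mw_exp, Fintype.sum_prod_type]
    congr 1
    refine Finset.sum_congr rfl fun h _ => ?_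
    have h1 : ∀ s, y (h, s) * (b (h, s) : ℝ) = l h * η * b (h, s) +
        (if s = T h then -(l h * (B + η)) * b (h, s) else 0) := by
      intro s
      simp only [y]
      split_ifs <;> ring
    simp only [h1]
    rw [Finset.sum_add_distrib, ← Finset.mul_sum, Finset.sum_ite_eq' Finset.univ (T h),
      if_pos (Finset.mem_univ _), ← hbr h]
    push_cast
    ring
  have hfin := (coeff_le_wnorm absR hw (lsub (fun h => M * ir (Z h)) p) b).trans (hbound.trans hwn)
  rw [absR_apply, hmwb] at hfin
  have hKexp : (K * K1) ^ (∑ h, r h) = Real.exp ((∑ h, (r h : ℝ)) * (Real.log K + Real.log K1)) := by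
    rw [← Real.log_mul (by linarith) (by linarith), ← Nat.cast_sum, Real.exp_nat_mul,
      Real.exp_log (by positivity)]
  have h20 : Real.exp (∑ h, l h * (η * r h - (B + η) * b (h, T h))) ≤
      Real.exp ((∑ h, (r h : ℝ)) * (Real.log K + Real.log K1) + X0) := by
    rw [Real.exp_add, ← hKexp]
    calc _ ≤ |(lsub (fun h => M * ir (Z h)) p).coeff b| *
          Real.exp (∑ h, l h * (η * r h - (B + η) * b (h, T h))) :=
          le_mul_of_one_le_left (Real.exp_pos _).le hqb
      _ ≤ _ := hfin
      _ ≤ _ := mul_le_mul_of_nonneg_right hl1p (Real.exp_pos _).le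
  rw [Real.exp_le_exp] at h20
  have h21 : ∀ h, τ * η - τ * ((1 + ε1) * (B + η)) * ((b (h, T h) : ℝ) / r h) ≤
      l h * (η * r h - (B + η) * b (h, T h)) := by
    intro h
    have h22 : l h * (η * r h - (B + η) * b (h, T h)) =
        (r h * l h) * η - (r h * l h) * ((B + η) * ((b (h, T h) : ℝ) / r h)) := by
      have := (hr0 h).ne'
      field_simp
    rw [h22]
    have h23 : 0 ≤ (B + η) * ((b (h, T h) : ℝ) / r h) := by positivity
    have h24 := mul_le_mul_of_nonneg_right (hl2 h) h23
    have h25 := mul_le_mul_of_nonneg_right (hl1 h) hη.le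
    nlinarith
  have h26 := Finset.sum_le_sum fun h (_ : h ∈ Finset.univ) => h21 h
  rw [Finset.sum_sub_distrib, Finset.sum_const, Finset.card_univ,
      Fintype.card_fin, nsmul_eq_mul, ← Finset.mul_sum] at h26
  rw [hX0] at h20
  nlinarith

end

/-- a configuration of a bad sequence -/
def Bad {ι : Type} [Fintype ι] [DecidableEq ι] (M : Matrix ι ι ℝ) (η B c' l : ℝ) : Prop :=
  ∃ (Z Z' : Matrix ι ι ℤ) (T j : ι) (c : ι → ℝ), Z * Z' = 1 ∧ ∑ s, c s = 0 ∧ (∀ s, |c s| ≤ B) ∧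
    (∀ σ S, |(M * ir Z) σ S| ≤ Real.exp (l * c σ) *
      (if S = T then Real.exp (l * B) else Real.exp (-(l * η)))) ∧
    c' * l ≤ Real.log |(Z' T j : ℝ)|

theorem core {R : Type} [CommRing R] [IsDomain R] {D : ℕ} (bs : Module.Basis (Fin D) ℤ R)
    (φ : R →+* ℝ) {ι : Type} [Fintype ι] [DecidableEq ι] [Nonempty ι]
    (M : Matrix ι ι ℝ) (M' : Matrix ι ι R) (N : ℤ) (hN : N ≠ 0)
    (hM : M'.map φ * M = (N : ℝ) • 1) (η B c' : ℝ) (hη : 0 < η) (hB : 0 < B) (hc' : 0 < c')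
    (hbad : ∀ l0 : ℝ, ∃ l ≥ l0, Bad M η B c' l) : False := by
  obtain ⟨m, hm1, K, hK, haux⟩ := aux_poly bs M' B (η / 2) (by positivity)
  have hm0 : (1 : ℝ) ≤ m := by exact_mod_cast hm1
  set K1 : ℝ := 1 + ∑ s, ∑ t, |φ (M' s t)| with hK1d
  have hsum : ∀ s, 0 ≤ ∑ t, |φ (M' s t)| := fun s => Finset.sum_nonneg fun t _ => abs_nonneg _
  have hK1 : 1 ≤ K1 := by
    have : 0 ≤ ∑ s, ∑ t, |φ (M' s t)| := Finset.sum_nonneg fun s _ => hsum s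
    linarith
  have hrow : ∀ s, ∑ t, |φ (M' s t)| ≤ K1 := by
    intro s
    have := Finset.single_le_sum (f := fun s => ∑ t, |φ (M' s t)|) (fun s _ => hsum s)
      (Finset.mem_univ s)
    linarith
  set t' : ℝ := η / (16 * (B + η)) with ht'
  have ht'0 : 0 < t' := by positivity
  set t : ℝ := min 1 (t' * m) with ht
  have ht0 : 0 < t := lt_min one_pos (by positivity)
  obtain ⟨ω, hω, hroth⟩ := roth_end m ι t ht0 (min_le_left _ _)
  set κ : ℝ := Real.log K + Real.log K1 + Real.log (Fintype.card ι) with hκ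
  have hn : (1 : ℝ) ≤ (Fintype.card ι : ℝ) := by exact_mod_cast Fintype.card_pos
  have hlK : 0 ≤ Real.log K := Real.log_nonneg hK
  have hκ0 : 0 ≤ κ := by
    have h2 := Real.log_nonneg hK1
    have h3 := Real.log_nonneg hn
    linarith
  set ε1 : ℝ := min 1 (η / (8 * B)) with hε1
  have hε10 : 0 < ε1 := lt_min one_pos (by positivity)
  have hε11 : ε1 ≤ 1 := min_le_left _ _
  have hε1B : ε1 * B ≤ η / 8 := by
    have : ε1 ≤ η / (8 * B) := min_le_right _ _
    rw [le_div_iff₀ (by positivity)] at this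
    linarith
  set L0 : ℝ := 1 + 8 * κ / η + 2 * m * (Real.log K + 1) / (ω * c') with hL0d
  have hLa : 0 ≤ 8 * κ / η := by positivity
  have hLb : 0 ≤ 2 * m * (Real.log K + 1) / (ω * c') := by positivity
  have hL0 : 0 < L0 := by linarith
  obtain ⟨l, hlbad, hlL, hlchain⟩ := chain (Bad M η B c') hbad (ω / 2) L0 (by positivity) hL0 m
  choose Z Z' T j c hZZ hc hcB hMZ hlog using hlbad
  have hl0 : ∀ h, 0 < l h := fun h => hL0.trans_le (hlL h)
  set τ : ℝ := (∑ h, l h) / ε1 with hτd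
  have hτl : ∀ h, l h ≤ ε1 * τ := by
    intro h
    rw [hτd, mul_div_cancel₀ _ hε10.ne']
    exact Finset.single_le_sum (f := l) (fun h _ => (hl0 h).le) (Finset.mem_univ h)
  have hτ : 0 < τ := by
    have h1 := hτl ⟨0, hm1⟩
    have h2 := hl0 ⟨0, hm1⟩
    by_contra hcon
    push Not at hcon
    nlinarith
  let r : Fin m → ℕ := fun h => ⌈τ / l h⌉₊
  have hr : ∀ h, 1 ≤ r h := fun h => Nat.one_le_ceil_iff.2 (div_pos hτ (hl0 h))
  have hr1 : ∀ h, τ ≤ r h * l h := by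
    intro h
    rw [← div_le_iff₀ (hl0 h)]
    exact Nat.le_ceil _
  have hr2 : ∀ h, r h * l h ≤ (1 + ε1) * τ := by
    intro h
    have h1 : (r h : ℝ) < τ / l h + 1 := Nat.ceil_lt_add_one (by have := hl0 h; positivity)
    have h2 : (r h : ℝ) * l h ≤ (τ / l h + 1) * l h :=
      mul_le_mul_of_nonneg_right h1.le (hl0 h).le
    have h3 : (τ / l h + 1) * l h = τ + l h := by
      have := (hl0 h).ne'
      field_simp
    linarith [hτl h]
  have hr2' : ∀ h, r h * l h ≤ 2 * τ := fun h => (hr2 h).trans (by nlinarith)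
  have hrL : ∀ h, (r h : ℝ) ≤ 2 * τ / L0 := by
    intro h
    rw [le_div_iff₀ hL0]
    have : (r h : ℝ) * L0 ≤ r h * l h := mul_le_mul_of_nonneg_left (hlL h) (Nat.cast_nonneg _)
    linarith [hr2' h]
  have hsr : ∑ h, (r h : ℝ) ≤ m * (2 * τ / L0) := by
    refine (Finset.sum_le_card_nsmul _ _ _ fun h _ => hrL h).trans ?_
    rw [nsmul_eq_mul, Finset.card_univ, Fintype.card_fin]
  have hsr' : (∑ h, (r h : ℝ)) * L0 ≤ 2 * m * τ := by
    have := mul_le_mul_of_nonneg_right hsr hL0.le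
    have h2 : m * (2 * τ / L0) * L0 = 2 * m * τ := by field_simp
    linarith
  have hsr0 : 0 ≤ ∑ h, (r h : ℝ) := Finset.sum_nonneg fun h _ => Nat.cast_nonneg _
  obtain ⟨P, hP0, hPh, hPK, hPv⟩ := haux r hr c hc hcB
  have hPK' : l1 _ absZ P ≤ Real.exp ((∑ h, (r h : ℝ)) * Real.log K) := by
    rw [← Nat.cast_sum, Real.exp_nat_mul, Real.exp_log (by linarith)]
    exact hPK
  obtain ⟨b, hb, hbt⟩ := hroth P r Z Z' T j (c' * τ) ((∑ h, (r h : ℝ)) * Real.log K) hP0 hPh hr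
    (by
      intro h h' hh
      have h1 := hlchain h h' hh
      have h2 : (r h : ℝ) * l h ≤ ω * r h' * l h := by
        calc (r h : ℝ) * l h ≤ 2 * τ := hr2' h
          _ ≤ 2 * (r h' * l h') := by linarith [hr1 h']
          _ ≤ 2 * (r h' * (ω / 2 * l h)) := by gcongr
          _ = ω * r h' * l h := by ring
      exact le_of_mul_le_mul_right h2 (hl0 h))
    (by positivity) (by positivity) hZZ
    (by
      intro h h0
      have := hlog h
      rw [h0] at this
      simp only [Int.cast_zero, abs_zero, Real.log_zero] at this
      have := mul_pos hc' (hl0 h)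
      linarith)
    (by
      intro h
      have h1 : (r h : ℝ) * (c' * l h) ≤ r h * Real.log |(Z' h (T h) (j h) : ℝ)| :=
        mul_le_mul_of_nonneg_left (hlog h) (Nat.cast_nonneg _)
      have h2 := mul_le_mul_of_nonneg_left (hr1 h) hc'.le
      linarith)
    hPK'
    (by
      have h1 : 2 * m * (Real.log K + 1) / (ω * c') ≤ L0 := by linarith
      rw [div_le_iff₀ (by positivity)] at h1
      have h2 : ((∑ h, (r h : ℝ)) * Real.log K + ∑ h, (r h : ℝ)) * L0 ≤ ω * (c' * τ) * L0 := by
        calc _ = (Real.log K + 1) * ((∑ h, (r h : ℝ)) * L0) := by ring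
          _ ≤ (Real.log K + 1) * (2 * m * τ) := by gcongr
          _ = τ * (2 * m * (Real.log K + 1)) := by ring
          _ ≤ τ * (L0 * (ω * c')) := by gcongr
          _ = _ := by ring
      exact le_of_mul_le_mul_right h2 hL0)
  have hfin := small_coeff φ M M' N hN hM K1 hK1 hrow K hK η B (η / 2) ε1 τ hη hB hτ P r hr l hr1
    hr2 hPh hPK c hcB hPv Z T hMZ b hb
  rw [← hκ] at hfin
  have hb0 : 0 ≤ ∑ h, (b (h, T h) : ℝ) / r h := Finset.sum_nonneg fun h _ => by positivity
  have h1 : (1 + ε1) * (B + η) * ∑ h, (b (h, T h) : ℝ) / r h ≤ η / 8 * m := by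
    have h2 : ∑ h, (b (h, T h) : ℝ) / r h ≤ t' * m := hbt.le.trans (min_le_right _ _)
    calc _ ≤ 2 * (B + η) * (t' * m) := by gcongr; linarith
      _ = η / 8 * m := by
        rw [ht']
        field_simp
        ring
  have h2 : (∑ h, (r h : ℝ)) * κ < τ * m * η / 4 := by
    have h3 : 8 * κ / η < L0 := by linarith
    rw [div_lt_iff₀ hη] at h3
    have h4 : (∑ h, (r h : ℝ)) * κ * L0 < τ * m * η / 4 * L0 := by
      calc (∑ h, (r h : ℝ)) * κ * L0 = κ * ((∑ h, (r h : ℝ)) * L0) := by ring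
        _ ≤ κ * (2 * m * τ) := by gcongr
        _ = (m * τ / 4) * (8 * κ) := by ring
        _ < (m * τ / 4) * (L0 * η) := by gcongr
        _ = _ := by ring
    exact lt_of_mul_lt_mul_right h4 hL0.le
  have h5 : τ * (-η * m + (1 + ε1) * (B + η) * ∑ h, (b (h, T h) : ℝ) / r h) ≤
      τ * (-η * m + η / 8 * m) := by gcongr
  have h6 : τ * (η / 2 * m + ε1 * B * m) ≤ τ * (η / 2 * m + η / 8 * m) := by gcongr
  nlinarith

end Sch


namespace Sch
open MvPolynomial

lemma sn_nsmul {R : Type*} [CommRing R] (N : RingSeminorm R) (n : ℕ) (x : R) :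
    N (n • x) ≤ n * N x := by
  induction n with
  | zero => simp
  | succ n ih =>
    rw [succ_nsmul]
    refine (map_add_le_add N _ _).trans ?_
    push_cast
    linarith

lemma sn_zsmul {R : Type*} [CommRing R] (N : RingSeminorm R) (n : ℤ) (x : R) :
    N (n • x) ≤ |(n : ℝ)| * N x := by
  rcases Int.natAbs_eq n with h | h
  · have h1 : n • x = n.natAbs • x := by
      conv_lhs => rw [h]
      rw [natCast_zsmul]
    have h2 : |(n : ℝ)| = (n.natAbs : ℝ) := by rw [Nat.cast_natAbs, Int.cast_abs]
    rw [h1, h2]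
    exact sn_nsmul N _ _
  · have h1 : n • x = -(n.natAbs • x) := by
      conv_lhs => rw [h]
      rw [neg_zsmul, natCast_zsmul]
    have h2 : |(n : ℝ)| = (n.natAbs : ℝ) := by rw [Nat.cast_natAbs, Int.cast_abs]
    rw [h1, h2, map_neg_eq_map]
    exact sn_nsmul N _ _

section mats
variable {n : ℕ}

/-- the linear form followed by the coordinates -/
def AM {R : Type*} [CommRing R] (α : Fin (n + 1) → R) : Matrix (Fin (n + 1)) (Fin (n + 1)) R :=
  Matrix.of fun i j => if i = 0 then α j else if i = j then 1 else 0

/-- scaled inverse of `AM` -/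
def AI {R : Type*} [CommRing R] (N : R) (a : Fin (n + 1) → R) :
    Matrix (Fin (n + 1)) (Fin (n + 1)) R :=
  Matrix.of fun i j => if i = 0 then (if j = 0 then N else - a j) else if i = j then N else 0

lemma AI_map {R R' : Type*} [CommRing R] [CommRing R'] (φ : R →+* R') (N : R)
    (a : Fin (n + 1) → R) : (AI N a).map φ = AI (φ N) (fun i => φ (a i)) := by
  ext i j
  simp only [AI, Matrix.map_apply, Matrix.of_apply]
  split_ifs <;> simp

lemma AI_mul_AM (N : ℝ) (α : Fin (n + 1) → ℝ) (hα : α 0 = 1) :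
    AI N (fun i => N * α i) * AM α = N • 1 := by
  ext i j
  rw [Matrix.mul_apply, Fin.sum_univ_succ]
  simp only [AI, AM, Matrix.of_apply, if_true, Fin.succ_ne_zero, if_false]
  by_cases hi : i = 0
  · subst hi
    refine Fin.cases ?_ (fun j => ?_) j
    · simp [hα, Fin.succ_ne_zero]
    · simp [Fin.succ_ne_zero, Matrix.one_apply, (Fin.succ_ne_zero _).symm]
  · obtain ⟨i, rfl⟩ := Fin.exists_succ_eq.2 hi
    simp [Fin.succ_ne_zero, Matrix.one_apply]
    rw [Finset.sum_eq_single i]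
    · simp
    · intro x _ hx
      simp [hx.symm]
    · simp

lemma AM_det (α : Fin (n + 1) → ℝ) (hα : α 0 = 1) : (AM α).det = 1 := by
  rw [Matrix.det_of_upperTriangular]
  · rw [Fin.prod_univ_succ]
    simp [AM, hα, Fin.succ_ne_zero]
  · intro i j hij
    have hij : j < i := hij
    have h1 : i ≠ 0 := by
      intro h
      rw [h] at hij
      exact absurd hij (Fin.not_lt_zero _)
    simp [AM, h1, hij.ne']

/-- dilation weights -/
noncomputable def dd (n : ℕ) (l : ℝ) : Fin (n + 1) → ℝ :=
  fun i => if i = 0 then Real.exp (n * l) else Real.exp (-l)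

lemma dd_pos (l : ℝ) (i : Fin (n + 1)) : 0 < dd n l i := by
  unfold dd
  split_ifs <;> exact Real.exp_pos _

lemma dd_prod (l : ℝ) : ∏ i, dd n l i = 1 := by
  rw [Fin.prod_univ_succ]
  simp only [dd, if_true, Fin.succ_ne_zero, if_false, Finset.prod_const, Finset.card_univ,
    Fintype.card_fin]
  rw [← Real.exp_nat_mul, ← Real.exp_add, mul_neg, add_neg_cancel, Real.exp_zero]

/-- the dilated matrix -/
noncomputable def gM (α : Fin (n + 1) → ℝ) (l : ℝ) : Matrix (Fin (n + 1)) (Fin (n + 1)) ℝ :=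
  Matrix.diagonal (dd n l) * AM α

lemma gM_det (α : Fin (n + 1) → ℝ) (hα : α 0 = 1) (l : ℝ) : (gM α l).det = 1 := by
  rw [gM, Matrix.det_mul, AM_det α hα, Matrix.det_diagonal, dd_prod, mul_one]

lemma gM_mul_apply (α : Fin (n + 1) → ℝ) (l : ℝ) (B : Matrix (Fin (n + 1)) (Fin (n + 1)) ℝ) (i j) :
    (gM α l * B) i j = dd n l i * (AM α * B) i j := by
  rw [gM, Matrix.mul_assoc, Matrix.diagonal_mul]

lemma AM_mul_zero (α : Fin (n + 1) → ℝ) (B : Matrix (Fin (n + 1)) (Fin (n + 1)) ℝ) (j) :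
    (AM α * B) 0 j = ∑ i, α i * B i j := by
  simp [Matrix.mul_apply, AM]

lemma AM_mul_ne (α : Fin (n + 1) → ℝ) (B : Matrix (Fin (n + 1)) (Fin (n + 1)) ℝ) (i j)
    (hi : i ≠ 0) : (AM α * B) i j = B i j := by
  simp [Matrix.mul_apply, AM, hi]

end mats

/-- the output of reduction at a bad parameter -/
structure Red {n : ℕ} (α : Fin (n + 1) → ℝ) (C δ0 l : ℝ)
    (U : Matrix (Fin (n + 1)) (Fin (n + 1)) ℤ)
    (π : Equiv.Perm (Fin (n + 1))) (lam : Fin (n + 1) → ℝ) : Prop where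
  unit : IsUnit U.det
  mono : Monotone lam
  pos : ∀ i, 0 < lam i
  row : ∀ i j, |(gM α l * ir U) (π i) j| ≤ lam i
  col : ∀ i j, |(gM α l * ir U) i j| ≤ lam j
  prod_le : ∏ i, lam i ≤ C
  le0 : lam 0 ≤ Real.exp (-(l * δ0))

section red
variable {n : ℕ} {α : Fin (n + 1) → ℝ} {C δ0 l : ℝ} {U : Matrix (Fin (n + 1)) (Fin (n + 1)) ℤ}
  {π : Equiv.Perm (Fin (n + 1))} {lam : Fin (n + 1) → ℝ}

lemma ir_det (U : Matrix (Fin (n + 1)) (Fin (n + 1)) ℤ) (hU : IsUnit U.det) :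
    |(ir U).det| = 1 := by
  have h1 : (ir U).det = ((U.det : ℤ) : ℝ) := by
    rw [ir, ← RingHom.mapMatrix_apply, ← RingHom.map_det]
    rfl
  rw [h1]
  rcases Int.isUnit_iff.1 hU with h | h <;> rw [h] <;> simp

lemma Red.det (hα : α 0 = 1) (H : Red α C δ0 l U π lam) : |(gM α l * ir U).det| = 1 := by
  rw [Matrix.det_mul, gM_det α hα, one_mul, ir_det U H.unit]

lemma Red.prod_ge (hα : α 0 = 1) (H : Red α C δ0 l U π lam) :
    1 ≤ ((n + 1).factorial : ℝ) * ∏ i, lam i := by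
  have := det_bound_col (gM α l * ir U) 1 lam (fun i j => by rw [one_mul]; exact H.col i j)
  rwa [H.det hα, one_pow, mul_one] at this

lemma Red.col_ne (H : Red α C δ0 l U π lam) (j : Fin (n + 1)) : (fun i => U i j) ≠ 0 := by
  intro h0
  have : U.det = 0 := Matrix.det_eq_zero_of_column_eq_zero j fun i => congrFun h0 i
  have h1 := H.unit
  rw [this] at h1
  exact not_isUnit_zero h1

lemma Red.lam_ge (hα : α 0 = 1) (hl : 0 ≤ l) (H : Red α C δ0 l U π lam) (j : Fin (n + 1)) :
    Real.exp (-l) ≤ lam j := by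
  by_cases hU : ∃ i, i ≠ 0 ∧ U i j ≠ 0
  · obtain ⟨i, hi, hij⟩ := hU
    refine le_trans ?_ (H.col i j)
    rw [gM_mul_apply, AM_mul_ne _ _ _ _ hi, abs_mul, abs_of_pos (dd_pos l i), dd, if_neg hi]
    have : (1 : ℝ) ≤ |ir U i j| := by
      have : ir U i j = (U i j : ℝ) := rfl
      rw [this]
      exact_mod_cast Int.one_le_abs hij
    exact le_mul_of_one_le_right (Real.exp_pos _).le this
  · push Not at hU
    have h0 : U 0 j ≠ 0 := by
      intro h0
      apply H.col_ne j
      funext i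
      by_cases hi : i = 0
      · rw [hi]; exact h0
      · exact hU i hi
    refine le_trans ?_ (H.col 0 j)
    rw [gM_mul_apply, AM_mul_zero, Finset.sum_eq_single 0, hα, one_mul, abs_mul,
      abs_of_pos (dd_pos l 0), dd, if_pos rfl]
    · have : (1 : ℝ) ≤ |ir U 0 j| := by
        have : ir U 0 j = (U 0 j : ℝ) := rfl
        rw [this]
        exact_mod_cast Int.one_le_abs h0
      refine le_trans ?_ (le_mul_of_one_le_right (Real.exp_pos _).le this)
      rw [Real.exp_le_exp]
      have : 0 ≤ n * l := by positivity
      linarith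
    · intro i _ hi
      have : ir U i j = (U i j : ℝ) := rfl
      rw [this, hU i hi]
      simp
    · simp

lemma Red.log_ge (hα : α 0 = 1) (hl : 0 ≤ l) (H : Red α C δ0 l U π lam) (j : Fin (n + 1)) :
    -l ≤ Real.log (lam j) := by
  rw [Real.le_log_iff_exp_le (H.pos j)]
  exact H.lam_ge hα hl j

lemma Red.sum_le (H : Red α C δ0 l U π lam) : ∑ i, Real.log (lam i) ≤ Real.log C := by
  rw [← Real.log_prod fun i _ => (H.pos i).ne']
  exact Real.log_le_log (Finset.prod_pos fun i _ => H.pos i) H.prod_le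

lemma Red.sum_ge (hα : α 0 = 1) (H : Red α C δ0 l U π lam) :
    -Real.log ((n + 1).factorial : ℝ) ≤ ∑ i, Real.log (lam i) := by
  rw [← Real.log_prod fun i _ => (H.pos i).ne']
  have h1 := Real.log_le_log one_pos (H.prod_ge hα)
  have hp := Finset.prod_pos fun i (_ : i ∈ Finset.univ) => H.pos i
  rw [Real.log_one, Real.log_mul (by positivity) hp.ne'] at h1
  linarith

lemma Red.log_le (hα : α 0 = 1) (hl : 0 ≤ l) (H : Red α C δ0 l U π lam) (j : Fin (n + 1)) :
    Real.log (lam j) ≤ Real.log C + n * l := by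
  have h1 := H.sum_le
  rw [← Finset.add_sum_erase _ _ (Finset.mem_univ j)] at h1
  have h2 := Finset.card_nsmul_le_sum (Finset.univ.erase j) (fun i => Real.log (lam i)) (-l)
    fun i _ => H.log_ge hα hl i
  rw [Finset.card_erase_of_mem (Finset.mem_univ j), Finset.card_univ, Fintype.card_fin,
    nsmul_eq_mul, Nat.add_sub_cancel] at h2
  linarith

lemma Red.gap (hα : α 0 = 1) (H : Red α C δ0 l U π lam)
    (hl : Real.log ((n + 1).factorial : ℝ) < l * (δ0 / 2)) (hn : 0 < δ0) (hl0 : 0 ≤ l) :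
    ∃ p : Fin n, Real.log (lam p.castSucc) ≤ Real.log (lam p.succ) - δ0 / (2 * (n + 1)) * l := by
  by_contra hcon
  push Not at hcon
  set δ := δ0 / (2 * (n + 1)) with hδ
  have h1 : ∀ i : Fin (n + 1), Real.log (lam i) ≤ -(l * δ0) + (i : ℕ) * (δ * l) := by
    intro i
    induction i using Fin.induction with
    | zero =>
      have := Real.log_le_log (H.pos 0) H.le0
      rw [Real.log_exp] at this
      simpa using this
    | succ i ih =>
      have h2 := hcon i
      simp only [Fin.val_castSucc] at ih
      simp only [Fin.val_succ]
      push_cast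
      linarith
  have h2 : ∀ i : Fin (n + 1), Real.log (lam i) ≤ -(l * (δ0 / 2)) := by
    intro i
    refine (h1 i).trans ?_
    have h3 : ((i : ℕ) : ℝ) ≤ n + 1 := by
      have := i.2
      exact_mod_cast this.le
    have h4 : ((i : ℕ) : ℝ) * (δ * l) ≤ (n + 1) * (δ * l) := by gcongr
    have h5 : (n + 1) * (δ * l) = l * (δ0 / 2) := by
      rw [hδ]
      field_simp
    linarith
  have h6 := Finset.sum_le_sum fun i (_ : i ∈ Finset.univ) => h2 i
  rw [Finset.sum_const, Finset.card_univ, Fintype.card_fin, nsmul_eq_mul] at h6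
  have h7 := H.sum_ge hα
  have h8 : 0 ≤ l * (δ0 / 2) := by positivity
  have h9 : ((n + 1 : ℕ) : ℝ) * -(l * (δ0 / 2)) ≤ -(l * (δ0 / 2)) := by
    push_cast
    nlinarith [mul_nonneg (Nat.cast_nonneg (α := ℝ) n) h8]
  linarith

end red

theorem red_exists {n : ℕ} (α : Fin (n + 1) → ℝ) (hα : α 0 = 1) : ∃ C : ℝ, 1 ≤ C ∧
    ∀ δ0 l : ℝ, (∃ x : Fin (n + 1) → ℤ, x ≠ 0 ∧ ‖(gM α l).mulVec (iv x)‖ ≤ Real.exp (-(l * δ0))) →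
      ∃ U π lam, Red α C δ0 l U π lam := by
  obtain ⟨C, hC, h⟩ := reduction (n + 1)
  refine ⟨C, hC, ?_⟩
  rintro δ0 l ⟨x, hx0, hx⟩
  obtain ⟨U, hU, π, lam, h1, h2, h3, h4, h5, h6⟩ := h (gM α l) (by rw [gM_det α hα]; exact one_ne_zero)
  refine ⟨U, π, lam, hU, h1, h2, h3, ?_, ?_, (h6 0 rfl x hx0).trans hx⟩
  · intro i j
    have := h4 (π.symm i) j
    rwa [Equiv.apply_symm_apply] at this
  · rwa [gM_det α hα, abs_one, mul_one] at h5

end Sch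


namespace Sch
open MvPolynomial

section
variable {k q : ℕ}

/-- sum over an index -/
def ss (F : Fin k → ℝ) (S : Ix k q) : ℝ := ∑ i ∈ S.1, F i

lemma wt_exp (F : Fin k → ℝ) (S : Ix k q) :
    wt (fun i => Real.exp (F i)) S = Real.exp (ss F S) := by
  rw [wt_eq, ss, Real.exp_sum]

lemma sum_ss (k q : ℕ) : ∃ c : ℕ, ∀ F : Fin k → ℝ, ∑ S : Ix k q, ss F S = c * ∑ i, F i := by
  obtain ⟨c, hc⟩ := prod_wt k q
  refine ⟨c, fun F => ?_⟩
  have h := hc fun i => Real.exp (F i)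
  simp only [wt_exp] at h
  rw [← Real.exp_sum, ← Real.exp_sum, ← Real.exp_nat_mul] at h
  exact Real.exp_injective h

lemma ss_abs (F : Fin k → ℝ) (b : ℝ) (h : ∀ i, |F i| ≤ b) (S : Ix k q) : |ss F S| ≤ k * b := by
  rcases Nat.eq_zero_or_pos k with rfl | hk
  · have : S.1 = ∅ := Finset.eq_empty_of_isEmpty _
    simp [ss, this]
  have hb : 0 ≤ b := (abs_nonneg _).trans (h ⟨0, hk⟩)
  refine (Finset.abs_sum_le_sum_abs _ _).trans ?_
  refine (Finset.sum_le_card_nsmul _ _ b fun i _ => h i).trans ?_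
  rw [nsmul_eq_mul]
  have : S.1.card ≤ k := by
    have := Finset.card_le_univ S.1
    simpa using this
  have : (S.1.card : ℝ) ≤ k := by exact_mod_cast this
  gcongr

/-- image of an index under a permutation -/
def pix (π : Equiv.Perm (Fin k)) (S : Ix k q) : Ix k q :=
  ⟨S.1.map π.toEmbedding, by
    have h := S.2
    rw [Set.powersetCard.mem_iff] at h ⊢
    rw [Finset.card_map, h]⟩

lemma ss_pix (π : Equiv.Perm (Fin k)) (F : Fin k → ℝ) (S : Ix k q) :
    ss (fun i => F (π.symm i)) (pix π S) = ss F S := by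
  simp [ss, pix, Finset.sum_map]

end

lemma ir_cmp {n q : ℕ} (α : Fin (n + 1) → ℝ) (U : Matrix (Fin (n + 1)) (Fin (n + 1)) ℤ) :
    cmp q (AM α) * ir (cmp q U) = cmp q (AM α * ir U) := by
  rw [cmp_mul]
  congr 1
  exact (cmp_map (Int.castRingHom ℝ) U).symm

theorem Red.ineq {n : ℕ} {α : Fin (n + 1) → ℝ} {C δ0 l : ℝ}
    {U : Matrix (Fin (n + 1)) (Fin (n + 1)) ℤ}
    {π : Equiv.Perm (Fin (n + 1))} {lam : Fin (n + 1) → ℝ} (hα : α 0 = 1) (hC : 1 ≤ C)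
    (H : Red α C δ0 l U π lam) (q : ℕ) (hq : 0 < q) (hqn : q < n + 1) (δ η B : ℝ) (hη0 : 0 < η)
    (hη : δ = 2 * Fintype.card (Ix (n + 1) q) * η)
    (hgap : lam ⟨n + 1 - q - 1, by omega⟩ ≤ Real.exp (-(δ * l)) * lam ⟨n + 1 - q, by omega⟩)
    (c0 : ℕ) (hc0 : ∀ F : Fin (n + 1) → ℝ, ∑ S : Ix (n + 1) q, ss F S = c0 * ∑ i, F i)
    (hl0 : 0 < l)
    (hl : Real.log (q.factorial : ℝ) + c0 * (Real.log C + Real.log ((n + 1).factorial : ℝ))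
      + Real.log C ≤ η / 2 * l)
    (hB : B = 2 * (n + 1) ^ 2 + (n + 1 + 2 + Fintype.card (Ix (n + 1) q)) * η) :
    ∃ c : Ix (n + 1) q → ℝ, ∑ s, c s = 0 ∧ (∀ s, |c s| ≤ B) ∧
      ∀ σ S, |(cmp q (AM α) * ir (cmp q U)) σ S| ≤ Real.exp (l * c σ) *
        (if S = topIx (n + 1) q hqn.le then Real.exp (l * B) else Real.exp (-(l * (η / 2)))) := by
  classical
  set T := topIx (n + 1) q hqn.le with hT
  set Λ : Fin (n + 1) → ℝ := fun i => Real.log (lam i) with hΛ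
  have hlam : lam = fun i => Real.exp (Λ i) := by
    funext i
    simp only [hΛ]
    rw [Real.exp_log (H.pos i)]
  set Λ' : Fin (n + 1) → ℝ := fun i => Λ (π.symm i) with hΛ'
  set E : Fin (n + 1) → ℝ := fun i => if i = 0 then n * l else -l with hE
  have hdd : dd n l = fun i => Real.exp (E i) := by
    funext i
    simp only [dd, hE]
    split_ifs <;> rfl
  set N : ℝ := (Fintype.card (Ix (n + 1) q) : ℝ) with hN
  have hN1 : 1 ≤ N := by
    have : 0 < Fintype.card (Ix (n + 1) q) := Fintype.card_pos_iff.2 ⟨T⟩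
    rw [hN]
    exact_mod_cast this
  set lq : ℝ := Real.log (q.factorial : ℝ) with hlq
  have hlq0 : 0 ≤ lq := Real.log_nonneg (by exact_mod_cast Nat.factorial_pos q)
  have hlC0 : 0 ≤ Real.log C := Real.log_nonneg hC
  have hlk0 : 0 ≤ Real.log ((n + 1).factorial : ℝ) :=
    Real.log_nonneg (by exact_mod_cast Nat.factorial_pos _)
  set κ : ℝ := c0 * ∑ i, Λ i with hκ
  have hκabs : |κ| ≤ c0 * (Real.log C + Real.log ((n + 1).factorial : ℝ)) := by
    rw [hκ, abs_mul, Nat.abs_cast]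
    have h1 := H.sum_le
    have h2 := H.sum_ge hα
    refine mul_le_mul_of_nonneg_left (abs_le.2 ⟨?_, ?_⟩) (Nat.cast_nonneg _)
    · change _ ≤ ∑ i, Real.log (lam i)
      linarith
    · change ∑ i, Real.log (lam i) ≤ _
      linarith
  have hκ1 := (abs_le.1 hκabs).1
  have hκ2 := (abs_le.1 hκabs).2
  have hcc : 0 ≤ c0 * (Real.log C + Real.log ((n + 1).factorial : ℝ)) := (abs_nonneg _).trans hκabs
  -- the basic bounds
  have hcmp : ∀ σ S, |cmp q (AM α * ir U) σ S| * Real.exp (ss E σ) = |cmp q (gM α l * ir U) σ S| := by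
    intro σ S
    rw [gM, Matrix.mul_assoc, cmp_mul (Matrix.diagonal (dd n l)), cmp_diagonal, Matrix.diagonal_mul, hdd, wt_exp, abs_mul,
      abs_of_pos (Real.exp_pos _), mul_comm]
  have hfac : ((q.factorial : ℕ) : ℝ) = Real.exp lq := by
    rw [hlq, Real.exp_log (by exact_mod_cast Nat.factorial_pos q)]
  have hrow : ∀ σ S, |cmp q (gM α l * ir U) σ S| ≤ Real.exp (lq + ss Λ' σ) := by
    intro σ S
    have h1 := cmp_bound_row (q := q) (gM α l * ir U) 1 (fun i => Real.exp (Λ' i)) (by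
      intro i j
      have := H.row (π.symm i) j
      rw [Equiv.apply_symm_apply] at this
      rw [one_mul]
      refine this.trans (le_of_eq ?_)
      rw [hlam]) σ S
    rwa [one_pow, mul_one, wt_exp, hfac, ← Real.exp_add] at h1
  have hcol : ∀ σ S, |cmp q (gM α l * ir U) σ S| ≤ Real.exp (lq + ss Λ S) := by
    intro σ S
    have h1 := cmp_bound_col (q := q) (gM α l * ir U) 1 (fun i => Real.exp (Λ i)) (by
      intro i j
      rw [one_mul]
      refine (H.col i j).trans (le_of_eq ?_)
      rw [hlam]) σ S
    rwa [one_pow, mul_one, wt_exp, hfac, ← Real.exp_add] at h1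
  have hrow' : ∀ σ S, |cmp q (AM α * ir U) σ S| ≤ Real.exp (lq + ss Λ' σ - ss E σ) := by
    intro σ S
    rw [Real.exp_sub, le_div_iff₀ (Real.exp_pos _), hcmp]
    exact hrow σ S
  have hcol' : ∀ σ S, |cmp q (AM α * ir U) σ S| ≤ Real.exp (lq + ss Λ S - ss E σ) := by
    intro σ S
    rw [Real.exp_sub, le_div_iff₀ (Real.exp_pos _), hcmp]
    exact hcol σ S
  have hST : ∀ S, S ≠ T → ss Λ S ≤ ss Λ T - δ * l := by
    intro S hS
    have h1 := wt_le_top hqn.le hq hqn lam H.pos H.mono _ hgap S hS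
    rw [hlam, wt_exp, wt_exp, ← Real.exp_add, Real.exp_le_exp, ← hT] at h1
    linarith
  set σ0 := pix π T with hσ0
  have hσ0s : ss Λ' σ0 = ss Λ T := ss_pix π Λ T
  let cl : Ix (n + 1) q → ℝ := fun σ => -ss E σ + ss Λ' σ + η * l -
    (if σ = σ0 then N * η * l + κ else 0)
  have hcl0 : ∑ σ, cl σ = 0 := by
    simp only [cl]
    rw [Finset.sum_sub_distrib, Finset.sum_add_distrib, Finset.sum_add_distrib,
      Finset.sum_neg_distrib, hc0, hc0, Finset.sum_const, Finset.card_univ, nsmul_eq_mul,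
      Finset.sum_ite_eq' Finset.univ σ0, if_pos (Finset.mem_univ _)]
    have h1 : ∑ i, E i = 0 := by
      rw [hE, Fin.sum_univ_succ]
      simp
    have h2 : ∑ i, Λ' i = ∑ i, Λ i := Equiv.sum_comp π.symm Λ
    rw [h1, h2, hκ]
    ring
  have hEabs : ∀ i, |E i| ≤ (n + 1) * l := by
    intro i
    simp only [hE]
    have : 0 ≤ n * l := by positivity
    split_ifs
    · rw [abs_of_nonneg this]
      linarith
    · rw [abs_neg, abs_of_pos hl0]
      linarith
  have hΛabs : ∀ i, |Λ' i| ≤ Real.log C + (n + 1) * l := by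
    intro i
    have h1 := H.log_ge hα hl0.le (π.symm i)
    have h2 := H.log_le hα hl0.le (π.symm i)
    have : 0 ≤ n * l := by positivity
    refine abs_le.2 ⟨?_, ?_⟩
    · change _ ≤ Real.log (lam (π.symm i))
      linarith
    · change Real.log (lam (π.symm i)) ≤ _
      linarith
  have hclabs : ∀ σ, |cl σ| ≤ B * l := by
    intro σ
    have h1 := abs_le.1 (ss_abs E _ hEabs σ)
    have h2 := abs_le.1 (ss_abs Λ' _ hΛabs σ)
    push_cast at h1 h2
    have h3 : (n + 1) * Real.log C ≤ (n + 1) * (η / 2 * l) := by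
      gcongr
      linarith
    have h4 : 0 ≤ η * l := by positivity
    have h5 : 0 ≤ N * η * l := by positivity
    have h6 : 0 ≤ (n : ℝ) * (η * l) := by positivity
    rw [hB]
    simp only [cl]
    split_ifs
    · refine abs_le.2 ⟨?_, ?_⟩ <;> linarith
    · refine abs_le.2 ⟨?_, ?_⟩ <;> linarith
  refine ⟨fun σ => cl σ / l, ?_, ?_, ?_⟩
  · rw [← Finset.sum_div, hcl0, zero_div]
  · intro σ
    rw [abs_div, abs_of_pos hl0, div_le_iff₀ hl0]
    exact hclabs σ
  · intro σ S
    rw [ir_cmp, mul_div_cancel₀ _ hl0.ne']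
    have h4 : 0 ≤ η * l := by positivity
    have h5 : 0 ≤ N * η * l := by positivity
    have h6 : η * l ≤ N * η * l := by nlinarith
    by_cases hS : S = T
    · rw [if_pos hS, ← Real.exp_add]
      refine (hrow' σ S).trans (Real.exp_le_exp.2 ?_)
      have h7 : 0 ≤ 2 * ((n : ℝ) + 1) ^ 2 * l := by positivity
      have h8 : 0 ≤ (n : ℝ) * (η * l) := by positivity
      have h9 : N * η * l + 3 * (η * l) ≤ l * B := by rw [hB]; linarith
      simp only [cl]
      split_ifs <;> linarith
    · rw [if_neg hS, ← Real.exp_add]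
      by_cases hσ : σ = σ0
      · refine (hcol' σ S).trans (Real.exp_le_exp.2 ?_)
        simp only [cl]
        rw [if_pos hσ, hσ, hσ0s]
        have h7 := hST S hS
        have h8 : δ * l = 2 * (N * η * l) := by rw [hη]; ring
        linarith
      · refine (hrow' σ S).trans (Real.exp_le_exp.2 ?_)
        simp only [cl]
        rw [if_neg hσ]
        linarith

end Sch


namespace Sch
open MvPolynomial

section
variable {n : ℕ}

lemma AI_one_mul (α : Fin (n + 1) → ℝ) (hα : α 0 = 1) : AI 1 α * AM α = 1 := by
  have := AI_mul_AM 1 α hα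
  simpa using this

lemma AI_smul (N : ℝ) (α : Fin (n + 1) → ℝ) :
    AI N (fun i => N * α i) = AI 1 α * Matrix.diagonal (fun _ => N) := by
  ext i j
  rw [Matrix.mul_diagonal]
  simp only [AI, Matrix.of_apply]
  split_ifs <;> ring

lemma wt_const {k q : ℕ} {R : Type*} [CommMonoid R] (N : R) (S : Ix k q) :
    wt (fun _ => N) S = N ^ q := by
  simp [wt]

lemma adj_apply (G : Matrix (Fin (n + 1)) (Fin (n + 1)) ℝ) (i j) :
    G.adjugate j i = (G.updateCol j (Pi.single i 1)).det := by
  rw [← Matrix.cramer_apply, Matrix.cramer_eq_adjugate_mulVec]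
  simp

variable {α : Fin (n + 1) → ℝ} {C δ0 l : ℝ} {U : Matrix (Fin (n + 1)) (Fin (n + 1)) ℤ}
  {π : Equiv.Perm (Fin (n + 1))} {lam : Fin (n + 1) → ℝ}

lemma Red.inv_bound (hα : α 0 = 1) (H : Red α C δ0 l U π lam)
    (V : Matrix (Fin (n + 1)) (Fin (n + 1)) ℝ) (hV : V * (gM α l * ir U) = 1) (j i) :
    |V j i| ≤ ((n + 1).factorial * C) * (lam j)⁻¹ := by
  set G := gM α l * ir U with hG
  have h0 : V * G.det • 1 = G.adjugate := by
    rw [← Matrix.mul_adjugate, ← Matrix.mul_assoc, hV, one_mul]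
  have h1 : |V j i| = |G.adjugate j i| := by
    rw [← h0, Matrix.mul_smul, Matrix.mul_one, Matrix.smul_apply, smul_eq_mul, abs_mul, H.det hα,
      one_mul]
  rw [h1, adj_apply]
  have h2 := det_bound_col (G.updateCol j (Pi.single i 1)) 1 (Function.update lam j 1) (by
    intro a b
    rw [one_mul]
    by_cases hb : b = j
    · subst hb
      rw [Matrix.updateCol_self, Function.update_self]
      by_cases ha : a = i
      · subst ha
        simp
      · simp [ha]
    · rw [Matrix.updateCol_ne hb, Function.update_of_ne hb]
      exact H.col a b)
  refine h2.trans ?_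
  rw [one_pow, mul_one, mul_assoc]
  refine mul_le_mul_of_nonneg_left ?_ (Nat.cast_nonneg _)
  rw [← div_eq_mul_inv, le_div_iff₀ (H.pos j)]
  refine le_trans (le_of_eq ?_) H.prod_le
  rw [Finset.prod_update_of_mem (Finset.mem_univ j), one_mul, mul_comm,
    ← Finset.mul_prod_erase Finset.univ lam (Finset.mem_univ j), Finset.sdiff_singleton_eq_erase]

lemma Red.wt_top_ge (hα : α 0 = 1) (H : Red α C δ0 l U π lam) (q : ℕ) (hq : 0 < q)
    (hqn : q < n + 1) (c0 : ℕ)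
    (hc0 : ∀ f : Fin (n + 1) → ℝ, ∏ S : Ix (n + 1) q, wt f S = (∏ i, f i) ^ c0) :
    (((n + 1).factorial : ℝ)⁻¹) ^ c0 ≤ wt lam (topIx (n + 1) q hqn.le) := by
  set T := topIx (n + 1) q hqn.le with hT
  have hfac : (1 : ℝ) ≤ (n + 1).factorial := by exact_mod_cast Nat.factorial_pos _
  have hpos : ∀ S : Ix (n + 1) q, 0 < wt lam S := fun S => Finset.prod_pos fun s _ => H.pos _
  have hle : ∀ S : Ix (n + 1) q, wt lam S ≤ wt lam T := by
    intro S
    by_cases hS : S = T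
    · rw [hS]
    · have := wt_le_top hqn.le hq hqn lam H.pos H.mono 1 (by
        rw [one_mul]
        apply H.mono
        rw [Fin.le_def]
        simp) S hS
      rwa [one_mul] at this
  have h1 : (((n + 1).factorial : ℝ)⁻¹) ^ c0 ≤ wt lam T ^ Fintype.card (Ix (n + 1) q) := by
    have h2 : ((n + 1).factorial : ℝ)⁻¹ ≤ ∏ i, lam i := by
      rw [inv_le_iff_one_le_mul₀' (by positivity)]
      exact H.prod_ge hα
    refine (pow_le_pow_left₀ (by positivity) h2 c0).trans ?_
    rw [← hc0]
    refine (Finset.prod_le_prod (fun S _ => (hpos S).le) fun S _ => hle S).trans ?_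
    rw [Finset.prod_const, Finset.card_univ]
  by_contra hcon
  push Not at hcon
  have h3 : (((n + 1).factorial : ℝ)⁻¹) ^ c0 ≤ 1 :=
    pow_le_one₀ (by positivity) (inv_le_one_of_one_le₀ hfac)
  have h4 : 0 < Fintype.card (Ix (n + 1) q) := Fintype.card_pos_iff.2 ⟨T⟩
  have h5 := pow_le_of_le_one (hpos T).le (hcon.le.trans h3) h4.ne'
  linarith

lemma exists_sigma (V Y : Matrix (Fin (n + 1)) (Fin (n + 1)) ℝ) (hVY : V * Y = 1)
    (h00 : Y 0 0 ≠ 0) (q : ℕ) (T : Ix (n + 1) q) (hT : ∀ s, em T s ≠ 0) :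
    ∃ σ : Ix (n + 1) q, (∀ s, em σ s ≠ 0) ∧ cmp q V T σ ≠ 0 := by
  classical
  obtain ⟨i, hi⟩ := exists_det_ne_zero (K := ℝ) (I := {i : Fin (n + 1) // i ≠ 0})
    (fun i (l : Fin q) => V (em T l) i) (by
    intro y hy
    set w : Fin (n + 1) → ℝ := fun i => ∑ l, y l * V (em T l) i with hw
    have hw0 : ∀ i, i ≠ 0 → w i = 0 := fun i hi => hy ⟨i, hi⟩
    have hwY : ∀ m, w 0 * Y 0 m = ∑ l, y l * (1 : Matrix (Fin (n + 1)) (Fin (n + 1)) ℝ) (em T l) m := by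
      intro m
      rw [← hVY]
      have h1 : ∑ i, w i * Y i m = w 0 * Y 0 m := by
        rw [Finset.sum_eq_single 0]
        · intro i _ hi
          rw [hw0 i hi, zero_mul]
        · simp
      rw [← h1]
      simp only [hw, Finset.sum_mul, Matrix.mul_apply, Finset.mul_sum, mul_assoc]
      exact Finset.sum_comm
    have hc : w 0 = 0 := by
      have h1 := hwY 0
      rw [Finset.sum_eq_zero] at h1
      · exact (mul_eq_zero.1 h1).resolve_right h00
      · intro l _
        rw [Matrix.one_apply_ne (hT l), mul_zero]
    funext l0
    have h1 := hwY (em T l0)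
    rw [hc, zero_mul, Finset.sum_eq_single l0, Matrix.one_apply_eq, mul_one] at h1
    · exact h1.symm
    · intro b _ hb
      rw [Matrix.one_apply_ne, mul_zero]
      intro h
      exact hb ((em T).injective h)
    · simp)
  obtain ⟨S, hS1, hS2⟩ := exists_sorted (fun i (l : Fin q) => V (em T l) i) (fun s => (i s).1) hi
  refine ⟨S, ?_, ?_⟩
  · intro s hs
    obtain ⟨a, ha⟩ := hS1 s
    exact (i a).2 (ha.trans hs)
  · have h1 : cmp q V T S = (Matrix.of fun a l => V (em T l) (em S a)).det := by
      rw [cmp, Matrix.of_apply, ← Matrix.det_transpose]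
      rfl
    rw [h1]
    exact hS2

lemma wt_dd_le (l : ℝ) (hl : 0 ≤ l) (q : ℕ) (hq : 0 < q) (σ : Ix (n + 1) q)
    (hσ : ∀ s, em σ s ≠ 0) : wt (dd n l) σ ≤ Real.exp (-l) := by
  have : wt (dd n l) σ = Real.exp (-l) ^ q := by
    rw [wt, Finset.prod_congr rfl (g := fun _ => Real.exp (-l))]
    · simp
    · intro s _
      rw [dd, if_neg (hσ s)]
  rw [this]
  exact pow_le_of_le_one (Real.exp_pos _).le (Real.exp_le_one_iff.2 (by linarith)) hq.ne'

end

theorem height {R : Type} [CommRing R] [IsDomain R] {D : ℕ} (bs : Module.Basis (Fin D) ℤ R)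
    (φ : R →+* ℝ) {n : ℕ} (α : Fin (n + 1) → ℝ) (hα : α 0 = 1)
    (hind : ∀ x : Fin (n + 1) → ℤ, x ≠ 0 → ∑ i, α i * (x i : ℝ) ≠ 0)
    (N : ℤ) (hN : N ≠ 0) (a : Fin (n + 1) → R) (ha : ∀ i, φ (a i) = N * α i)
    (C : ℝ) (hC : 1 ≤ C) (q : ℕ) (hq : 0 < q) (hqn : q < n + 1) :
    ∃ L : ℝ, ∀ l ≥ L, ∀ δ0 U π lam, Red α C δ0 l U π lam →
      ∀ W : Matrix (Fin (n + 1)) (Fin (n + 1)) ℤ, W * U = 1 →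
      ∃ j, 1 / (2 * ((D : ℝ) + 1)) * l ≤ Real.log |((cmp q W (topIx (n + 1) q hqn.le) j : ℤ) : ℝ)| := by
  classical
  obtain ⟨c, hc, hliou⟩ := liouville bs φ
  obtain ⟨c0, hc0⟩ := prod_wt (n + 1) q
  set T := topIx (n + 1) q hqn.le with hT
  have hT0 : ∀ s, em T s ≠ 0 := by
    intro s hs
    have h1 := em_topIx (k := n + 1) hqn.le s
    rw [← hT, hs] at h1
    simp at h1
    omega
  set A := cmp q (AI (N : R) a) with hA
  set C3 : ℝ := q.factorial * ((n + 1).factorial * C) ^ q * ((n + 1).factorial : ℝ) ^ c0 with hC3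
  set C4 : ℝ := 1 + ∑ σ, ∑ S, sz bs (A S σ) with hC4
  set C6 : ℝ := |(N : ℝ)| ^ q * C3 * C4 ^ D with hC6
  have hC40 : 1 ≤ C4 := by
    have : 0 ≤ ∑ σ, ∑ S, sz bs (A S σ) :=
      Finset.sum_nonneg fun σ _ => Finset.sum_nonneg fun S _ => apply_nonneg _ _
    linarith
  have hNR : (N : ℝ) ≠ 0 := by exact_mod_cast hN
  have hC60 : 0 < C6 := by
    have : 0 < C := by linarith
    have : 0 < C4 := by linarith
    positivity
  refine ⟨max 0 (2 * Real.log (C6 / c) + 1), ?_⟩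
  intro l hl δ0 U π lam H W hWU
  have hl0 : 0 ≤ l := (le_max_left _ _).trans hl
  have hl1 : 2 * Real.log (C6 / c) + 1 ≤ l := (le_max_right _ _).trans hl
  set c' : ℝ := 1 / (2 * ((D : ℝ) + 1)) with hc'
  have hc'0 : 0 < c' := by positivity
  by_contra hcon
  push Not at hcon
  have hZ : ∀ j, |((cmp q W T j : ℤ) : ℝ)| ≤ Real.exp (c' * l) := by
    intro j
    by_cases h0 : |((cmp q W T j : ℤ) : ℝ)| = 0
    · rw [h0]; positivity
    · rw [← Real.log_le_iff_le_exp (lt_of_le_of_ne (abs_nonneg _) (Ne.symm h0))]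
      exact (hcon j).le
  -- real inverse
  set P := ir W * AI 1 α with hP
  have hirWU : ir W * ir U = 1 := by
    have := congrArg (fun M => Matrix.map M (Int.castRingHom ℝ)) hWU
    simp only [Matrix.map_mul] at this
    rw [ir, ir, this]
    simp
  have hPY : P * (AM α * ir U) = 1 := by
    rw [hP, Matrix.mul_assoc, ← Matrix.mul_assoc (AI 1 α), AI_one_mul α hα, Matrix.one_mul, hirWU]
  set V := P * Matrix.diagonal (fun i => (dd n l i)⁻¹) with hV
  have hdd1 : Matrix.diagonal (fun i => (dd n l i)⁻¹) * Matrix.diagonal (dd n l) = 1 := by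
    rw [Matrix.diagonal_mul_diagonal, ← Matrix.diagonal_one]
    congr 1
    funext i
    exact inv_mul_cancel₀ (dd_pos l i).ne'
  have hVG : V * (gM α l * ir U) = 1 := by
    rw [hV, gM, Matrix.mul_assoc, Matrix.mul_assoc (Matrix.diagonal (dd n l)),
      ← Matrix.mul_assoc (Matrix.diagonal fun i => (dd n l i)⁻¹), hdd1, Matrix.one_mul, hPY]
  have hPV : P = V * Matrix.diagonal (dd n l) := by
    rw [hV, Matrix.mul_assoc, hdd1, Matrix.mul_one]
  have hY00 : (AM α * ir U) 0 0 ≠ 0 := by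
    rw [AM_mul_zero]
    exact hind (fun i => U i 0) (H.col_ne 0)
  obtain ⟨σ, hσ0, hσ⟩ := exists_sigma P (AM α * ir U) hPY hY00 q T hT0
  have hwtpos : 0 < wt lam T := Finset.prod_pos fun s _ => H.pos _
  have hPb : |cmp q P T σ| ≤ C3 * Real.exp (-l) := by
    rw [hPV, cmp_mul, cmp_diagonal, Matrix.mul_diagonal, abs_mul]
    have h1 := cmp_bound_row (q := q) V ((n + 1).factorial * C) (fun i => (lam i)⁻¹)
      (fun j i => H.inv_bound hα V hVG j i) T σ
    have h2 : wt (fun i => (lam i)⁻¹) T ≤ ((n + 1).factorial : ℝ) ^ c0 := by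
      have h3 := H.wt_top_ge hα q hq hqn c0 hc0
      have h4 : wt (fun i => (lam i)⁻¹) T = (wt lam T)⁻¹ := by
        simp only [wt, Finset.prod_inv_distrib]
      rw [h4]
      rw [inv_pow] at h3
      exact inv_le_of_inv_le₀ (by positivity) h3
    have h5 : |cmp q V T σ| ≤ C3 := by
      refine h1.trans ?_
      rw [hC3]
      gcongr
    have h6 : |wt (dd n l) σ| ≤ Real.exp (-l) := by
      have h7 : 0 < wt (dd n l) σ := Finset.prod_pos fun s _ => dd_pos l _
      rw [abs_of_pos h7]
      exact wt_dd_le l hl0 q hq σ hσ0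
    exact mul_le_mul h5 h6 (abs_nonneg _) ((abs_nonneg _).trans h5)
  -- the algebraic number
  set x : R := ∑ S, (cmp q W T S) • A S σ with hx
  have hφx : φ x = (N : ℝ) ^ q * cmp q P T σ := by
    have h1 : cmp q (ir W * AI (N : ℝ) (fun i => N * α i)) T σ = (N : ℝ) ^ q * cmp q P T σ := by
      rw [AI_smul, ← Matrix.mul_assoc, ← hP, cmp_mul, cmp_diagonal, Matrix.mul_diagonal, wt_const,
        mul_comm]
    rw [← h1, cmp_mul, Matrix.mul_apply, hx, map_sum]
    refine Finset.sum_congr rfl fun S _ => ?_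
    have h2 : AI (N : ℝ) (fun i => N * α i) = (AI (N : R) a).map φ := by
      rw [AI_map]
      simp only [ha, map_intCast]
    have h3 : cmp q (ir W) = ir (cmp q W) := cmp_map (Int.castRingHom ℝ) W
    rw [h2, h3, cmp_map, zsmul_eq_mul, map_mul, map_intCast]
    rfl
  have hx0 : x ≠ 0 := by
    intro h0
    rw [h0, map_zero] at hφx
    exact mul_ne_zero (pow_ne_zero q hNR) hσ hφx.symm
  have hsz : sz bs x ≤ C4 * Real.exp (c' * l) := by
    have h1 : sz bs x ≤ ∑ S, sz bs ((cmp q W T S) • A S σ) := by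
      rw [hx]
      exact Finset.le_sum_of_subadditive _ (map_zero _).le (map_add_le_add _) _ _
    refine h1.trans ?_
    have h2 : ∀ S ∈ Finset.univ, sz bs ((cmp q W T S) • A S σ) ≤ Real.exp (c' * l) * sz bs (A S σ) := by
      intro S _
      refine (sn_zsmul (sz bs) _ _).trans ?_
      exact mul_le_mul_of_nonneg_right (hZ S) (apply_nonneg _ _)
    refine (Finset.sum_le_sum h2).trans ?_
    rw [← Finset.mul_sum, mul_comm]
    refine mul_le_mul_of_nonneg_right ?_ (Real.exp_pos _).le
    have h3 : ∑ S, sz bs (A S σ) ≤ ∑ σ, ∑ S, sz bs (A S σ) :=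
      Finset.single_le_sum (f := fun σ => ∑ S, sz bs (A S σ))
        (fun σ _ => Finset.sum_nonneg fun S _ => apply_nonneg _ _) (Finset.mem_univ σ)
    linarith
  have hs1 : 1 ≤ C4 * Real.exp (c' * l) := by
    have : 1 ≤ Real.exp (c' * l) := Real.one_le_exp (by positivity)
    nlinarith
  have hfin := hliou x hx0 _ hs1 hsz
  rw [hφx, abs_mul, abs_pow] at hfin
  have h7 : c / (C4 * Real.exp (c' * l)) ^ D ≤ |(N : ℝ)| ^ q * (C3 * Real.exp (-l)) :=
    hfin.trans (mul_le_mul_of_nonneg_left hPb (by positivity))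
  rw [div_le_iff₀ (by positivity), mul_pow, ← Real.exp_nat_mul] at h7
  have h8 : c ≤ C6 * Real.exp (-l + D * (c' * l)) := by
    rw [Real.exp_add]
    refine h7.trans (le_of_eq ?_)
    rw [hC6]
    ring
  have h9 : -l + D * (c' * l) ≤ -(l / 2) := by
    have : D * c' ≤ 1 / 2 := by
      rw [hc', mul_one_div, div_le_div_iff₀ (by positivity) (by norm_num)]
      linarith
    nlinarith
  have h10 : c ≤ C6 * Real.exp (-(l / 2)) :=
    h8.trans (mul_le_mul_of_nonneg_left (Real.exp_le_exp.2 h9) hC60.le)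
  have h11 : Real.exp (l / 2) ≤ C6 / c := by
    rw [le_div_iff₀ hc]
    calc Real.exp (l / 2) * c ≤ Real.exp (l / 2) * (C6 * Real.exp (-(l / 2))) := by gcongr
      _ = C6 * (Real.exp (l / 2) * Real.exp (-(l / 2))) := by ring
      _ = C6 := by rw [← Real.exp_add]; simp
  have h12 := Real.log_le_log (Real.exp_pos _) h11
  rw [Real.log_exp] at h12
  linarith

end Sch


namespace Sch
open MvPolynomial

lemma key {n : ℕ} (α : Fin (n + 1) → ℝ) (hα : α 0 = 1) (halg : ∀ i, IsAlgebraic ℚ (α i))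
    (hind : ∀ x : Fin (n + 1) → ℤ, x ≠ 0 → ∑ i, α i * (x i : ℝ) ≠ 0)
    (C : ℝ) (hC : 1 ≤ C) (δ0 δ : ℝ) (hδ : 0 < δ) (p : Fin n) :
    ∃ L : ℝ, ∀ l ≥ L, ∀ U π lam, Red α C δ0 l U π lam →
      ¬ (Real.log (lam p.castSucc) ≤ Real.log (lam p.succ) - δ * l) := by
  classical
  obtain ⟨R, _, _, D, bs, φ, N, a, hφ, hN, ha⟩ := exists_ring α halg
  have hp := p.2
  obtain ⟨q, hqdef⟩ : ∃ q : ℕ, q = n - p := ⟨_, rfl⟩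
  have hq : 0 < q := by omega
  have hqn : q < n + 1 := by omega
  obtain ⟨L1, hL1⟩ := height bs φ α hα hind N hN a ha C hC q hq hqn
  obtain ⟨c0, hc0⟩ := sum_ss (n + 1) q
  have hcard : 0 < Fintype.card (Ix (n + 1) q) :=
    Fintype.card_pos_iff.2 ⟨topIx (n + 1) q hqn.le⟩
  have hcardR : (0 : ℝ) < Fintype.card (Ix (n + 1) q) := by exact_mod_cast hcard
  haveI : Nonempty (Ix (n + 1) q) := ⟨topIx (n + 1) q hqn.le⟩
  obtain ⟨η, hηdef⟩ : ∃ η : ℝ, η = δ / (2 * Fintype.card (Ix (n + 1) q)) := ⟨_, rfl⟩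
  have hη0 : 0 < η := by rw [hηdef]; positivity
  have hη : δ = 2 * Fintype.card (Ix (n + 1) q) * η := by
    rw [hηdef]
    field_simp
  obtain ⟨B, hB⟩ : ∃ B : ℝ, B = 2 * (n + 1) ^ 2 + (n + 1 + 2 + Fintype.card (Ix (n + 1) q)) * η :=
    ⟨_, rfl⟩
  have hB0 : 0 < B := by rw [hB]; positivity
  have hM : (cmp q (AI (N : R) a)).map φ * cmp q (AM α) = (((N ^ q : ℤ)) : ℝ) • 1 := by
    rw [← cmp_map, AI_map, ← cmp_mul]
    have h1 : AI (φ (N : R)) (fun i => φ (a i)) * AM α = Matrix.diagonal (fun _ => (N : ℝ)) := by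
      simp only [ha, map_intCast]
      rw [AI_mul_AM _ α hα]
      ext i j
      simp [Matrix.diagonal_apply, Matrix.one_apply]
    rw [h1, cmp_diagonal]
    ext i j
    simp [Matrix.diagonal_apply, Matrix.one_apply, wt_const]
  have hcore := core bs φ (cmp q (AM α)) (cmp q (AI (N : R) a)) (N ^ q) (pow_ne_zero q hN) hM
    (η / 2) B (1 / (2 * ((D : ℝ) + 1))) (by positivity) hB0 (by positivity)
  have hcore' : ∃ l0 : ℝ, ∀ l ≥ l0, ¬ Bad (cmp q (AM α)) (η / 2) B (1 / (2 * ((D : ℝ) + 1))) l := by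
    by_contra hcon
    push Not at hcon
    exact hcore hcon
  obtain ⟨l0, hl0⟩ := hcore'
  obtain ⟨L2, hL2⟩ : ∃ L2 : ℝ, L2 = (Real.log (q.factorial : ℝ) + c0 * (Real.log C +
    Real.log ((n + 1).factorial : ℝ)) + Real.log C) / (η / 2) := ⟨_, rfl⟩
  refine ⟨max (max l0 L1) (max 1 L2), ?_⟩
  intro l hl U π lam H hgap
  have hll0 : l0 ≤ l := (le_max_left _ _).trans ((le_max_left _ _).trans hl)
  have hlL1 : L1 ≤ l := (le_max_right _ _).trans ((le_max_left _ _).trans hl)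
  have hl1 : 1 ≤ l := (le_max_left _ _).trans ((le_max_right _ _).trans hl)
  have hlL2 : L2 ≤ l := (le_max_right _ _).trans ((le_max_right _ _).trans hl)
  apply hl0 l hll0
  have hgap' : lam ⟨n + 1 - q - 1, by omega⟩ ≤ Real.exp (-(δ * l)) * lam ⟨n + 1 - q, by omega⟩ := by
    have e1 : (⟨n + 1 - q - 1, by omega⟩ : Fin (n + 1)) = p.castSucc := by
      apply Fin.ext
      simp
      omega
    have e2 : (⟨n + 1 - q, by omega⟩ : Fin (n + 1)) = p.succ := by
      apply Fin.ext
      simp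
      omega
    rw [e1, e2]
    rw [← Real.log_le_log_iff (H.pos _) (mul_pos (Real.exp_pos _) (H.pos _)),
      Real.log_mul (Real.exp_pos _).ne' (H.pos _).ne', Real.log_exp]
    linarith
  obtain ⟨c, hc1, hc2, hc3⟩ := H.ineq hα hC q hq hqn δ η B hη0 hη hgap' c0 hc0 (by linarith) (by
    rw [hL2, div_le_iff₀ (by positivity)] at hlL2
    linarith) hB
  have hU1 : U * U⁻¹ = 1 := Matrix.mul_nonsing_inv U H.unit
  have hU2 : U⁻¹ * U = 1 := Matrix.nonsing_inv_mul U H.unit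
  obtain ⟨j, hj⟩ := hL1 l hlL1 δ0 U π lam H U⁻¹ hU2
  refine ⟨cmp q U, cmp q U⁻¹, topIx (n + 1) q hqn.le, j, c, ?_, hc1, hc2, hc3, hj⟩
  rw [← cmp_mul, hU1, cmp_one]

theorem no_bad {n : ℕ} (α : Fin (n + 1) → ℝ) (hα : α 0 = 1) (halg : ∀ i, IsAlgebraic ℚ (α i))
    (hind : ∀ x : Fin (n + 1) → ℤ, x ≠ 0 → ∑ i, α i * (x i : ℝ) ≠ 0) (δ0 : ℝ) (hδ0 : 0 < δ0) :
    ∃ L : ℝ, ∀ l ≥ L, ∀ x : Fin (n + 1) → ℤ, x ≠ 0 →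
      Real.exp (-(l * δ0)) < ‖(gM α l).mulVec (iv x)‖ := by
  obtain ⟨C, hC, hred⟩ := red_exists α hα
  have hδ : 0 < δ0 / (2 * ((n : ℝ) + 1)) := by positivity
  choose L hL using key α hα halg hind C hC δ0 (δ0 / (2 * ((n : ℝ) + 1))) hδ
  obtain ⟨L', hL'⟩ : ∃ L' : ℝ, ∀ p, L p ≤ L' := by
    obtain ⟨M, hM⟩ := (Set.finite_range L).bddAbove
    exact ⟨M, fun p => hM ⟨p, rfl⟩⟩
  refine ⟨max L' (max 0 (Real.log ((n + 1).factorial : ℝ) / (δ0 / 2) + 1)), ?_⟩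
  intro l hl x hx
  have h1 : L' ≤ l := (le_max_left _ _).trans hl
  have h2 : 0 ≤ l := (le_max_left _ _).trans ((le_max_right _ _).trans hl)
  have h3 : Real.log ((n + 1).factorial : ℝ) / (δ0 / 2) < l := by
    have : Real.log ((n + 1).factorial : ℝ) / (δ0 / 2) + 1 ≤ l :=
      (le_max_right _ _).trans ((le_max_right _ _).trans hl)
    linarith
  rw [div_lt_iff₀ (by positivity)] at h3
  by_contra hcon
  push Not at hcon
  obtain ⟨U, π, lam, H⟩ := hred δ0 l ⟨x, hx, hcon⟩
  obtain ⟨p, hp⟩ := H.gap hα h3 hδ0 h2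
  exact hL p l ((hL' p).trans h1) U π lam H hp

theorem schmidt {n : ℕ} (α : Fin (n + 1) → ℝ) (hα : α 0 = 1) (halg : ∀ i, IsAlgebraic ℚ (α i))
    (hind : ∀ x : Fin (n + 1) → ℤ, x ≠ 0 → ∑ i, α i * (x i : ℝ) ≠ 0) (ε : ℝ) (hε : 0 < ε) :
    ∃ K : ℝ, 0 < K ∧ ∀ x : Fin (n + 1) → ℤ, x ≠ 0 → ∀ X : ℝ, 1 ≤ X → (∀ i, |(x i : ℝ)| ≤ X) →
      K / X ^ ((n : ℝ) + ε) ≤ |∑ i, α i * (x i : ℝ)| := by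
  obtain ⟨e, he⟩ : ∃ e : ℝ, e = ε / (n + 1) := ⟨_, rfl⟩
  have he0 : 0 < e := by rw [he]; positivity
  have hee : (n + 1) * e = ε := by
    rw [he]
    field_simp
  obtain ⟨δ0, hδ⟩ : ∃ δ0 : ℝ, δ0 = e / (1 + e) := ⟨_, rfl⟩
  have hδ0 : 0 < δ0 := by rw [hδ]; positivity
  have hδ1 : δ0 * (1 + e) = e := by
    rw [hδ]
    field_simp
  have hδ2 : δ0 ≤ 1 := by
    rw [hδ, div_le_one (by positivity)]
    linarith
  obtain ⟨L, hL⟩ := no_bad α hα halg hind δ0 hδ0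
  set l1 := max 0 L with hl1
  have hl10 : 0 ≤ l1 := le_max_left _ _
  refine ⟨Real.exp (-(l1 * (n + δ0))), Real.exp_pos _, ?_⟩
  intro x hx X hX hxX
  have hX0 : 0 < X := by linarith
  set y := Real.log X with hy
  have hy0 : 0 ≤ y := Real.log_nonneg hX
  set l := (1 + e) * y + l1 with hl
  have hlL : L ≤ l := by
    have : 0 ≤ (1 + e) * y := by positivity
    have : L ≤ l1 := le_max_right _ _
    linarith
  have hlδ : l * δ0 = e * y + l1 * δ0 := by
    rw [hl]
    linear_combination y * hδ1
  have hmain := hL l hlL x hx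
  have hR : Real.exp (-(l1 * (n + δ0))) / X ^ ((n : ℝ) + ε) = Real.exp (-(n * l)) * Real.exp (-(l * δ0)) := by
    rw [Real.rpow_def_of_pos hX0, ← Real.exp_sub, ← Real.exp_add, ← hy, hlδ, hl, ← hee]
    congr 1
    ring
  rw [hR]
  by_contra hcon
  push Not at hcon
  refine absurd hmain (not_lt.2 ?_)
  rw [pi_norm_le_iff_of_nonneg (Real.exp_pos _).le]
  intro i
  rw [Real.norm_eq_abs, gM, ← Matrix.mulVec_mulVec, Matrix.mulVec_diagonal, abs_mul,
    abs_of_pos (dd_pos l i)]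
  by_cases hi : i = 0
  · subst hi
    have h1 : (AM α).mulVec (iv x) 0 = ∑ i, α i * (x i : ℝ) := by
      simp [Matrix.mulVec, dotProduct, AM, iv]
    rw [h1, dd, if_pos rfl]
    calc Real.exp (n * l) * |∑ i, α i * (x i : ℝ)|
        ≤ Real.exp (n * l) * (Real.exp (-(n * l)) * Real.exp (-(l * δ0))) := by gcongr
      _ = Real.exp (-(l * δ0)) := by
        rw [← mul_assoc, ← Real.exp_add, add_neg_cancel, Real.exp_zero, one_mul]
  · have h1 : (AM α).mulVec (iv x) i = (x i : ℝ) := by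
      simp [Matrix.mulVec, dotProduct, AM, iv, hi]
    rw [h1, dd, if_neg hi]
    calc Real.exp (-l) * |(x i : ℝ)| ≤ Real.exp (-l) * X := by gcongr; exact hxX i
      _ = Real.exp (-l + y) := by rw [Real.exp_add, hy, Real.exp_log hX0]
      _ ≤ Real.exp (-(l * δ0)) := by
        rw [Real.exp_le_exp, hlδ, hl]
        nlinarith

end Sch


namespace Sch
open MvPolynomial

lemma exists_good_basis (d m : ℕ) (n : Fin d → ℝ) (i0 : Fin d) (h1 : n i0 = 1)
    (hdim : Module.finrank ℚ (Submodule.span ℚ (Set.range n)) = m + 1) :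
    ∃ α : Fin (m + 1) → ℝ, α 0 = 1 ∧ (∀ j, ∃ i, α j = n i) ∧ LinearIndependent ℚ α ∧
      ∀ i, n i ∈ Submodule.span ℚ (Set.range α) := by
  classical
  have hs : LinearIndepOn ℚ id ({(1 : ℝ)} : Set ℝ) := by
    apply LinearIndepOn.singleton
    simp
  obtain ⟨b, hbt, hsb, htb, hb⟩ := exists_linearIndepOn_id_extension hs
    (t := Set.range n) (by rintro _ rfl; exact ⟨i0, h1⟩)
  have hspan : Submodule.span ℚ b = Submodule.span ℚ (Set.range n) :=
    le_antisymm (Submodule.span_mono hbt) (Submodule.span_le.2 htb)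
  haveI : Fintype b := ((Set.finite_range n).subset hbt).fintype
  have hcard : Fintype.card b = m + 1 := by
    rw [← hdim, ← hspan, finrank_span_set_eq_card hb, Set.toFinset_card]
  let e0 : Fin (m + 1) ≃ b := (Fintype.equivFinOfCardEq hcard).symm
  let o : b := ⟨1, hsb rfl⟩
  let e : Fin (m + 1) ≃ b := (Equiv.swap 0 (e0.symm o)).trans e0
  have he : e 0 = o := by simp [e]
  refine ⟨fun j => (e j : ℝ), by simp [he, o], ?_, ?_, ?_⟩
  · intro j
    obtain ⟨i, hi⟩ := hbt (e j).2
    exact ⟨i, hi.symm⟩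
  · exact LinearIndependent.comp hb e e.injective
  · intro i
    have : Set.range (fun j => (e j : ℝ)) = b := by
      rw [show (fun j => (e j : ℝ)) = Subtype.val ∘ e from rfl, e.surjective.range_comp,
        Subtype.range_coe]
    rw [this]
    exact htb ⟨i, rfl⟩

lemma exists_int_coeff (d m : ℕ) (n : Fin d → ℝ) (α : Fin (m + 1) → ℝ)
    (h : ∀ i, n i ∈ Submodule.span ℚ (Set.range α)) :
    ∃ (N : ℤ) (z : Fin d → Fin (m + 1) → ℤ), N ≠ 0 ∧
      ∀ i, (N : ℝ) * n i = ∑ j, α j * (z i j : ℝ) := by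
  have h1 : ∀ i, ∃ r : Fin (m + 1) → ℚ, ∑ j, r j • α j = n i := fun i =>
    (Submodule.mem_span_range_iff_exists_fun ℚ).1 (h i)
  choose r hr using h1
  obtain ⟨N, hN⟩ := IsLocalization.exist_integer_multiples_of_finite (nonZeroDivisors ℤ)
    (fun ij : Fin d × Fin (m + 1) => r ij.1 ij.2)
  choose z hz using hN
  refine ⟨N, fun i j => z (i, j), nonZeroDivisors.ne_zero N.2, fun i => ?_⟩
  rw [← hr, Finset.mul_sum]
  refine Finset.sum_congr rfl fun j _ => ?_
  have h2 := hz (i, j)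
  simp only [algebraMap_int_eq, eq_intCast, zsmul_eq_mul] at h2
  have h3 : ((z (i, j) : ℤ) : ℝ) = ((N : ℤ) : ℝ) * (r i j : ℝ) := by
    exact_mod_cast congrArg (fun t : ℚ => (t : ℝ)) h2
  rw [h3, Rat.smul_def]
  ring

end Sch

theorem stmt14 (d k : ℕ) (hk : 2 ≤ k) (hkd : k ≤ d) (n : Fin d → ℝ)
    (hlast : n ⟨d - 1, by omega⟩ = 1) (halg : ∀ i, IsAlgebraic ℚ (n i))
    (hdim : Module.finrank ℚ (Submodule.span ℚ (Set.range n)) = k) :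
    ∀ ε > (0 : ℝ), ∃ K > (0 : ℝ), ∀ R : ℝ, 1 < R → ∀ c c' : Fin d → ℤ,
      Real.sqrt (∑ i, ((c i : ℝ) - (c' i : ℝ)) ^ 2) ≤ 2 * R →
      (∑ i, ((c i : ℝ) - (c' i : ℝ)) * n i) ≠ 0 →
      K / R ^ ((k : ℝ) - 1 + ε) ≤
        |∑ i, ((c i : ℝ) - (c' i : ℝ)) * (n i / Real.sqrt (∑ j, n j ^ 2))| := by
  intro ε hε
  obtain ⟨m, rfl⟩ : ∃ m, k = m + 1 := ⟨k - 1, by omega⟩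
  obtain ⟨α, hα0, hαn, hαind, hspan⟩ := Sch.exists_good_basis d m n _ hlast hdim
  obtain ⟨N, z, hN, hz⟩ := Sch.exists_int_coeff d m n α hspan
  have hαalg : ∀ i, IsAlgebraic ℚ (α i) := by
    intro i
    obtain ⟨j, hj⟩ := hαn i
    rw [hj]
    exact halg j
  have hind : ∀ x : Fin (m + 1) → ℤ, x ≠ 0 → ∑ i, α i * (x i : ℝ) ≠ 0 := by
    intro x hx h0
    apply hx
    have h1 := Fintype.linearIndependent_iff.1 hαind (fun i => (x i : ℚ)) (by
      rw [← h0]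
      refine Finset.sum_congr rfl fun i _ => ?_
      rw [Rat.smul_def, mul_comm]
      simp)
    funext i
    exact_mod_cast h1 i
  obtain ⟨K, hK, hS⟩ := Sch.schmidt α hα0 hαalg hind ε hε
  set A : ℝ := 1 + 2 * ∑ i, ∑ j, |(z i j : ℝ)| with hA
  have hsum0 : 0 ≤ ∑ i, ∑ j, |(z i j : ℝ)| :=
    Finset.sum_nonneg fun i _ => Finset.sum_nonneg fun j _ => abs_nonneg _
  have hA1 : 1 ≤ A := by linarith
  have hA0 : 0 < A := by linarith
  set nn : ℝ := Real.sqrt (∑ j, n j ^ 2) with hnn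
  have hnn0 : 0 < nn := by
    apply Real.sqrt_pos.2
    refine Finset.sum_pos' (fun i _ => sq_nonneg _) ⟨⟨d - 1, by omega⟩, Finset.mem_univ _, ?_⟩
    rw [hlast]
    norm_num
  have hNR : 0 < |(N : ℝ)| := abs_pos.2 (by exact_mod_cast hN)
  have hAp : 0 < A ^ ((m : ℝ) + ε) := Real.rpow_pos_of_pos hA0 _
  refine ⟨K / A ^ ((m : ℝ) + ε) / (|(N : ℝ)| * nn), by positivity, ?_⟩
  intro R hR c c' hcc hne
  have hR0 : 0 < R := by linarith
  set x : Fin (m + 1) → ℤ := fun j => ∑ i, (c i - c' i) * z i j with hx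
  have hsumx : ∑ j, α j * (x j : ℝ) = N * ∑ i, ((c i : ℝ) - (c' i : ℝ)) * n i := by
    simp only [hx]
    push_cast
    simp only [Finset.mul_sum]
    rw [Finset.sum_comm]
    refine Finset.sum_congr rfl fun i _ => ?_
    have := hz i
    calc ∑ j, α j * (((c i : ℝ) - c' i) * z i j)
        = ((c i : ℝ) - c' i) * ∑ j, α j * (z i j : ℝ) := by
          rw [Finset.mul_sum]
          exact Finset.sum_congr rfl fun j _ => by ring
      _ = N * (((c i : ℝ) - c' i) * n i) := by
          rw [← this]
          ring
  have hx0 : x ≠ 0 := by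
    intro h0
    have h1 : ∑ j, α j * (x j : ℝ) = 0 := by
      rw [h0]
      simp
    rw [hsumx] at h1
    rcases mul_eq_zero.1 h1 with h2 | h2
    · exact hN (by exact_mod_cast h2)
    · exact hne h2
  have hci : ∀ i, |(c i : ℝ) - c' i| ≤ 2 * R := by
    intro i
    refine le_trans ?_ hcc
    rw [← Real.sqrt_sq_eq_abs]
    apply Real.sqrt_le_sqrt
    exact Finset.single_le_sum (f := fun i => ((c i : ℝ) - (c' i : ℝ)) ^ 2)
      (fun i _ => sq_nonneg _) (Finset.mem_univ i)
  have hxX : ∀ j, |(x j : ℝ)| ≤ A * R := by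
    intro j
    have h1 : |(x j : ℝ)| ≤ ∑ i, 2 * R * |(z i j : ℝ)| := by
      simp only [hx]
      push_cast
      refine (Finset.abs_sum_le_sum_abs _ _).trans (Finset.sum_le_sum fun i _ => ?_)
      rw [abs_mul]
      exact mul_le_mul_of_nonneg_right (hci i) (abs_nonneg _)
    have h2 : ∑ i, |(z i j : ℝ)| ≤ ∑ i, ∑ j, |(z i j : ℝ)| :=
      Finset.sum_le_sum fun i _ => Finset.single_le_sum (f := fun j => |(z i j : ℝ)|)
        (fun j _ => abs_nonneg _) (Finset.mem_univ j)
    rw [← Finset.mul_sum] at h1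
    have h3 : 2 * R * ∑ i, |(z i j : ℝ)| ≤ 2 * R * ∑ i, ∑ j, |(z i j : ℝ)| :=
      mul_le_mul_of_nonneg_left h2 (by positivity)
    rw [hA]
    nlinarith
  have hfin := hS x hx0 (A * R) (by nlinarith) hxX
  rw [hsumx, abs_mul, Real.mul_rpow hA0.le hR0.le] at hfin
  have hgoal : |∑ i, ((c i : ℝ) - (c' i : ℝ)) * (n i / nn)| =
      |∑ i, ((c i : ℝ) - (c' i : ℝ)) * n i| / nn := by
    have : ∑ i, ((c i : ℝ) - (c' i : ℝ)) * (n i / nn) =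
        (∑ i, ((c i : ℝ) - (c' i : ℝ)) * n i) / nn := by
      rw [Finset.sum_div]
      exact Finset.sum_congr rfl fun i _ => by ring
    rw [this, abs_div, abs_of_pos hnn0]
  have hexp : (((m + 1 : ℕ) : ℝ) - 1 + ε) = (m : ℝ) + ε := by
    push_cast
    ring
  rw [hgoal, hexp, le_div_iff₀ hnn0]
  have hRp : 0 < R ^ ((m : ℝ) + ε) := Real.rpow_pos_of_pos hR0 _
  have h5 : K / A ^ ((m : ℝ) + ε) / (|(N : ℝ)| * nn) / R ^ ((m : ℝ) + ε) * nn =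
      K / (A ^ ((m : ℝ) + ε) * R ^ ((m : ℝ) + ε)) / |(N : ℝ)| := by
    field_simp
  rw [h5, div_le_iff₀ hNR, mul_comm |∑ i, ((c i : ℝ) - (c' i : ℝ)) * n i|]
  exact hfin
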